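/- Let g be a complete Riemannian metric without conjugate points on ℝ² and let p ∈ ℝ². Then the function A_p : (0,∞) → (0,∞) is smooth and non-decreasing, A_p'(r) = H¹(∂B(p,r)) for every r > 0, and A_p''(r) = 2π − ∫_{B(p,r)} K dA for every r > 0. -/

import Mathlib

open MeasureTheory Filter Set Real
open scoped ENNReal NNReal

noncomputable section

/-- Points / tangent vectors of the plane. -/
abbrev V2 : Type := Fin 2 → ℝ

/-- Componentwise velocity of a curve in the plane. -/
def vel (γ : ℝ → V2) (t : ℝ) : V2 := fun k => deriv (fun s => γ s k) t

/-- Componentwise acceleration of a curve in the plane. -/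
def acc (γ : ℝ → V2) (t : ℝ) : V2 := fun k => deriv (fun s => vel γ s k) t

/-- The deck transformation `τⁿ(x,y) = (x+n,y)`. -/
def shift (n : ℤ) (p : V2) : V2 := p + (n : ℝ) • (Pi.single 0 1 : V2)

/-- A (smooth) Riemannian metric on the plane ℝ²: a smooth family of
positive-definite symmetric matrices. -/
structure RMetric where
  g : V2 → Matrix (Fin 2) (Fin 2) ℝ
  smooth : ∀ i j, ContDiff ℝ (⊤ : ℕ∞) fun p => g p i j
  symm : ∀ p, (g p).IsSymm
  posDef : ∀ p, (g p).PosDef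

/-- `B` has tangent direction `τ` at `p`. -/
def TangentDirAt (B : Set V2) (p τ : V2) : Prop :=
  τ ≠ 0 ∧ ∀ ε > 0, ∃ δ > 0, ∀ q ∈ B, q ≠ p → ‖q - p‖ < δ →
    ∃ s : ℝ, ‖q - p - s • τ‖ ≤ ε * ‖q - p‖

/-- `B` is, near `x`, after a bi-Lipschitz change of coordinates, the graph of a
Lipschitz function. -/
def IsLipGraphAt (B : Set V2) (x : V2) : Prop :=
  ∃ U : Set V2, IsOpen U ∧ x ∈ U ∧
    ∃ (φ : V2 → ℝ × ℝ) (ψ : ℝ × ℝ → V2) (L : NNReal) (f : ℝ → ℝ),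
      LipschitzOnWith L φ U ∧ LipschitzOnWith L ψ (φ '' U) ∧
      (∀ y ∈ U, ψ (φ y) = y) ∧ LipschitzWith L f ∧
      ∀ y ∈ U, (y ∈ B ↔ (φ y).2 = f (φ y).1)

/-- A (compact) 1-dimensional strong Lipschitz submanifold of the plane. -/
def IsStrongLipschitzCurve (B : Set V2) : Prop := ∀ x ∈ B, IsLipGraphAt B x

/-- `Q` is the closure of its interior and its boundary `Q \ int Q` is a
1-dimensional strong Lipschitz submanifold. -/
def HasStrongLipschitzBoundary (Q : Set V2) : Prop :=
  Q = closure (interior Q) ∧ IsStrongLipschitzCurve (Q \ interior Q)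

/-- Absolute continuity of `F` on `[a,b]`. -/
def AbsContOn (F : ℝ → ℝ) (a b : ℝ) : Prop :=
  ∀ ε > 0, ∃ δ > 0, ∀ n : ℕ, ∀ I : Fin n → ℝ × ℝ,
    (∀ i, a ≤ (I i).1 ∧ (I i).1 ≤ (I i).2 ∧ (I i).2 ≤ b) →
    (∀ i j, i ≠ j → Disjoint (Set.Ioo (I i).1 (I i).2) (Set.Ioo (I j).1 (I j).2)) →
    (∑ i, ((I i).2 - (I i).1)) < δ → (∑ i, |F (I i).2 - F (I i).1|) < ε

/-- Local absolute continuity on a set: absolute continuity on every compact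
subinterval. -/
def LocAbsContOn (F : ℝ → ℝ) (s : Set ℝ) : Prop :=
  ∀ a ∈ s, ∀ b ∈ s, a ≤ b → AbsContOn F a b

namespace RMetric

variable (M : RMetric)

/-- The inner product `g_p(v,w)`. -/
def met (p v w : V2) : ℝ := ∑ i, ∑ j, M.g p i j * v i * w j

/-- The unit tangent bundle `T¹ = {(p,v) : g_p(v,v) = 1}`. -/
def UnitTangent : Set (V2 × V2) := {x | M.met x.1 x.2 x.2 = 1}

/-- Riemannian length of a `C¹` curve. -/
def curveLen (γ : ℝ → V2) (a b : ℝ) : ℝ :=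
  ∫ t in a..b, Real.sqrt (M.met (γ t) (vel γ t) (vel γ t))

/-- The Riemannian distance: infimum of lengths of `C¹` curves joining the points. -/
def dist (p q : V2) : ℝ :=
  sInf {L | ∃ γ : ℝ → V2, ContDiff ℝ 1 γ ∧ γ 0 = p ∧ γ 1 = q ∧ L = M.curveLen γ 0 1}

/-- Completeness of the induced metric space. -/
def Complete : Prop :=
  ∀ u : ℕ → V2, (∀ ε > 0, ∃ N, ∀ m ≥ N, ∀ n ≥ N, M.dist (u m) (u n) < ε) →
    ∃ p, Tendsto (fun n => M.dist (u n) p) atTop (nhds 0)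

/-- Open metric ball. -/
def ball (p : V2) (r : ℝ) : Set V2 := {q | M.dist p q < r}

/-- Metric sphere. -/
def sphere (p : V2) (r : ℝ) : Set V2 := {q | M.dist p q = r}

/-- Coordinate derivative `∂_d g_{ij}`. -/
def dg (d i j : Fin 2) (p : V2) : ℝ :=
  deriv (fun s : ℝ => M.g (p + s • (Pi.single d 1 : V2)) i j) 0

/-- Christoffel symbols `Γ^k_{ij}`. -/
def Γ (k i j : Fin 2) (p : V2) : ℝ :=
  (1 / 2) * ∑ l, (M.g p)⁻¹ k l * (M.dg i j l p + M.dg j i l p - M.dg l i j p)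

/-- Coordinate derivative `∂_d Γ^k_{ij}`. -/
def dΓ (d k i j : Fin 2) (p : V2) : ℝ :=
  deriv (fun s : ℝ => M.Γ k i j (p + s • (Pi.single d 1 : V2))) 0

/-- Gaussian curvature `K = R_{1212} / det g`. -/
def K (p : V2) : ℝ :=
  (∑ l, M.g p 0 l *
      (M.dΓ 0 l 1 1 p - M.dΓ 1 l 0 1 p +
        ∑ m, (M.Γ l 0 m p * M.Γ m 1 1 p - M.Γ l 1 m p * M.Γ m 0 1 p))) /
    (M.g p).det

/-- Flatness: vanishing Gaussian curvature. -/
def Flat : Prop := ∀ p, M.K p = 0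

/-- A geodesic of `g`: a `C²` solution of the geodesic equation. -/
def IsGeodesic (γ : ℝ → V2) : Prop :=
  ContDiff ℝ 2 γ ∧
    ∀ t, ∀ k, acc γ t k + ∑ i, ∑ j, M.Γ k i j (γ t) * vel γ t i * vel γ t j = 0

/-- Unit-speed curve. -/
def UnitSpeed (γ : ℝ → V2) : Prop := ∀ t, M.met (γ t) (vel γ t) (vel γ t) = 1

/-- No conjugate points: every nontrivial solution of the Jacobi equation along a
unit-speed geodesic vanishing at `a` vanishes nowhere else. -/
def NoConjugatePoints : Prop :=
  ∀ γ : ℝ → V2, M.IsGeodesic γ → M.UnitSpeed γ →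
    ∀ J : ℝ → ℝ, ContDiff ℝ 2 J →
      (∀ t, deriv (deriv J) t + M.K (γ t) * J t = 0) →
      (∃ t₀, J t₀ ≠ 0) → ∀ a, J a = 0 → ∀ t, t ≠ a → J t ≠ 0

/-- Riemannian area measure: density `√(det g)` with respect to Lebesgue measure. -/
def area : Measure V2 := volume.withDensity fun p => ENNReal.ofReal (Real.sqrt (M.g p).det)

/-- `Φ` is the geodesic flow of `g` on the unit tangent bundle. -/
def IsGeodesicFlow (Φ : V2 × V2 → ℝ → V2 × V2) : Prop :=
  ∀ x ∈ M.UnitTangent, Φ x 0 = x ∧ M.IsGeodesic (fun t => (Φ x t).1) ∧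
    ∀ t : ℝ, (Φ x t).2 = vel (fun s => (Φ x s).1) t

/-- First vector of the Gram-Schmidt `g`-orthonormal frame. -/
def E1 (p : V2) : V2 :=
  (Real.sqrt (M.met p (Pi.single 0 1) (Pi.single 0 1)))⁻¹ • (Pi.single 0 1 : V2)

def w2 (p : V2) : V2 :=
  (Pi.single 1 1 : V2) - (M.met p (Pi.single 1 1) (M.E1 p)) • M.E1 p

/-- Second vector of the Gram-Schmidt `g`-orthonormal frame. -/
def E2 (p : V2) : V2 := (Real.sqrt (M.met p (M.w2 p) (M.w2 p)))⁻¹ • M.w2 p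

/-- The `g`-unit tangent vector at `p` of angle `θ` (arclength parametrization of
the `g_p`-unit circle). -/
def unitVec (p : V2) (θ : ℝ) : V2 := Real.cos θ • M.E1 p + Real.sin θ • M.E2 p

/-- The Liouville measure on the unit tangent bundle: locally the product of the
area measure with the arclength (angle) measure on the fibers; `σ_* μ = 2π A`. -/
def liouville : Measure (V2 × V2) :=
  Measure.map (fun x : V2 × ℝ => (x.1, M.unitVec x.1 x.2))
    (M.area.prod (volume.restrict (Set.Ico 0 (2 * π))))

/-- Diameter with respect to the Riemannian distance. -/
def ediam (S : Set V2) : ℝ≥0∞ := ⨆ p ∈ S, ⨆ q ∈ S, ENNReal.ofReal (M.dist p q)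

/-- 1-dimensional Hausdorff measure (as an outer-measure set function) with
respect to the Riemannian distance. -/
def H1 (S : Set V2) : ℝ≥0∞ :=
  ⨆ (δ : ℝ) (_ : 0 < δ),
    ⨅ (U : ℕ → Set V2) (_ : S ⊆ ⋃ n, U n) (_ : ∀ n, M.ediam (U n) ≤ ENNReal.ofReal δ),
      ∑' n, M.ediam (U n)

/-- The "tube" in the unit tangent bundle over `S` with angles in `Θ`. -/
def tube (S : Set V2) (Θ : Set ℝ) : Set (V2 × V2) :=
  (fun x : V2 × ℝ => (x.1, M.unitVec x.1 x.2)) '' (S ×ˢ Θ)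

/-- `ν` is the measure on `σ⁻¹(B)` which is locally the product of the
1-dimensional Hausdorff measure on `B` with the angle measure on the fibers. -/
def IsNuOn (B : Set V2) (ν : Measure (V2 × V2)) : Prop :=
  ν {x : V2 × V2 | x.1 ∉ B} = 0 ∧
    ∀ S : Set V2, ∀ Θ : Set ℝ, S ⊆ B → MeasurableSet Θ → Θ ⊆ Set.Ico 0 (2 * π) →
      ν (M.tube S Θ) = M.H1 S * volume Θ

/-- Locally bounded function on the unit tangent bundle. -/
def LocBddUT (f : V2 × V2 → ℝ) : Prop :=
  ∀ R : ℝ, ∃ Cb : ℝ, ∀ x ∈ M.UnitTangent, ‖x.1‖ ≤ R → |f x| ≤ Cb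

/-- Locally bounded function on `T¹ × ℝ`. -/
def LocBddHopf (u : (V2 × V2) × ℝ → ℝ) : Prop :=
  ∀ R : ℝ, ∃ Cb : ℝ, ∀ x ∈ M.UnitTangent, ‖x.1‖ ≤ R → ∀ t : ℝ, |t| ≤ R → |u (x, t)| ≤ Cb

/-- The function `u` produced by E. Hopf's construction: Borel measurable, locally
bounded, solving the Riccati equation along every unit-speed geodesic, and
invariant under the geodesic flow. -/
def IsHopfSolution (Φ : V2 × V2 → ℝ → V2 × V2) (u : (V2 × V2) × ℝ → ℝ) : Prop :=
  Measurable u ∧ M.LocBddHopf u ∧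
    (∀ x ∈ M.UnitTangent, ∀ t : ℝ,
      HasDerivAt (fun s => u (x, s)) (-(u (x, t)) ^ 2 - M.K ((Φ x t).1)) t) ∧
    ∀ x ∈ M.UnitTangent, ∀ s t : ℝ, u (x, s + t) = u (Φ x s, t)

/-- `n` is the inner (w.r.t. `Q`) unit normal of the curve `B` at `p`. -/
def IsInnerUnitNormalAt (Q B : Set V2) (p n : V2) : Prop :=
  M.met p n n = 1 ∧ (∃ τ, TangentDirAt B p τ ∧ M.met p n τ = 0) ∧
    ∀ᶠ t in nhdsWithin (0 : ℝ) (Set.Ioi 0), p + t • n ∈ interior Q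

end RMetric

/-- A Riemannian metric on the cylinder `C = S¹ × ℝ`, modeled by a metric on ℝ²
invariant under the translation `τ(x,y) = (x+1,y)`. -/
structure CylMetric where
  M : RMetric
  invariant : ∀ p, M.g (shift 1 p) = M.g p

/-- τ-invariant subsets of ℝ², i.e. subsets of the cylinder. -/
def InvSet (S : Set V2) : Prop := ∀ p, p ∈ S ↔ shift 1 p ∈ S

/-- The fundamental strip `[0,1) × ℝ`. -/
def strip : Set V2 := {p : V2 | p 0 ∈ Set.Ico (0 : ℝ) 1}

namespace CylMetric

variable (C : CylMetric)

/-- The distance on the cylinder: `d(p,q) = min_n d̃(p̃, τⁿ q̃)`. -/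
def cdist (p q : V2) : ℝ := ⨅ n : ℤ, C.M.dist p (shift n q)

/-- Metric ball in the cylinder. -/
def cball (p : V2) (r : ℝ) : Set V2 := {q | C.cdist p q < r}

/-- Metric sphere in the cylinder. -/
def csphere (p : V2) (r : ℝ) : Set V2 := {q | C.cdist p q = r}

/-- Completeness of the cylinder. -/
def Complete : Prop :=
  ∀ u : ℕ → V2, (∀ ε > 0, ∃ N, ∀ m ≥ N, ∀ n ≥ N, C.cdist (u m) (u n) < ε) →
    ∃ p, Tendsto (fun n => C.cdist (u n) p) atTop (nhds 0)

/-- Area measure on the cylinder, computed in the fundamental strip. -/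
def carea (S : Set V2) : ℝ≥0∞ := C.M.area (S ∩ strip)

/-- The length `l(p)` of a shortest non-contractible loop based at `p`:
`l(p) = min_{n ≠ 0} d̃(p̃, τⁿ p̃)`. -/
def loopLen (p : V2) : ℝ := ⨅ n : {n : ℤ // n ≠ 0}, C.M.dist p (shift n.1 p)

/-- Diameter with respect to the cylinder distance. -/
def ediamC (S : Set V2) : ℝ≥0∞ := ⨆ p ∈ S, ⨆ q ∈ S, ENNReal.ofReal (C.cdist p q)

/-- 1-dimensional Hausdorff measure of a (τ-invariant) subset of the cylinder. -/
def cH1 (S : Set V2) : ℝ≥0∞ :=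
  ⨆ (δ : ℝ) (_ : 0 < δ),
    ⨅ (U : ℕ → Set V2) (_ : S ∩ strip ⊆ ⋃ n, U n)
      (_ : ∀ n, C.ediamC (U n) ≤ ENNReal.ofReal δ),
      ∑' n, C.ediamC (U n)

/-- Distance from a point to a set in the cylinder. -/
def cinfDist (p : V2) (S : Set V2) : ℝ := ⨅ q : S, C.cdist p (q : V2)

/-- A neighborhood of the end `ℰ₊` (`pos = true`) resp. `ℰ₋` (`pos = false`). -/
def EndNbhd (U : Set V2) (pos : Bool) : Prop :=
  InvSet U ∧ ∃ c : ℝ, 0 < c ∧ ∀ p : V2, (if pos then c < p 1 else p 1 < -c) → p ∈ U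

/-- The end has subquadratic area growth. -/
def Subquadratic (pos : Bool) : Prop :=
  ∃ U : Set V2, EndNbhd U pos ∧ ∃ p : V2,
    Filter.liminf (fun r : ℝ => C.carea (U ∩ C.cball p r) / ENNReal.ofReal (r ^ 2)) atTop = 0

/-- A sequence converging to the end `ℰ₊` resp. `ℰ₋`. -/
def TendstoEnd (p : ℕ → V2) (pos : Bool) : Prop :=
  Tendsto (fun i => p i 1) atTop (if pos then atTop else atBot)

/-- The end opens less than linearly. -/
def OpensLessThanLinearly (pos : Bool) : Prop :=
  ∃ p : ℕ → V2, TendstoEnd p pos ∧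
    Tendsto (fun i => C.loopLen (p i) / C.cdist (p i) (p 0)) atTop (nhds 0)

/-- A ray in the cylinder. -/
def IsRay (γ : ℝ → V2) : Prop := ∀ s ≥ (0:ℝ), ∀ t ≥ (0:ℝ), C.cdist (γ s) (γ t) = |s - t|

/-- A ray converging to the end `ℰ₊` resp. `ℰ₋`. -/
def RayToEnd (γ : ℝ → V2) (pos : Bool) : Prop :=
  C.IsRay γ ∧ Tendsto (fun t => γ t 1) atTop (if pos then atTop else atBot)

/-- A minimal geodesic line in the cylinder. -/
def IsMinimalLine (γ : ℝ → V2) : Prop :=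
  C.M.IsGeodesic γ ∧ ∀ s t : ℝ, C.cdist (γ s) (γ t) = |s - t|

/-- The line joins the two ends of the cylinder. -/
def JoinsEnds (γ : ℝ → V2) : Prop :=
  Tendsto (fun t : ℝ => γ t 1) atTop atTop ∧ Tendsto (fun t : ℝ => γ t 1) atBot atBot

/-- `b` is the Busemann function of the ray `γ`: `b(p) = lim_t (d(p,γ(t)) - t)`. -/
def IsBusemann (γ : ℝ → V2) (b : V2 → ℝ) : Prop :=
  ∀ p : V2, Tendsto (fun t : ℝ => C.cdist p (γ t) - t) atTop (nhds (b p))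

end CylMetric

end

section AutonomousODE

open Metric Topology

variable {E : Type*} [NormedAddCommGroup E] [NormedSpace ℝ E]

/-- `X` solves `X' = F X` on `[0, T]`. -/
def SolvesOn (F : E → E) (X : ℝ → E) (T : ℝ) : Prop :=
  ∀ t ∈ Icc 0 T, HasDerivWithinAt X (F (X t)) (Icc 0 T) t

lemma SolvesOn.continuousOn {F : E → E} {X : ℝ → E} {T : ℝ} (h : SolvesOn F X T) :
    ContinuousOn X (Icc 0 T) := fun t ht => (h t ht).continuousWithinAt

lemma SolvesOn.mono {F : E → E} {X : ℝ → E} {S T : ℝ} (h : SolvesOn F X T) (hST : S ≤ T) :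
    SolvesOn F X S := fun t ht =>
  (h t ⟨ht.1, ht.2.trans hST⟩).mono (Icc_subset_Icc_right hST)

lemma SolvesOn.right {F : E → E} {X : ℝ → E} {T : ℝ} (h : SolvesOn F X T) :
    ∀ t ∈ Ico 0 T, HasDerivWithinAt X (F (X t)) (Ici t) t := fun t ht =>
  (h t ⟨ht.1, ht.2.le⟩).mono_of_mem_nhdsWithin
    (mem_of_superset (Icc_mem_nhdsGE ht.2) (Icc_subset_Icc_left ht.1))

lemma solvesOn_of_hasDerivAt {F : E → E} {X : ℝ → E} (h : ∀ t, HasDerivAt X (F (X t)) t)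
    (T : ℝ) : SolvesOn F X T := fun t _ => (h t).hasDerivWithinAt

/-- A continuous function on `[0, T]` which is small at `0` and reaches the value `n` has a first
time at which it does. -/
lemma exists_first_time {f : ℝ → ℝ} {T n : ℝ} (hf : ContinuousOn f (Icc 0 T)) (h0 : f 0 < n)
    (h : ∃ t ∈ Icc 0 T, n ≤ f t) :
    ∃ τ ∈ Ioc 0 T, f τ = n ∧ ∀ t ∈ Icc 0 τ, f t ≤ n := by
  obtain ⟨t₁, ht₁, hn⟩ := h
  have hcl : IsClosed (Icc 0 T ∩ f ⁻¹' Ici n) := hf.preimage_isClosed_of_isClosed isClosed_Icc isClosed_Ici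
  have hcpt : IsCompact (Icc 0 T ∩ f ⁻¹' Ici n) :=
    isCompact_Icc.of_isClosed_subset hcl inter_subset_left
  obtain ⟨τ, ⟨hτ, hτn⟩, hmin⟩ := hcpt.exists_isLeast ⟨t₁, ht₁, hn⟩
  have hτn : n ≤ f τ := hτn
  have h0τ : 0 < τ := by
    rcases hτ.1.lt_or_eq with h | h
    · exact h
    · rw [← h] at hτn; linarith
  have hlt : ∀ t ∈ Ico 0 τ, f t < n := by
    intro t ht
    by_contra! hc
    exact absurd (hmin ⟨⟨ht.1, ht.2.le.trans hτ.2⟩, hc⟩) (not_le.2 ht.2)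
  have hle : f τ ≤ n := by
    have hc : ContinuousWithinAt f (Ico 0 τ) τ :=
      (hf τ hτ).mono fun t ht => ⟨ht.1, ht.2.le.trans hτ.2⟩
    have : (𝓝[Ico 0 τ] τ).NeBot := by
      rw [← mem_closure_iff_nhdsWithin_neBot, closure_Ico h0τ.ne]
      exact ⟨h0τ.le, le_rfl⟩
    refine le_of_tendsto hc ?_
    filter_upwards [self_mem_nhdsWithin] with t ht using (hlt t ht).le
  refine ⟨τ, ⟨h0τ, hτ.2⟩, le_antisymm hle hτn, fun t ht => ?_⟩
  rcases ht.2.lt_or_eq with h | h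
  · exact (hlt t ⟨ht.1, h⟩).le
  · rw [h]; exact hle

lemma exists_lipschitzOnWith_closedBall [FiniteDimensional ℝ E] {F : E → E} (hF : ContDiff ℝ 1 F)
    (R : ℝ) : ∃ K, LipschitzOnWith K F (closedBall 0 R) := by
  have := FiniteDimensional.proper_real E
  exact hF.contDiffOn.exists_lipschitzOnWith one_ne_zero (convex_closedBall _ _)
    (isCompact_closedBall _ _)

lemma SolvesOn.eqOn [FiniteDimensional ℝ E] {F : E → E} (hF : ContDiff ℝ 1 F) {X Y : ℝ → E} {T : ℝ}
    (hX : SolvesOn F X T) (hY : SolvesOn F Y T) (h0 : X 0 = Y 0) : EqOn X Y (Icc 0 T) := by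
  obtain ⟨R₁, h₁⟩ := (isCompact_Icc.image_of_continuousOn hX.continuousOn).isBounded.exists_norm_le
  obtain ⟨R₂, h₂⟩ := (isCompact_Icc.image_of_continuousOn hY.continuousOn).isBounded.exists_norm_le
  obtain ⟨K, hK⟩ := exists_lipschitzOnWith_closedBall hF (max R₁ R₂)
  refine ODE_solution_unique_of_mem_Icc_right (v := fun _ => F) (s := fun _ => closedBall 0 (max R₁ R₂))
    (fun _ _ => hK) hX.continuousOn hX.right (fun t ht => ?_) hY.continuousOn hY.right
    (fun t ht => ?_) h0
  · rw [mem_closedBall_zero_iff]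
    exact (h₁ _ (mem_image_of_mem _ ⟨ht.1, ht.2.le⟩)).trans (le_max_left _ _)
  · rw [mem_closedBall_zero_iff]
    exact (h₂ _ (mem_image_of_mem _ ⟨ht.1, ht.2.le⟩)).trans (le_max_right _ _)

/-- Either the solution starting at `x₀` exists up to time `T`, or it reaches norm `n`. -/
lemma exists_solvesOn_or_exit [FiniteDimensional ℝ E] {F : E → E} (hF : ContDiff ℝ 1 F) (x₀ : E)
    {T n : ℝ} (hT : 0 ≤ T) (hn : ‖x₀‖ < n) :
    (∃ X, X 0 = x₀ ∧ SolvesOn F X T) ∨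
      ∃ τ ∈ Icc 0 T, ∃ X, X 0 = x₀ ∧ SolvesOn F X τ ∧ ‖X τ‖ = n ∧ ∀ t ∈ Icc 0 τ, ‖X t‖ ≤ n := by
  have := FiniteDimensional.proper_real E
  have hn0 : 0 < n := (norm_nonneg _).trans_lt hn
  let χ : ContDiffBump (0 : E) := ⟨n, n + 1, hn0, by linarith⟩
  have hG : ContDiff ℝ 1 (fun x => χ x • F x) := χ.contDiff.smul hF
  have hGc : HasCompactSupport (fun x => χ x • F x) := χ.hasCompactSupport.smul_right
  obtain ⟨K, hK⟩ := ContDiff.lipschitzWith_of_hasCompactSupport hGc hG one_ne_zero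
  obtain ⟨C, hC⟩ := hG.continuous.bounded_above_of_compact_support hGc
  have hC0 : 0 ≤ C := (norm_nonneg _).trans (hC 0)
  have hPL : IsPicardLindelof (fun _ x => χ x • F x) (tmin := 0) (tmax := T) ⟨0, le_rfl, hT⟩ x₀
      (⟨C, hC0⟩ * ⟨T, hT⟩) 0 ⟨C, hC0⟩ K :=
    { lipschitzOnWith := fun t _ => hK.lipschitzOnWith
      continuousOn := fun _ _ => continuousOn_const
      norm_le := fun _ _ x _ => hC x
      mul_max_le := by
        simp only [sub_zero, sub_self, NNReal.coe_zero]
        rw [max_eq_left hT]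
        exact le_rfl }
  obtain ⟨X, hX0, hX⟩ := hPL.exists_eq_forall_mem_Icc_hasDerivWithinAt₀
  simp only at hX0
  have hcont : ContinuousOn X (Icc 0 T) := fun t ht => (hX t ht).continuousWithinAt
  have key : ∀ τ ≤ T, (∀ t ∈ Icc 0 τ, ‖X t‖ ≤ n) → SolvesOn F X τ := by
    intro τ hτ h t ht
    have := (hX t ⟨ht.1, ht.2.trans hτ⟩).mono (Icc_subset_Icc_right hτ)
    rwa [χ.one_of_mem_closedBall (by rw [mem_closedBall_zero_iff]; exact h t ht), one_smul] at this
  by_cases hex : ∃ t ∈ Icc 0 T, n ≤ ‖X t‖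
  · right
    obtain ⟨τ, hτ, h1, h2⟩ := exists_first_time hcont.norm (by simpa [hX0] using hn) hex
    exact ⟨τ, ⟨hτ.1.le, hτ.2⟩, X, hX0, key τ hτ.2 h2, h1, h2⟩
  · left
    push Not at hex
    exact ⟨X, hX0, key T le_rfl fun t ht => (hex t ht).le⟩

lemma exists_solution_Ici [FiniteDimensional ℝ E] {F : E → E} (hF : ContDiff ℝ 1 F) {x₀ : E}
    (h : ∀ T, 0 ≤ T → ∃ X, X 0 = x₀ ∧ SolvesOn F X T) :
    ∃ X : ℝ → E, X 0 = x₀ ∧ ∀ t, 0 ≤ t → HasDerivWithinAt X (F (X t)) (Ici 0) t := by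
  choose A hA0 hA using fun n : ℕ => h n n.cast_nonneg
  have hag : ∀ n m : ℕ, ∀ t : ℝ, 0 ≤ t → t ≤ n → t ≤ m → A n t = A m t := by
    intro n m t ht hn hm
    exact ((hA n).mono hn).eqOn hF ((hA m).mono hm) ((hA0 n).trans (hA0 m).symm) ⟨ht, le_rfl⟩
  have hX : ∀ n : ℕ, ∀ t : ℝ, 0 ≤ t → t ≤ n → A (⌊t⌋₊ + 1) t = A n t := fun n t ht hn =>
    hag _ _ t ht (by push_cast; exact (Nat.lt_floor_add_one t).le) hn
  refine ⟨fun t => A (⌊t⌋₊ + 1) t, ?_, fun t ht => ?_⟩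
  · simpa using hA0 1
  · have hlt : t < ((⌊t⌋₊ + 1 : ℕ) : ℝ) := by push_cast; exact Nat.lt_floor_add_one t
    have h1 := (hA (⌊t⌋₊ + 1) t ⟨ht, hlt.le⟩)
    have hmem : Icc 0 ((⌊t⌋₊ + 1 : ℕ) : ℝ) ∈ 𝓝[Ici 0] t := by
      rw [← Ici_inter_Iic, inter_comm]
      exact inter_mem_nhdsWithin' hlt
    refine (h1.mono_of_mem_nhdsWithin hmem).congr_of_eventuallyEq ?_ rfl
    filter_upwards [hmem] with s hs using hX _ s hs.1 hs.2
where
  inter_mem_nhdsWithin' {t a : ℝ} (h : t < a) : Iic a ∩ Ici 0 ∈ 𝓝[Ici 0] t :=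
    inter_mem (mem_nhdsWithin_of_mem_nhds (Iic_mem_nhds h)) self_mem_nhdsWithin

lemma exists_global_solution [FiniteDimensional ℝ E] {F : E → E} (hF : ContDiff ℝ 1 F) {x₀ : E}
    (h : ∀ T, 0 ≤ T → ∃ X, X 0 = x₀ ∧ SolvesOn F X T)
    (h' : ∀ T, 0 ≤ T → ∃ X, X 0 = x₀ ∧ SolvesOn (fun x => -F x) X T) :
    ∃ X : ℝ → E, X 0 = x₀ ∧ ∀ t, HasDerivAt X (F (X t)) t := by
  obtain ⟨A, hA0, hA⟩ := exists_solution_Ici hF h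
  obtain ⟨B, hB0, hB⟩ := exists_solution_Ici hF.neg h'
  let X : ℝ → E := fun t => if 0 ≤ t then A t else B (-t)
  have hXp : ∀ t, 0 ≤ t → X t = A t := fun t ht => if_pos ht
  have hXm : ∀ t, t ≤ 0 → X t = B (-t) := by
    intro t ht
    rcases ht.lt_or_eq with h | h
    · exact if_neg (not_le.2 h)
    · rw [h, hXp 0 le_rfl, hA0, neg_zero, hB0]
  have hp : ∀ t, 0 ≤ t → HasDerivWithinAt X (F (X t)) (Ici 0) t := by
    intro t ht
    rw [hXp t ht]
    exact (hA t ht).congr (fun s hs => hXp s hs) (hXp t ht)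
  have hm : ∀ t, t ≤ 0 → HasDerivWithinAt X (F (X t)) (Iic 0) t := by
    intro t ht
    rw [hXm t ht]
    have h1 := hB (-t) (neg_nonneg.2 ht)
    have h2 : HasDerivWithinAt (fun s => B (-s)) ((-1 : ℝ) • -F (B (-t))) (Iic 0) t :=
      h1.scomp t ((hasDerivWithinAt_id t _).neg) (fun s (hs : s ≤ 0) => by
        change (0:ℝ) ≤ -s; linarith)
    rw [neg_smul, one_smul, neg_neg] at h2
    exact h2.congr (fun s hs => hXm s hs) (hXm t ht)
  refine ⟨X, (hXp 0 le_rfl).trans hA0, fun t => ?_⟩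
  rcases lt_trichotomy t 0 with h | h | h
  · exact (hm t h.le).hasDerivAt (Iic_mem_nhds h)
  · subst h
    have := (hp 0 le_rfl).union (hm 0 le_rfl)
    rwa [Ici_union_Iic, hasDerivWithinAt_univ] at this
  · exact (hp t h.le).hasDerivAt (Ici_mem_nhds h)

/-- Local Lipschitz dependence on initial values. -/
lemma exists_dependence [FiniteDimensional ℝ E] {F : E → E} (hF : ContDiff ℝ 1 F) {X : ℝ → E} {T : ℝ}
    (hX : SolvesOn F X T) : ∃ C > 0, ∃ δ > 0, ∀ Y Z : ℝ → E, SolvesOn F Y T → SolvesOn F Z T →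
      ‖Y 0 - X 0‖ < δ → ‖Z 0 - X 0‖ < δ → ∀ t ∈ Icc 0 T, ‖Y t - Z t‖ ≤ C * ‖Y 0 - Z 0‖ := by
  obtain ⟨R, hR⟩ := (isCompact_Icc.image_of_continuousOn hX.continuousOn).isBounded.exists_norm_le
  have hR : ∀ t ∈ Icc 0 T, ‖X t‖ ≤ R := fun t ht => hR _ (mem_image_of_mem _ ht)
  obtain ⟨K, hK⟩ := exists_lipschitzOnWith_closedBall hF (R + 1)
  set C := Real.exp (K * T) with hC
  have gr : ∀ τ ≤ T, ∀ Y Z : ℝ → E, SolvesOn F Y T → SolvesOn F Z T →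
      (∀ t ∈ Icc 0 τ, ‖Y t‖ ≤ R + 1) → (∀ t ∈ Icc 0 τ, ‖Z t‖ ≤ R + 1) →
      ∀ t ∈ Icc 0 τ, ‖Y t - Z t‖ ≤ C * ‖Y 0 - Z 0‖ := by
    intro τ hτ Y Z hY hZ hYb hZb t ht
    have h1 := dist_le_of_trajectories_ODE_of_mem (v := fun _ => F)
      (s := fun _ => closedBall 0 (R + 1)) (fun _ _ => hK) (hY.mono hτ).continuousOn
      (hY.mono hτ).right (fun t ht => by
        rw [mem_closedBall_zero_iff]; exact hYb t ⟨ht.1, ht.2.le⟩) (hZ.mono hτ).continuousOn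
      (hZ.mono hτ).right (fun t ht => by
        rw [mem_closedBall_zero_iff]; exact hZb t ⟨ht.1, ht.2.le⟩) le_rfl t ht
    rw [dist_eq_norm, dist_eq_norm, mul_comm] at h1
    refine h1.trans (mul_le_mul_of_nonneg_right ?_ (norm_nonneg _))
    rw [hC]
    refine Real.exp_le_exp.2 (mul_le_mul_of_nonneg_left ?_ K.2)
    linarith [ht.2]
  have hCpos : 0 < C := Real.exp_pos _
  have tube : ∀ Y : ℝ → E, SolvesOn F Y T → ‖Y 0 - X 0‖ < min 1 (1 / (2 * C)) →
      ∀ t ∈ Icc 0 T, ‖Y t‖ ≤ R + 1 := by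
    intro Y hY h0 t ht
    have hb : ∀ t ∈ Icc 0 T, ‖Y t - X t‖ ≤ 1 → ‖Y t‖ ≤ R + 1 := fun t ht h => by
      have := norm_add_le (Y t - X t) (X t)
      rw [sub_add_cancel] at this
      linarith [hR t ht]
    apply hb t ht
    by_contra! hc
    obtain ⟨τ, hτ, h1, h2⟩ := exists_first_time (f := fun t => ‖Y t - X t‖) (n := 1)
      (hY.continuousOn.sub hX.continuousOn).norm (h0.trans_le (min_le_left _ _)) ⟨t, ht, hc.le⟩
    have h3 := gr τ hτ.2 Y X hY hX (fun s hs => hb s ⟨hs.1, hs.2.trans hτ.2⟩ (h2 s hs))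
      (fun s hs => (hR s ⟨hs.1, hs.2.trans hτ.2⟩).trans (by linarith)) τ ⟨hτ.1.le, le_rfl⟩
    have h4 := (lt_div_iff₀ (by positivity)).1 (h0.trans_le (min_le_right _ _))
    nlinarith
  refine ⟨C, hCpos, min 1 (1 / (2 * C)), by positivity, fun Y Z hY hZ hY0 hZ0 => ?_⟩
  exact gr T le_rfl Y Z hY hZ (tube Y hY hY0) (tube Z hZ hZ0)

lemma exists_dependence_abs [FiniteDimensional ℝ E] {F : E → E} (hF : ContDiff ℝ 1 F) {X : ℝ → E}
    (hX : ∀ t, HasDerivAt X (F (X t)) t) (T : ℝ) :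
    ∃ C > 0, ∃ δ > 0, ∀ Y : ℝ → E, (∀ t, HasDerivAt Y (F (Y t)) t) →
      ‖Y 0 - X 0‖ < δ → ∀ t, |t| ≤ T → ‖Y t - X t‖ ≤ C * ‖Y 0 - X 0‖ := by
  obtain ⟨C, hC, δ, hδ, h⟩ := exists_dependence hF (solvesOn_of_hasDerivAt hX T)
  have hrev : ∀ Y : ℝ → E, (∀ t, HasDerivAt Y (F (Y t)) t) →
      SolvesOn (fun x => -F x) (fun t => Y (-t)) T := by
    intro Y hY
    refine solvesOn_of_hasDerivAt (fun t => ?_) T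
    have h1 := (hY (-t)).scomp t (hasDerivAt_neg t)
    rwa [neg_smul, one_smul] at h1
  obtain ⟨C', hC', δ', hδ', h'⟩ := exists_dependence hF.neg (hrev X hX)
  simp only [neg_zero] at h'
  refine ⟨max C C', by positivity, min δ δ', by positivity, fun Y hY hY0 t ht => ?_⟩
  rcases le_total 0 t with h0 | h0
  · refine (h Y X (solvesOn_of_hasDerivAt hY T) (solvesOn_of_hasDerivAt hX T)
      (hY0.trans_le (min_le_left _ _)) (by simpa using hδ) t ⟨h0, (le_abs_self t).trans ht⟩).trans ?_
    exact mul_le_mul_of_nonneg_right (le_max_left _ _) (norm_nonneg _)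
  · have := (h' (fun t => Y (-t)) (fun t => X (-t)) (hrev Y hY) (hrev X hX)
      (by simpa using hY0.trans_le (min_le_right _ _)) (by simpa using hδ') (-t)
      ⟨neg_nonneg.2 h0, (neg_le_abs t).trans ht⟩)
    simp only [neg_zero, neg_neg] at this
    exact this.trans (mul_le_mul_of_nonneg_right (le_max_right _ _) (norm_nonneg _))

lemma continuous_solution_family [FiniteDimensional ℝ E] {F : E → E} (hF : ContDiff ℝ 1 F)
    {W : Type*} [TopologicalSpace W] {X : W → ℝ → E} (hX : ∀ w t, HasDerivAt (X w) (F (X w t)) t)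
    (h0 : Continuous fun w => X w 0) : Continuous fun q : W × ℝ => X q.1 q.2 := by
  rw [continuous_iff_continuousAt]
  rintro ⟨w, t⟩
  obtain ⟨C, hC, δ, hδ, h⟩ := exists_dependence_abs hF (hX w) (|t| + 1)
  have e1 : Tendsto (fun q : W × ℝ => C * ‖X q.1 0 - X w 0‖ + ‖X w q.2 - X w t‖) (𝓝 (w, t)) (𝓝 0) := by
    have hXc : Continuous (X w) := continuous_iff_continuousAt.2 fun t => (hX w t).continuousAt
    have : Continuous (fun q : W × ℝ => C * ‖X q.1 0 - X w 0‖ + ‖X w q.2 - X w t‖) := by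
      have := h0.comp (continuous_fst (X := W) (Y := ℝ))
      have := hXc.comp (continuous_snd (X := W) (Y := ℝ))
      simp only [Function.comp_def] at *
      fun_prop
    simpa using this.tendsto (w, t)
  have e2 : ∀ᶠ q : W × ℝ in 𝓝 (w, t), ‖X q.1 0 - X w 0‖ < δ := by
    have : Continuous fun q : W × ℝ => ‖X q.1 0 - X w 0‖ :=
      ((h0.comp continuous_fst).sub continuous_const).norm
    exact this.continuousAt.eventually_lt continuousAt_const (by simpa using hδ)
  have e3 : ∀ᶠ q : W × ℝ in 𝓝 (w, t), |q.2| < |t| + 1 :=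
    (continuous_abs.comp continuous_snd).continuousAt.eventually_lt continuousAt_const (by simp)
  refine tendsto_iff_norm_sub_tendsto_zero.2 (squeeze_zero' (Eventually.of_forall fun _ => norm_nonneg _) ?_ e1)
  filter_upwards [e2, e3] with q h2 h3
  have := h (X q.1) (hX q.1) h2 q.2 h3.le
  calc ‖X q.1 q.2 - X w t‖ = ‖(X q.1 q.2 - X w q.2) + (X w q.2 - X w t)‖ := by congr 1; abel
    _ ≤ _ := (norm_add_le _ _).trans (by linarith)

/-- Strict differentiability of the time-`T` map of a family of solutions whose initial values
depend affinely on the parameter; the derivative is given by the linearized equation. -/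
lemma hasStrictFDerivAt_solution_family [FiniteDimensional ℝ E] {F : E → E} (hF : ContDiff ℝ 1 F)
    {W : Type*} [NormedAddCommGroup W] [NormedSpace ℝ W] {X : W → ℝ → E} {x₀ : E} {ι D : W →L[ℝ] E}
    (hX : ∀ w t, HasDerivAt (X w) (F (X w t)) t) (h0 : ∀ w, X w 0 = x₀ + ι w) (w₀ : W) {T : ℝ}
    (hT : 0 ≤ T)
    (hD : ∀ w, ∃ y : ℝ → E, y 0 = ι w ∧ y T = D w ∧
      ∀ t, HasDerivAt y (fderiv ℝ F (X w₀ t) (y t)) t) :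
    HasStrictFDerivAt (fun w => X w T) D w₀ := by
  have := FiniteDimensional.proper_real E
  obtain ⟨C, hC, δ, hδ, hdep⟩ := exists_dependence hF (solvesOn_of_hasDerivAt (hX w₀) T)
  obtain ⟨R, hR⟩ := (isCompact_Icc.image_of_continuousOn
    (solvesOn_of_hasDerivAt (hX w₀) T).continuousOn).isBounded.exists_norm_le
  have hR : ∀ t ∈ Icc 0 T, ‖X w₀ t‖ ≤ R := fun t ht => hR _ (mem_image_of_mem _ ht)
  have hDF : Continuous (fderiv ℝ F) := hF.continuous_fderiv one_ne_zero
  obtain ⟨L₀, hL₀⟩ := ((isCompact_closedBall (0 : E) R).image hDF).isBounded.exists_norm_le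
  set L := max L₀ 1 with hLdef
  have hL1 : 1 ≤ L := le_max_right _ _
  have hL : ∀ t ∈ Icc 0 T, ‖fderiv ℝ F (X w₀ t)‖ ≤ L := fun t ht =>
    (hL₀ _ (mem_image_of_mem _ (by rw [mem_closedBall_zero_iff]; exact hR t ht))).trans
      (le_max_left _ _)
  have hUC : UniformContinuousOn (fderiv ℝ F) (closedBall 0 (R + 1)) :=
    (isCompact_closedBall _ _).uniformContinuousOn_of_continuous hDF.continuousOn
  rw [hasStrictFDerivAt_iff_isLittleO, Asymptotics.isLittleO_iff]
  intro c hc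
  set M := C * (‖ι‖ + 1) * (Real.exp (L * T) / L) with hM
  have hMpos : 0 < M := by positivity
  obtain ⟨η, hη, hηF⟩ := Metric.uniformContinuousOn_iff.1 hUC (c / M) (by positivity)
  set η' := min η 1 with hη'
  have hη'pos : 0 < η' := by positivity
  have hstrict : ∀ t ∈ Icc 0 T, ∀ y z, ‖y - X w₀ t‖ < η' → ‖z - X w₀ t‖ < η' →
      ‖F y - F z - fderiv ℝ F (X w₀ t) (y - z)‖ ≤ c / M * ‖y - z‖ := by
    intro t ht y z hy hz
    refine Convex.norm_image_sub_le_of_norm_fderiv_le' (s := ball (X w₀ t) η')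
      (fun x _ => hF.differentiable one_ne_zero x) (fun x hx => ?_) (convex_ball _ _)
      (by rwa [mem_ball_iff_norm]) (by rwa [mem_ball_iff_norm])
    rw [mem_ball_iff_norm] at hx
    rw [← dist_eq_norm]
    refine (hηF x ?_ _ ?_ ?_).le
    · rw [mem_closedBall_zero_iff]
      have := norm_add_le (x - X w₀ t) (X w₀ t)
      rw [sub_add_cancel] at this
      linarith [hR t ht, min_le_right η 1]
    · rw [mem_closedBall_zero_iff]; linarith [hR t ht]
    · rw [dist_eq_norm]; exact hx.trans_le (min_le_left _ _)
  have hnear : ∀ᶠ w in 𝓝 w₀, ‖X w 0 - X w₀ 0‖ < min δ (η' / C) := by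
    have : Continuous fun w => ‖X w 0 - X w₀ 0‖ := by
      simp only [h0]; fun_prop
    exact this.continuousAt.eventually_lt continuousAt_const
      (by rw [sub_self, norm_zero]; exact lt_min hδ (div_pos hη'pos hC))
  have hnear2 := hnear.prod_nhds hnear
  filter_upwards [hnear2] with ⟨v, w⟩ ⟨hv, hw⟩
  simp only at hv hw ⊢
  obtain ⟨y, hy0, hyT, hy⟩ := hD (v - w)
  have hX' := fun w => solvesOn_of_hasDerivAt (hX w) T
  have hclose : ∀ u, ‖X u 0 - X w₀ 0‖ < min δ (η' / C) → ∀ t ∈ Icc 0 T, ‖X u t - X w₀ t‖ < η' := by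
    intro u hu t ht
    have h1 := hdep (X u) (X w₀) (hX' u) (hX' w₀) (hu.trans_le (min_le_left _ _)) (by simpa) t ht
    have h2 := (lt_div_iff₀' hC).1 (hu.trans_le (min_le_right _ _))
    linarith
  have hvw : ∀ t ∈ Icc 0 T, ‖X v t - X w t‖ ≤ C * (‖ι‖ + 1) * ‖v - w‖ := by
    intro t ht
    refine (hdep (X v) (X w) (hX' v) (hX' w) (hv.trans_le (min_le_left _ _))
      (hw.trans_le (min_le_left _ _)) t ht).trans ?_
    rw [h0, h0, add_sub_add_left_eq_sub, ← map_sub, mul_assoc]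
    refine mul_le_mul_of_nonneg_left ((ι.le_opNorm _).trans ?_) hC.le
    nlinarith [norm_nonneg (v - w)]
  have hf : ∀ t, HasDerivAt (fun t => X v t - X w t - y t)
      (F (X v t) - F (X w t) - fderiv ℝ F (X w₀ t) (y t)) t := fun t =>
    ((hX v t).sub (hX w t)).sub (hy t)
  have hG := norm_le_gronwallBound_of_norm_deriv_right_le (f := fun t => X v t - X w t - y t)
    (f' := fun t => F (X v t) - F (X w t) - fderiv ℝ F (X w₀ t) (y t)) (δ := 0) (K := L)
    (ε := c / M * (C * (‖ι‖ + 1) * ‖v - w‖)) (a := 0) (b := T)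
    (fun t _ => (hf t).continuousAt.continuousWithinAt) (fun t _ => (hf t).hasDerivWithinAt)
    (by rw [h0, h0, hy0, map_sub]; simp) (fun t ht => ?_) T ⟨hT, le_rfl⟩
  · rw [hyT] at hG
    refine hG.trans ?_
    rw [gronwallBound_of_K_ne_0 (by positivity)]
    simp only [zero_mul, zero_add, sub_zero]
    have : c / M * (C * (‖ι‖ + 1) * ‖v - w‖) / L * (Real.exp (L * T) - 1) ≤
        c / M * (C * (‖ι‖ + 1) * ‖v - w‖) / L * Real.exp (L * T) :=
      mul_le_mul_of_nonneg_left (by linarith) (by positivity)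
    refine this.trans (le_of_eq ?_)
    have hLne : L ≠ 0 := by positivity
    rw [hM]
    field_simp
  · have ht' : t ∈ Icc 0 T := ⟨ht.1, ht.2.le⟩
    have e : F (X v t) - F (X w t) - fderiv ℝ F (X w₀ t) (y t) =
        fderiv ℝ F (X w₀ t) (X v t - X w t - y t) +
          (F (X v t) - F (X w t) - fderiv ℝ F (X w₀ t) (X v t - X w t)) := by
      rw [map_sub]; abel
    rw [e]
    refine (norm_add_le _ _).trans (add_le_add ?_ ?_)
    · exact (ContinuousLinearMap.le_opNorm _ _).trans
        (mul_le_mul_of_nonneg_right (hL t ht') (norm_nonneg _))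
    · refine (hstrict t ht' _ _ (hclose v hv t ht') (hclose w hw t ht')).trans ?_
      exact mul_le_mul_of_nonneg_left (hvw t ht') (by positivity)

end AutonomousODE

noncomputable section MetricAlgebra

open scoped ContDiff

lemma V2.eq_sum_single (v : V2) : v = v 0 • (Pi.single 0 1 : V2) + v 1 • (Pi.single 1 1 : V2) := by
  ext i; fin_cases i <;> simp

lemma deriv_line_eq_fderiv {f : V2 → ℝ} {x : V2} (hf : DifferentiableAt ℝ f x) (e : V2) :
    deriv (fun s : ℝ => f (x + s • e)) 0 = fderiv ℝ f x e := by
  have h1 : HasDerivAt (fun s : ℝ => x + s • e) e 0 := by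
    simpa using ((hasDerivAt_id (0 : ℝ)).smul_const e).const_add x
  have h2 : HasFDerivAt f (fderiv ℝ f x) (x + (0 : ℝ) • e) := by simpa using hf.hasFDerivAt
  exact (h2.comp_hasDerivAt (0 : ℝ) h1).deriv

lemma fderiv_eq_sum_line {f : V2 → ℝ} {x : V2} (hf : DifferentiableAt ℝ f x) (v : V2) :
    fderiv ℝ f x v = ∑ d, deriv (fun s : ℝ => f (x + s • (Pi.single d 1 : V2))) 0 * v d := by
  simp only [deriv_line_eq_fderiv hf, Fin.sum_univ_two]
  conv_lhs => rw [V2.eq_sum_single v]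
  simp only [map_add, map_smul, smul_eq_mul]
  ring

lemma contDiff_line_deriv {f : V2 → ℝ} (hf : ContDiff ℝ ∞ f) (e : V2) :
    ContDiff ℝ ∞ fun x => deriv (fun s : ℝ => f (x + s • e)) 0 := by
  have : (fun x => deriv (fun s : ℝ => f (x + s • e)) 0) = fun x => fderiv ℝ f x e := by
    ext x; exact deriv_line_eq_fderiv (hf.differentiable (by simp) x) e
  rw [this]
  exact (hf.fderiv_right (m := ∞) (by simp)).clm_apply contDiff_const

lemma line_deriv_comm {f : V2 → ℝ} (hf : ContDiff ℝ ∞ f) (e e' x : V2) :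
    deriv (fun s : ℝ => deriv (fun r : ℝ => f (x + s • e + r • e')) 0) 0 =
      deriv (fun s : ℝ => deriv (fun r : ℝ => f (x + s • e' + r • e)) 0) 0 := by
  have key : ∀ a b : V2, deriv (fun s : ℝ => deriv (fun r : ℝ => f (x + s • a + r • b)) 0) 0 =
      fderiv ℝ (fderiv ℝ f) x a b := by
    intro a b
    have hd : ContDiff ℝ ∞ fun y => fderiv ℝ f y b :=
      (hf.fderiv_right (m := ∞) (by simp)).clm_apply contDiff_const
    have h1 := deriv_line_eq_fderiv (hd.differentiable (by simp) x) a
    have h2 : ∀ s : ℝ, deriv (fun r : ℝ => f (x + s • a + r • b)) 0 = fderiv ℝ f (x + s • a) b :=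
      fun s => deriv_line_eq_fderiv (hf.differentiable (by simp) _) b
    simp only [h2, h1]
    have h3 : DifferentiableAt ℝ (fderiv ℝ f) x :=
      (hf.fderiv_right (m := ∞) (by simp)).differentiable (by simp) x
    rw [fderiv_clm_apply h3 (differentiableAt_const b)]
    simp
  rw [key, key]
  have : IsSymmSndFDerivAt ℝ f x :=
    hf.contDiffAt.isSymmSndFDerivAt (by
    rw [minSmoothness_of_isRCLikeNormedField]
    exact WithTop.coe_le_coe.2 (le_top : (2 : ℕ∞) ≤ ⊤))
  exact this e e'

variable (M : RMetric)

lemma g_symm (x : V2) (i j : Fin 2) : M.g x i j = M.g x j i :=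
  ((M.symm x).apply i j).symm

lemma det_eq (x : V2) : (M.g x).det = M.g x 0 0 * M.g x 1 1 - M.g x 0 1 * M.g x 0 1 := by
  rw [Matrix.det_fin_two, g_symm M x 1 0]

lemma det_pos (x : V2) : 0 < (M.g x).det := (M.posDef x).det_pos

lemma g_smooth (i j : Fin 2) : ContDiff ℝ ∞ fun x => M.g x i j := M.smooth i j

lemma det_smooth : ContDiff ℝ ∞ fun x => (M.g x).det := by
  simp only [det_eq]
  have := g_smooth M
  fun_prop

lemma dg_smooth (d i j : Fin 2) : ContDiff ℝ ∞ (M.dg d i j) :=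
  contDiff_line_deriv (g_smooth M i j) _

lemma dg_symm (d i j : Fin 2) (x : V2) : M.dg d i j x = M.dg d j i x := by
  simp only [RMetric.dg, g_symm M _ i j]

lemma ginv_eq (x : V2) (k l : Fin 2) : (M.g x)⁻¹ k l =
    (M.g x).adjugate k l * ((M.g x).det)⁻¹ := by
  rw [Matrix.inv_def, Ring.inverse_eq_inv']
  simp [mul_comm]

lemma ginv_smooth (k l : Fin 2) : ContDiff ℝ ∞ fun x => (M.g x)⁻¹ k l := by
  simp only [ginv_eq]
  refine ContDiff.mul ?_ ((det_smooth M).inv fun x => (det_pos M x).ne')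
  have := g_smooth M
  simp only [Matrix.adjugate_fin_two]
  fin_cases k <;> fin_cases l <;> simp <;> fun_prop

lemma Γ_smooth (k i j : Fin 2) : ContDiff ℝ ∞ (M.Γ k i j) := by
  unfold RMetric.Γ
  have h1 := ginv_smooth M
  have h2 := dg_smooth M
  exact contDiff_const.mul (ContDiff.sum fun l _ => (h1 k l).mul (((h2 i j l).add (h2 j i l)).sub (h2 l i j)))

lemma dΓ_smooth (d k i j : Fin 2) : ContDiff ℝ ∞ (M.dΓ d k i j) :=
  contDiff_line_deriv (Γ_smooth M k i j) _

lemma K_smooth : ContDiff ℝ ∞ M.K := by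
  unfold RMetric.K
  have h1 := g_smooth M
  have h2 := dΓ_smooth M
  have h3 := Γ_smooth M
  refine ContDiff.div ?_ (det_smooth M) fun x => (det_pos M x).ne'
  refine ContDiff.sum fun l _ => (h1 0 l).mul (((h2 _ _ _ _).sub (h2 _ _ _ _)).add
    (ContDiff.sum fun m _ => ((h3 _ _ _).mul (h3 _ _ _)).sub ((h3 _ _ _).mul (h3 _ _ _))))

lemma Γ_symm (k i j : Fin 2) (x : V2) : M.Γ k i j x = M.Γ k j i x := by
  unfold RMetric.Γ
  congr 1
  refine Finset.sum_congr rfl fun l _ => ?_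
  rw [dg_symm M l i j]; ring

lemma dΓ_symm (d k i j : Fin 2) (x : V2) : M.dΓ d k i j x = M.dΓ d k j i x := by
  unfold RMetric.dΓ
  simp only [Γ_symm M k i j]

/-- The Levi-Civita connection is compatible with the metric. -/
lemma dg_eq (d i j : Fin 2) (x : V2) :
    M.dg d i j x = ∑ l, (M.g x i l * M.Γ l d j x + M.g x j l * M.Γ l d i x) := by
  have hd := (det_pos M x).ne'
  have hlow : ∀ a b c : Fin 2, ∑ l, M.g x c l * M.Γ l a b x =
      1 / 2 * (M.dg a b c x + M.dg b a c x - M.dg c a b x) := by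
    intro a b c
    have h1 : M.g x * (M.g x)⁻¹ = 1 := Matrix.mul_nonsing_inv _ (isUnit_iff_ne_zero.2 hd)
    have h2 : ∀ m, ∑ l, M.g x c l * (M.g x)⁻¹ l m = if c = m then 1 else 0 := by
      intro m
      rw [← Matrix.one_apply, ← h1, Matrix.mul_apply]
    have h20 := h2 0
    have h21 := h2 1
    simp only [RMetric.Γ, Fin.sum_univ_two] at h20 h21 ⊢
    fin_cases c <;> simp at h20 h21 ⊢
    · linear_combination (1 / 2 * (M.dg a b 0 x + M.dg b a 0 x - M.dg 0 a b x)) * h20 +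
        (1 / 2 * (M.dg a b 1 x + M.dg b a 1 x - M.dg 1 a b x)) * h21
    · linear_combination (1 / 2 * (M.dg a b 0 x + M.dg b a 0 x - M.dg 0 a b x)) * h20 +
        (1 / 2 * (M.dg a b 1 x + M.dg b a 1 x - M.dg 1 a b x)) * h21
  rw [Finset.sum_add_distrib, hlow, hlow, dg_symm M d j i, dg_symm M i d j, dg_symm M j d i]
  ring

/-- `R(∂₀, ∂₁) ∂ₖ` in coordinates. -/
def curvOp (k l : Fin 2) (x : V2) : ℝ :=
  M.dΓ 0 l 1 k x - M.dΓ 1 l 0 k x +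
    ∑ m, (M.Γ l 0 m x * M.Γ m 1 k x - M.Γ l 1 m x * M.Γ m 0 k x)

lemma ddg_eq (c d i j : Fin 2) (x : V2) :
    deriv (fun s : ℝ => M.dg d i j (x + s • (Pi.single c 1 : V2))) 0 =
      ∑ l, (M.dg c i l x * M.Γ l d j x + M.g x i l * M.dΓ c l d j x +
        (M.dg c j l x * M.Γ l d i x + M.g x j l * M.dΓ c l d i x)) := by
  have hline : HasDerivAt (fun s : ℝ => x + s • (Pi.single c 1 : V2)) (Pi.single c 1) 0 := by
    simpa using ((hasDerivAt_id (0 : ℝ)).smul_const (Pi.single c 1 : V2)).const_add x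
  have hf : ∀ {f : V2 → ℝ}, ContDiff ℝ ∞ f → HasDerivAt (fun s : ℝ => f (x + s • (Pi.single c 1 : V2)))
      (deriv (fun s : ℝ => f (x + s • (Pi.single c 1 : V2))) 0) 0 := by
    intro f hf
    have h2 : DifferentiableAt ℝ f (x + (0 : ℝ) • (Pi.single c 1 : V2)) := hf.differentiable (by simp) _
    exact (h2.comp (0 : ℝ) hline.differentiableAt).hasDerivAt
  simp only [dg_eq M d i j]
  refine HasDerivAt.deriv (HasDerivAt.fun_sum fun l _ => ?_)
  have h1 := (hf (g_smooth M i l)).mul (hf (Γ_smooth M l d j))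
  have h2 := (hf (g_smooth M j l)).mul (hf (Γ_smooth M l d i))
  simpa [RMetric.dg, RMetric.dΓ, Pi.mul_def, Pi.add_def] using h1.add h2

lemma curvOp_antisymm (i j : Fin 2) (x : V2) :
    ∑ l, (M.g x i l * curvOp M j l x + M.g x j l * curvOp M i l x) = 0 := by
  have h := line_deriv_comm (g_smooth M i j) (Pi.single 0 1) (Pi.single 1 1) x
  change deriv (fun s : ℝ => M.dg 1 i j (x + s • (Pi.single 0 1 : V2))) 0 =
    deriv (fun s : ℝ => M.dg 0 i j (x + s • (Pi.single 1 1 : V2))) 0 at h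
  rw [ddg_eq, ddg_eq] at h
  simp only [dg_eq M _ _ _ x, Fin.sum_univ_two, curvOp] at h ⊢
  fin_cases i <;> fin_cases j <;> simp only [Fin.zero_eta, Fin.mk_one, g_symm M x 1 0] at h ⊢ <;>
    linear_combination h

lemma K_mul_det (x : V2) : M.K x * (M.g x).det = ∑ l, M.g x 0 l * curvOp M 1 l x := by
  rw [RMetric.K, div_mul_cancel₀ _ (det_pos M x).ne']
  rfl

lemma curvOp_eq (x : V2) :
    curvOp M 0 0 x = M.K x * M.g x 0 1 ∧ curvOp M 0 1 x = - (M.K x * M.g x 0 0) ∧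
      curvOp M 1 0 x = M.K x * M.g x 1 1 ∧ curvOp M 1 1 x = - (M.K x * M.g x 0 1) := by
  have hd := (det_pos M x).ne'
  have h1 := K_mul_det M x
  have h2 := curvOp_antisymm M 0 0 x
  have h3 := curvOp_antisymm M 0 1 x
  have h4 := curvOp_antisymm M 1 1 x
  simp only [Fin.sum_univ_two, g_symm M x 1 0] at h1 h2 h3 h4
  have hdet := det_eq M x
  refine ⟨?_, ?_, ?_, ?_⟩ <;> refine mul_right_cancel₀ hd ?_ <;> rw [det_eq] at *
  · linear_combination (M.g x 1 1) / 2 * h2 - M.g x 0 1 * h3 - M.g x 0 1 * h1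
  · linear_combination (- M.g x 0 1) / 2 * h2 + M.g x 0 0 * h3 + M.g x 0 0 * h1
  · linear_combination - M.g x 1 1 * h1 - (M.g x 0 1) / 2 * h4
  · linear_combination M.g x 0 1 * h1 + (M.g x 0 0) / 2 * h4

end MetricAlgebra

noncomputable section GeodesicAlgebra

open scoped ContDiff

variable (M : RMetric)

/-- The Christoffel form `Γ_x(v, w)`. -/
def chr (x v w : V2) : V2 := fun k => ∑ i, ∑ j, M.Γ k i j x * v i * w j

/-- The derivative `(∂_y Γ)_x(v, w)` of the Christoffel form. -/
def dchr (x y v w : V2) : V2 := fun k => ∑ d, ∑ i, ∑ j, M.dΓ d k i j x * y d * v i * w j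

/-- Rotation by a right angle with respect to the metric. -/
def rot (x v : V2) : V2 :=
  ![-(M.g x 0 1 * v 0 + M.g x 1 1 * v 1) / √(M.g x).det,
    (M.g x 0 0 * v 0 + M.g x 0 1 * v 1) / √(M.g x).det]

lemma rot_zero (x v : V2) :
    rot M x v 0 = -(M.g x 0 1 * v 0 + M.g x 1 1 * v 1) / √(M.g x).det := rfl

lemma rot_one (x v : V2) :
    rot M x v 1 = (M.g x 0 0 * v 0 + M.g x 0 1 * v 1) / √(M.g x).det := rfl

lemma sqrt_det_pos (x : V2) : 0 < √(M.g x).det := Real.sqrt_pos.2 (det_pos M x)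

lemma sqrt_det_sq (x : V2) :
    √(M.g x).det * √(M.g x).det = M.g x 0 0 * M.g x 1 1 - M.g x 0 1 * M.g x 0 1 := by
  rw [Real.mul_self_sqrt (det_pos M x).le, det_eq]

lemma met_eq (x v w : V2) : M.met x v w =
    M.g x 0 0 * v 0 * w 0 + M.g x 0 1 * (v 0 * w 1 + v 1 * w 0) + M.g x 1 1 * v 1 * w 1 := by
  simp only [RMetric.met, Fin.sum_univ_two, g_symm M x 1 0]
  ring

lemma met_comm (x v w : V2) : M.met x v w = M.met x w v := by
  simp only [met_eq]; ring

lemma met_add_left (x u v w : V2) : M.met x (u + v) w = M.met x u w + M.met x v w := by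
  simp only [met_eq, Pi.add_apply]; ring

lemma met_smul_left (x v w : V2) (c : ℝ) : M.met x (c • v) w = c * M.met x v w := by
  simp only [met_eq, Pi.smul_apply, smul_eq_mul]; ring

lemma met_add_right (x u v w : V2) : M.met x w (u + v) = M.met x w u + M.met x w v := by
  simp only [met_eq, Pi.add_apply]; ring

lemma met_smul_right (x v w : V2) (c : ℝ) : M.met x w (c • v) = c * M.met x w v := by
  simp only [met_eq, Pi.smul_apply, smul_eq_mul]; ring

lemma met_pos {x v : V2} (hv : v ≠ 0) : 0 < M.met x v v := by
  have := (M.posDef x).dotProduct_mulVec_pos hv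
  simpa [dotProduct, Matrix.mulVec, RMetric.met, Fin.sum_univ_two, mul_add, add_mul, mul_comm,
    mul_left_comm, mul_assoc] using this

lemma met_rot_rot (x v w : V2) : M.met x (rot M x v) (rot M x w) = M.met x v w := by
  have h := sqrt_det_sq M x
  have h0 := (sqrt_det_pos M x).ne'
  simp only [met_eq, rot_zero, rot_one]
  field_simp
  rw [pow_two, h]
  ring

lemma met_self_rot (x v : V2) : M.met x v (rot M x v) = 0 := by
  simp only [met_eq, rot_zero, rot_one]
  field_simp
  ring

lemma rot_rot (x v : V2) : rot M x (rot M x v) = -v := by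
  have h := sqrt_det_sq M x
  have h0 := (sqrt_det_pos M x).ne'
  ext k
  fin_cases k <;> simp only [rot_zero, rot_one, Fin.zero_eta, Fin.mk_one, Pi.neg_apply] <;>
    field_simp <;> rw [pow_two, h] <;> ring

lemma rot_smul (x v : V2) (c : ℝ) : rot M x (c • v) = c • rot M x v := by
  ext k
  fin_cases k <;> simp only [rot_zero, rot_one, Fin.zero_eta, Fin.mk_one, Pi.smul_apply,
    smul_eq_mul] <;> ring

lemma rot_add (x v w : V2) : rot M x (v + w) = rot M x v + rot M x w := by
  ext k
  fin_cases k <;> simp only [rot_zero, rot_one, Fin.zero_eta, Fin.mk_one, Pi.add_apply] <;> ring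

/-- `v ∧ Dv = |v|² / √det` in coordinates. -/
lemma wedge_rot (x v : V2) :
    (v 0 * rot M x v 1 - v 1 * rot M x v 0) * √(M.g x).det = M.met x v v := by
  have h0 := (sqrt_det_pos M x).ne'
  simp only [met_eq, rot_zero, rot_one]
  field_simp
  ring

lemma chr_comm (x v w : V2) : chr M x v w = chr M x w v := by
  ext k
  simp only [chr, Fin.sum_univ_two, Γ_symm M k 1 0]
  ring

/-- The curvature identity `R(N, v) v = K |v|² N` for `N = Dv`. -/
lemma curvature_identity (x v : V2) :
    dchr M x (rot M x v) v v - dchr M x v v (rot M x v) + chr M x (rot M x v) (chr M x v v) -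
      chr M x v (chr M x v (rot M x v)) = (M.K x * M.met x v v) • rot M x v := by
  have h0 := (sqrt_det_pos M x).ne'
  have hw := wedge_rot M x v
  obtain ⟨h00, h01, h10, h11⟩ := curvOp_eq M x
  simp only [curvOp, Fin.sum_univ_two] at h00 h01 h10 h11
  have r0 : rot M x v 0 * √(M.g x).det = -(M.g x 0 1 * v 0 + M.g x 1 1 * v 1) := by
    rw [rot_zero]; field_simp
  have r1 : rot M x v 1 * √(M.g x).det = M.g x 0 0 * v 0 + M.g x 0 1 * v 1 := by
    rw [rot_one]; field_simp
  ext k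
  simp only [Pi.sub_apply, Pi.add_apply, Pi.smul_apply, smul_eq_mul]
  rw [← hw]
  generalize rot M x v = N at *
  fin_cases k <;>
    simp only [chr, dchr, Fin.sum_univ_two, Fin.zero_eta, Fin.mk_one, Γ_symm M _ 1 0,
      dΓ_symm M _ _ 1 0] at h00 h01 h10 h11 ⊢
  · linear_combination (N 0 * v 1 - N 1 * v 0) * (v 0 * h00 + v 1 * h10) -
      M.K x * (v 0 * N 1 - v 1 * N 0) * r0
  · linear_combination (N 0 * v 1 - N 1 * v 0) * (v 0 * h01 + v 1 * h11) -
      M.K x * (v 0 * N 1 - v 1 * N 0) * r1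

/-- The geodesic vector field. -/
def geoField (q : V2 × V2) : V2 × V2 := (q.2, -chr M q.1 q.2 q.2)

lemma chr_contDiff {E : Type*} [NormedAddCommGroup E] [NormedSpace ℝ E] {f u v : E → V2}
    (hf : ContDiff ℝ ∞ f) (hu : ContDiff ℝ ∞ u) (hv : ContDiff ℝ ∞ v) :
    ContDiff ℝ ∞ fun e => chr M (f e) (u e) (v e) := by
  rw [contDiff_pi] at *
  intro k
  exact ContDiff.sum fun i _ => ContDiff.sum fun j _ =>
    (((Γ_smooth M k i j).comp (contDiff_pi.2 hf)).mul (hu i)).mul (hv j)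

lemma geoField_contDiff : ContDiff ℝ ∞ (geoField M) :=
  contDiff_snd.prodMk (chr_contDiff M contDiff_fst contDiff_snd contDiff_snd).neg

lemma hasDerivAt_comp_curve {f : V2 → ℝ} (hf : ContDiff ℝ ∞ f) {γ : ℝ → V2} {v : V2} {t : ℝ}
    (h : HasDerivAt γ v t) : HasDerivAt (fun s => f (γ s))
      (∑ d, deriv (fun s : ℝ => f (γ t + s • (Pi.single d 1 : V2))) 0 * v d) t := by
  have hd := hf.differentiable (by simp) (γ t)
  rw [← fderiv_eq_sum_line hd]
  exact hd.hasFDerivAt.comp_hasDerivAt t h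

/-- Product rule for the Christoffel form along a curve. -/
lemma hasDerivAt_chr {γ u w : ℝ → V2} {v u' w' : V2} {t : ℝ} (h : HasDerivAt γ v t)
    (hu : HasDerivAt u u' t) (hw : HasDerivAt w w' t) :
    HasDerivAt (fun s => chr M (γ s) (u s) (w s))
      (dchr M (γ t) v (u t) (w t) + chr M (γ t) u' (w t) + chr M (γ t) (u t) w') t := by
  rw [hasDerivAt_pi] at hu hw ⊢
  intro k
  have : HasDerivAt (fun s => ∑ i, ∑ j, M.Γ k i j (γ s) * u s i * w s j)
      (∑ i, ∑ j, (((∑ d, M.dΓ d k i j (γ t) * v d) * u t i + M.Γ k i j (γ t) * u' i) * w t j +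
        M.Γ k i j (γ t) * u t i * w' j)) t :=
    HasDerivAt.fun_sum fun i _ => HasDerivAt.fun_sum fun j _ =>
      ((hasDerivAt_comp_curve (Γ_smooth M k i j) h).fun_mul (hu i)).fun_mul (hw j)
  refine this.congr_deriv ?_
  simp only [Pi.add_apply, dchr, chr, Fin.sum_univ_two]
  ring

lemma fderiv_geoField (q y : V2 × V2) : fderiv ℝ (geoField M) q y =
    (y.2, -(dchr M q.1 y.1 q.2 q.2 + (2 : ℝ) • chr M q.1 q.2 y.2)) := by
  have hd := ((geoField_contDiff M).differentiable (by simp) q).hasFDerivAt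
  have hl : HasDerivAt (fun s : ℝ => q + s • y) y 0 := by
    simpa using ((hasDerivAt_id (0 : ℝ)).smul_const y).const_add q
  have h1 : HasDerivAt (fun s : ℝ => geoField M (q + s • y)) (fderiv ℝ (geoField M) q y) 0 := by
    have hd' : HasFDerivAt (geoField M) (fderiv ℝ (geoField M) q) (q + (0 : ℝ) • y) := by simpa using hd
    exact hd'.comp_hasDerivAt (0 : ℝ) hl
  have hl1 : HasDerivAt (fun s : ℝ => (q + s • y).1) y.1 0  := by
    simpa using ((hasDerivAt_id (0 : ℝ)).smul_const y.1).const_add q.1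
  have hl2 : HasDerivAt (fun s : ℝ => (q + s • y).2) y.2 0  := by
    simpa using ((hasDerivAt_id (0 : ℝ)).smul_const y.2).const_add q.2
  have h2 := hl2.prodMk (hasDerivAt_chr M hl1 hl2 hl2).neg
  refine (h1.unique h2).trans ?_
  rw [chr_comm M _ y.2]
  simp [two_smul, add_assoc]

/-- Derivative of the metric along a curve, in covariant form. -/
lemma hasDerivAt_met {γ u w : ℝ → V2} {v u' w' : V2} {t : ℝ} (h : HasDerivAt γ v t)
    (hu : HasDerivAt u (u' - chr M (γ t) v (u t)) t)
    (hw : HasDerivAt w (w' - chr M (γ t) v (w t)) t) :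
    HasDerivAt (fun s => M.met (γ s) (u s) (w s))
      (M.met (γ t) u' (w t) + M.met (γ t) (u t) w') t := by
  rw [hasDerivAt_pi] at hu hw
  have : HasDerivAt (fun s => ∑ i, ∑ j, M.g (γ s) i j * u s i * w s j)
      (∑ i, ∑ j, (((∑ d, M.dg d i j (γ t) * v d) * u t i +
        M.g (γ t) i j * (u' - chr M (γ t) v (u t)) i) * w t j +
        M.g (γ t) i j * u t i * (w' - chr M (γ t) v (w t)) j)) t :=
    HasDerivAt.fun_sum fun i _ => HasDerivAt.fun_sum fun j _ =>
      ((hasDerivAt_comp_curve (g_smooth M i j) h).fun_mul (hu i)).fun_mul (hw j)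
  refine this.congr_deriv ?_
  simp only [Pi.sub_apply, RMetric.met, dg_eq, chr, Fin.sum_univ_two, g_symm M _ 1 0]
  ring

/-- The rotation field is parallel. -/
lemma hasDerivAt_rot {γ u : ℝ → V2} {v : V2} {t : ℝ} (h : HasDerivAt γ v t)
    (hu : HasDerivAt u (- chr M (γ t) v (u t)) t) :
    HasDerivAt (fun s => rot M (γ s) (u s)) (-chr M (γ t) v (rot M (γ t) (u t))) t := by
  have h0 := (sqrt_det_pos M (γ t)).ne'
  have hg : ∀ i j, HasDerivAt (fun s => M.g (γ s) i j) (∑ d, M.dg d i j (γ t) * v d) t :=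
    fun i j => hasDerivAt_comp_curve (g_smooth M i j) h
  have hdet : HasDerivAt (fun s => (M.g (γ s)).det)
      (2 * (∑ d, ∑ l, M.Γ l d l (γ t) * v d) * (M.g (γ t)).det) t := by
    simp only [det_eq]
    refine (((hg 0 0).fun_mul (hg 1 1)).fun_sub ((hg 0 1).fun_mul (hg 0 1))).congr_deriv ?_
    simp only [dg_eq, Fin.sum_univ_two, g_symm M _ 1 0]
    ring
  have hs : HasDerivAt (fun s => √(M.g (γ s)).det)
      ((∑ d, ∑ l, M.Γ l d l (γ t) * v d) * √(M.g (γ t)).det) t := by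
    refine (hdet.sqrt (det_pos M (γ t)).ne').congr_deriv ?_
    rw [div_eq_iff (by positivity)]
    nth_rewrite 1 [← Real.mul_self_sqrt (det_pos M (γ t)).le]
    ring
  rw [hasDerivAt_pi] at hu ⊢
  intro k
  fin_cases k
  · refine ((((hg 0 1).fun_mul (hu 0)).fun_add ((hg 1 1).fun_mul (hu 1))).fun_neg.fun_div
      hs h0).congr_deriv ?_
    simp only [Fin.zero_eta, Pi.neg_apply, chr, Fin.sum_univ_two, rot_zero, rot_one, dg_eq,
      g_symm M _ 1 0]
    field_simp
    ring
  · refine ((((hg 0 0).fun_mul (hu 0)).fun_add ((hg 0 1).fun_mul (hu 1))).fun_div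
      hs h0).congr_deriv ?_
    simp only [Fin.mk_one, Pi.neg_apply, chr, Fin.sum_univ_two, rot_zero, rot_one, dg_eq,
      g_symm M _ 1 0]
    field_simp
    ring

end GeodesicAlgebra

section ProdDeriv

variable {A B : Type*} [NormedAddCommGroup A] [NormedSpace ℝ A] [NormedAddCommGroup B]
  [NormedSpace ℝ B]

lemma hasDerivAt_fst_comp {X : ℝ → A × B} {X' : A × B} {t : ℝ} (h : HasDerivAt X X' t) :
    HasDerivAt (fun s => (X s).1) X'.1 t :=
  ((ContinuousLinearMap.fst ℝ A B).hasFDerivAt).comp_hasDerivAt t h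

lemma hasDerivAt_snd_comp {X : ℝ → A × B} {X' : A × B} {t : ℝ} (h : HasDerivAt X X' t) :
    HasDerivAt (fun s => (X s).2) X'.2 t :=
  ((ContinuousLinearMap.snd ℝ A B).hasFDerivAt).comp_hasDerivAt t h

end ProdDeriv

noncomputable section JacobiAlgebra

open scoped ContDiff

variable (M : RMetric)

lemma hasDerivAt_rot_smul {γ v : ℝ → V2} {j k : ℝ → ℝ} {t : ℝ} (hγ : HasDerivAt γ (v t) t)
    (hv : HasDerivAt v (-chr M (γ t) (v t) (v t)) t) (hj : HasDerivAt j (k t) t) :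
    HasDerivAt (fun s => j s • rot M (γ s) (v s))
      (k t • rot M (γ t) (v t) - j t • chr M (γ t) (v t) (rot M (γ t) (v t))) t := by
  refine (hj.fun_smul (hasDerivAt_rot M hγ hv)).congr_deriv ?_
  rw [smul_neg]; abel

/-- Normal Jacobi fields solve the linearized geodesic equation. -/
lemma hasDerivAt_normal_jacobi {γ v : ℝ → V2} {j k : ℝ → ℝ} {t : ℝ} (hγ : HasDerivAt γ (v t) t)
    (hv : HasDerivAt v (-chr M (γ t) (v t) (v t)) t) (hj : HasDerivAt j (k t) t)
    (hk : HasDerivAt k (-(M.K (γ t) * M.met (γ t) (v t) (v t) * j t)) t) :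
    HasDerivAt (fun s => (j s • rot M (γ s) (v s),
        k s • rot M (γ s) (v s) - j s • chr M (γ s) (v s) (rot M (γ s) (v s))))
      (fderiv ℝ (geoField M) (γ t, v t) (j t • rot M (γ t) (v t),
        k t • rot M (γ t) (v t) - j t • chr M (γ t) (v t) (rot M (γ t) (v t)))) t := by
  have hN := hasDerivAt_rot M hγ hv
  have hc := hasDerivAt_chr M hγ hv hN
  rw [fderiv_geoField]
  refine (hasDerivAt_rot_smul M hγ hv hj).prodMk
    (((hk.fun_smul hN).fun_sub (hj.fun_smul hc)).congr_deriv ?_)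
  have hcurv := curvature_identity M (γ t) (v t)
  ext l
  have hl := congrFun hcurv l
  simp only [chr, dchr, Fin.sum_univ_two, Pi.sub_apply, Pi.add_apply, Pi.neg_apply, Pi.smul_apply,
    smul_eq_mul, Γ_symm M _ 1 0] at hl ⊢
  linear_combination j t * hl

/-- The tangential Jacobi field `t γ'`. -/
lemma hasDerivAt_tangent_jacobi {γ v : ℝ → V2} {t : ℝ} (hγ : HasDerivAt γ (v t) t)
    (hv : HasDerivAt v (-chr M (γ t) (v t) (v t)) t) :
    HasDerivAt (fun s => (s • v s, v s - s • chr M (γ s) (v s) (v s)))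
      (fderiv ℝ (geoField M) (γ t, v t) (t • v t, v t - t • chr M (γ t) (v t) (v t))) t := by
  have hc := hasDerivAt_chr M hγ hv hv
  rw [fderiv_geoField]
  refine (((hasDerivAt_id' t).fun_smul hv).congr_deriv ?_).prodMk
    ((hv.fun_sub ((hasDerivAt_id' t).fun_smul hc)).congr_deriv ?_)
  · ext l; simp [add_comm, sub_eq_add_neg]
  · ext l
    simp only [chr, dchr, Fin.sum_univ_two, Pi.sub_apply, Pi.add_apply, Pi.neg_apply, Pi.smul_apply,
      smul_eq_mul, Γ_symm M _ 1 0]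
    ring

lemma hasDerivAt_met_self_zero {γ v : ℝ → V2} {t : ℝ} (hγ : HasDerivAt γ (v t) t)
    (hv : HasDerivAt v (-chr M (γ t) (v t) (v t)) t) :
    HasDerivAt (fun s => M.met (γ s) (v s) (v s)) 0 t := by
  have h := hasDerivAt_met M (u' := 0) (w' := 0) hγ (by simpa using hv) (by simpa using hv)
  refine h.congr_deriv ?_
  simp [RMetric.met]

end JacobiAlgebra

section LinearODE

lemma exists_solvesOn_of_bound {E : Type*} [NormedAddCommGroup E] [NormedSpace ℝ E]
    [FiniteDimensional ℝ E] {F : E → E} (hF : ContDiff ℝ 1 F) (x₀ : E) {T n : ℝ} (hT : 0 ≤ T)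
    (hn : ‖x₀‖ < n)
    (h : ∀ τ ∈ Icc 0 T, ∀ X : ℝ → E, X 0 = x₀ → SolvesOn F X τ → ‖X τ‖ < n) :
    ∃ X, X 0 = x₀ ∧ SolvesOn F X T := by
  rcases exists_solvesOn_or_exit hF x₀ hT hn with h1 | ⟨τ, hτ, X, hX0, hX, h2, -⟩
  · exact h1
  · exact absurd h2 (h τ hτ X hX0 hX).ne

/-- Global solvability of the scalar equation `j'' = -a j`. -/
lemma exists_jacobi_solution {a : ℝ → ℝ} (ha : ContDiff ℝ 1 a) (j₀ k₀ : ℝ) :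
    ∃ j k : ℝ → ℝ, j 0 = j₀ ∧ k 0 = k₀ ∧ (∀ t, HasDerivAt j (k t) t) ∧
      ∀ t, HasDerivAt k (-(a t * j t)) t := by
  let G : ℝ × ℝ × ℝ → ℝ × ℝ × ℝ := fun q => (1, q.2.2, -(a q.1 * q.2.1))
  have hG : ContDiff ℝ 1 G := by
    have h1 : ContDiff ℝ 1 fun q : ℝ × ℝ × ℝ => a q.1 := ha.comp contDiff_fst
    exact contDiff_const.prodMk ((contDiff_snd.comp contDiff_snd).prodMk
      (h1.mul (contDiff_fst.comp contDiff_snd)).neg)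
  have main : ∀ σ : ℝ, |σ| = 1 → ∀ T, 0 ≤ T →
      ∃ X : ℝ → ℝ × ℝ × ℝ, X 0 = (0, j₀, k₀) ∧ SolvesOn (fun x => σ • G x) X T := by
    intro σ hσ T hT
    obtain ⟨A, hA⟩ := (isCompact_Icc.image (s := Icc (-T) T) ha.continuous).isBounded.exists_norm_le
    have hA0 : 0 ≤ A := (norm_nonneg _).trans (hA (a 0) (mem_image_of_mem _ ⟨by linarith, hT⟩))
    set x₀ : ℝ × ℝ × ℝ := (0, j₀, k₀)
    have hpos : 0 ≤ gronwallBound ‖x₀‖ (A + 1) 1 T := by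
      have := gronwallBound_mono (norm_nonneg x₀) zero_le_one (by positivity : 0 ≤ A + 1) hT
      rw [gronwallBound_x0] at this
      exact (norm_nonneg _).trans this
    refine exists_solvesOn_of_bound (hG.const_smul σ) x₀ (n := max ‖x₀‖ (gronwallBound ‖x₀‖ (A + 1) 1 T) + 1)
      hT (by linarith [le_max_left ‖x₀‖ (gronwallBound ‖x₀‖ (A + 1) 1 T)]) ?_
    intro τ hτ X hX0 hX
    have hs : EqOn (fun t => (X t).1) (fun t => σ * t) (Icc 0 τ) := by
      refine SolvesOn.eqOn (F := fun _ => σ) contDiff_const (fun t ht => ?_) (fun t ht => ?_) ?_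
      · have := (hasFDerivAt_fst (𝕜 := ℝ) (p := X t)).comp_hasDerivWithinAt t (hX t ht)
        simpa [G, Function.comp_def] using this
      · simpa using ((hasDerivAt_id t).const_mul σ).hasDerivWithinAt
      · simp [hX0, x₀]
    have hb := norm_le_gronwallBound_of_norm_deriv_right_le (K := A + 1) (ε := 1) (δ := ‖x₀‖)
      hX.continuousOn hX.right (by rw [hX0]) (fun t ht => ?_) τ ⟨hτ.1, le_rfl⟩
    · rw [sub_zero] at hb
      have := gronwallBound_mono (norm_nonneg x₀) zero_le_one (by positivity : 0 ≤ A + 1) hτ.2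
      linarith [le_max_right ‖x₀‖ (gronwallBound ‖x₀‖ (A + 1) 1 T)]
    · rw [norm_smul, Real.norm_eq_abs, hσ, one_mul]
      have hst : (X t).1 = σ * t := hs ⟨ht.1, ht.2.le⟩
      have ha' : |a (X t).1| ≤ A := by
        refine hA _ (mem_image_of_mem _ ?_)
        rw [hst]
        refine abs_le.1 ?_
        rw [abs_mul, hσ, one_mul, abs_of_nonneg ht.1]
        linarith [ht.2, hτ.2]
      have h21 : |(X t).2.1| ≤ ‖X t‖ := (norm_fst_le (X t).2).trans (norm_snd_le (X t))
      have h22 : |(X t).2.2| ≤ ‖X t‖ := (norm_snd_le (X t).2).trans (norm_snd_le (X t))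
      have h0 := norm_nonneg (X t)
      have h3 : |a (X t).1 * (X t).2.1| ≤ A * ‖X t‖ := by
        rw [abs_mul]; exact mul_le_mul ha' h21 (abs_nonneg _) hA0
      refine norm_prod_le_iff.2 ⟨?_, norm_prod_le_iff.2 ⟨?_, ?_⟩⟩
      · simp only [G, norm_one]; nlinarith
      · simp only [G, Real.norm_eq_abs]; nlinarith
      · simp only [G, Real.norm_eq_abs, abs_neg]; nlinarith
  obtain ⟨X, hX0, hX⟩ := exists_global_solution hG (x₀ := (0, j₀, k₀))
    (fun T hT => by simpa using main 1 (by simp) T hT)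
    (fun T hT => by simpa using main (-1) (by simp) T hT)
  have h1 : ∀ t, (X t).1 = t := by
    have hd : ∀ t, HasDerivAt (fun t => (X t).1 - t) 0 t := fun t => by
      simpa [G] using (HasDerivAt.fun_sub (hasDerivAt_fst_comp (hX t)) (hasDerivAt_id t))
    intro t
    have := is_const_of_deriv_eq_zero (fun t => (hd t).differentiableAt) (fun t => (hd t).deriv) t 0
    simp only [hX0] at this
    linarith
  refine ⟨fun t => (X t).2.1, fun t => (X t).2.2, by simp [hX0], by simp [hX0], fun t => ?_, fun t => ?_⟩
  · simpa [G] using hasDerivAt_fst_comp (hasDerivAt_snd_comp (hX t))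
  · simpa [G, h1] using hasDerivAt_snd_comp (hasDerivAt_snd_comp (hX t))

end LinearODE

noncomputable section RiemannianDistance

open scoped ContDiff Topology
open Metric

variable (M : RMetric)

/-- The Riemannian norm of a tangent vector. -/
def gnorm (x v : V2) : ℝ := √(M.met x v v)

lemma gnorm_nonneg (x v : V2) : 0 ≤ gnorm M x v := Real.sqrt_nonneg _

lemma gnorm_smul (x v : V2) (c : ℝ) : gnorm M x (c • v) = |c| * gnorm M x v := by
  rw [gnorm, gnorm, met_smul_left, met_smul_right, ← mul_assoc, ← pow_two,
    Real.sqrt_mul (sq_nonneg c), Real.sqrt_sq_eq_abs]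

lemma contDiff_met {E : Type*} [NormedAddCommGroup E] [NormedSpace ℝ E] {f u v : E → V2}
    (hf : ContDiff ℝ ∞ f) (hu : ContDiff ℝ ∞ u) (hv : ContDiff ℝ ∞ v) :
    ContDiff ℝ ∞ fun e => M.met (f e) (u e) (v e) := by
  rw [contDiff_pi] at *
  exact ContDiff.sum fun i _ => ContDiff.sum fun j _ =>
    (((g_smooth M i j).comp (contDiff_pi.2 hf)).mul (hu i)).mul (hv j)

lemma continuous_gnorm : Continuous fun q : V2 × V2 => gnorm M q.1 q.2 :=
  (contDiff_met M contDiff_fst contDiff_snd contDiff_snd).continuous.sqrt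

lemma vel_eq_deriv {c : ℝ → V2} {v : V2} {t : ℝ} (h : HasDerivAt c v t) : vel c t = v := by
  ext k
  exact (hasDerivAt_pi.1 h k).deriv

lemma curveLen_eq {c v : ℝ → V2} (h : ∀ t, HasDerivAt c (v t) t) (a b : ℝ) :
    M.curveLen c a b = ∫ t in a..b, gnorm M (c t) (v t) := by
  simp only [RMetric.curveLen, gnorm, vel_eq_deriv (h _)]

lemma exists_velocity {c : ℝ → V2} (h : ContDiff ℝ 1 c) :
    ∃ v : ℝ → V2, Continuous v ∧ ∀ t, HasDerivAt c (v t) t :=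
  ⟨deriv c, h.continuous_deriv le_rfl, fun t => (h.differentiable one_ne_zero t).hasDerivAt⟩

lemma curveLen_nonneg (c : ℝ → V2) {a b : ℝ} (hab : a ≤ b) : 0 ≤ M.curveLen c a b :=
  intervalIntegral.integral_nonneg hab fun _ _ => Real.sqrt_nonneg _

lemma dist_set_bddBelow (p q : V2) :
    BddBelow {L | ∃ γ : ℝ → V2, ContDiff ℝ 1 γ ∧ γ 0 = p ∧ γ 1 = q ∧ L = M.curveLen γ 0 1} :=
  ⟨0, by rintro _ ⟨γ, -, -, -, rfl⟩; exact curveLen_nonneg M γ zero_le_one⟩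

lemma dist_set_nonempty (p q : V2) :
    {L | ∃ γ : ℝ → V2, ContDiff ℝ 1 γ ∧ γ 0 = p ∧ γ 1 = q ∧ L = M.curveLen γ 0 1}.Nonempty :=
  ⟨_, fun t => p + t • (q - p), by fun_prop, by simp, by simp, rfl⟩

lemma rdist_le_curveLen {γ : ℝ → V2} (h : ContDiff ℝ 1 γ) :
    M.dist (γ 0) (γ 1) ≤ M.curveLen γ 0 1 :=
  csInf_le (dist_set_bddBelow M _ _) ⟨γ, h, rfl, rfl, rfl⟩

lemma le_rdist {p q : V2} {ℓ : ℝ} (h : ∀ c v : ℝ → V2, Continuous v → (∀ t, HasDerivAt c (v t) t) →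
    c 0 = p → c 1 = q → ℓ ≤ ∫ t in (0:ℝ)..1, gnorm M (c t) (v t)) : ℓ ≤ M.dist p q := by
  refine le_csInf (dist_set_nonempty M p q) ?_
  rintro _ ⟨γ, hγ, h0, h1, rfl⟩
  obtain ⟨v, hv, hd⟩ := exists_velocity hγ
  rw [curveLen_eq M hd]
  exact h γ v hv hd h0 h1

lemma exists_lt_of_rdist_lt {p q : V2} {ℓ : ℝ} (h : M.dist p q < ℓ) : ∃ c v : ℝ → V2, Continuous v ∧
    (∀ t, HasDerivAt c (v t) t) ∧ c 0 = p ∧ c 1 = q ∧ ∫ t in (0:ℝ)..1, gnorm M (c t) (v t) < ℓ := by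
  by_contra! hc
  exact absurd (le_rdist M hc) (not_le.2 h)

/-- The distance between the endpoints of a curve is at most its length. -/
lemma rdist_le_integral {c v : ℝ → V2} {a b : ℝ} (hab : a ≤ b) (hv : ContinuousOn v (Icc a b))
    (hc : ∀ t ∈ Icc a b, HasDerivWithinAt c (v t) (Icc a b) t) :
    M.dist (c a) (c b) ≤ ∫ t in a..b, gnorm M (c t) (v t) := by
  let κ : ℝ → ℝ := fun t => a + (b - a) * t
  let w : ℝ → V2 := fun s => (b - a) • v (max a (min b (κ s)))
  have hclamp : ∀ s, max a (min b s) ∈ Icc a b := fun s =>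
    ⟨le_max_left _ _, max_le hab (min_le_left _ _)⟩
  have hκ : ∀ t ∈ Icc (0:ℝ) 1, κ t ∈ Icc a b := fun t ht =>
    ⟨by simp only [κ]; nlinarith [ht.1], by simp only [κ]; nlinarith [ht.2]⟩
  have hw : Continuous w := by
    have hcl : Continuous fun s : ℝ => max a (min b (a + (b - a) * s)) := by fun_prop
    exact (hv.comp_continuous hcl fun s => hclamp _).const_smul (b - a)
  have hwκ : ∀ t ∈ Icc (0:ℝ) 1, w t = (b - a) • v (κ t) := fun t ht => by
    have := hκ t ht
    simp only [w, min_eq_right this.2, max_eq_right this.1]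
  have hκd : ∀ t, HasDerivAt κ (b - a) t := fun t => by
    simpa [κ] using ((hasDerivAt_id t).const_mul (b - a)).const_add a
  have hcκ : ∀ t ∈ Icc (0:ℝ) 1, HasDerivWithinAt (fun t => c (κ t)) (w t) (Icc 0 1) t := by
    intro t ht
    rw [hwκ t ht]
    exact (hc _ (hκ t ht)).scomp t (hκd t).hasDerivWithinAt hκ
  have hFTC : ∀ t ∈ Icc (0:ℝ) 1, c a + ∫ s in (0:ℝ)..t, w s = c (κ t) := by
    intro t ht
    have := intervalIntegral.integral_eq_sub_of_hasDeriv_right_of_le (f := fun t => c (κ t)) (f' := w)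
      ht.1 (fun s hs => ((hcκ s ⟨hs.1, hs.2.trans ht.2⟩).continuousWithinAt).mono
        (Icc_subset_Icc_right ht.2)) (fun s hs => (hcκ s ⟨hs.1.le, hs.2.le.trans ht.2⟩).mono_of_mem_nhdsWithin
          (mem_of_superset (Ioc_mem_nhdsGT (hs.2.trans_le ht.2))
            (fun r hr => ⟨hs.1.le.trans hr.1.le, hr.2⟩))) (hw.intervalIntegrable _ _)
    rw [this]; simp [κ]
  have hd : ∀ t, HasDerivAt (fun t => c a + ∫ s in (0:ℝ)..t, w s) (w t) t := fun t =>
    (intervalIntegral.integral_hasDerivAt_right (hw.intervalIntegrable _ _)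
      (hw.stronglyMeasurableAtFilter _ _) hw.continuousAt).const_add _
  have hC1 : ContDiff ℝ 1 (fun t => c a + ∫ s in (0:ℝ)..t, w s) := by
    rw [contDiff_one_iff_deriv]
    refine ⟨fun t => (hd t).differentiableAt, ?_⟩
    have : deriv (fun t => c a + ∫ s in (0:ℝ)..t, w s) = w := funext fun t => (hd t).deriv
    rw [this]; exact hw
  have h1 := rdist_le_curveLen M hC1
  have e1 : κ 1 = b := by simp [κ]
  rw [curveLen_eq M hd, hFTC 1 ⟨zero_le_one, le_rfl⟩, e1] at h1
  simp only [intervalIntegral.integral_same, add_zero] at h1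
  refine h1.trans (le_of_eq ?_)
  have h2 : ∫ t in (0:ℝ)..1, gnorm M (c a + ∫ s in (0:ℝ)..t, w s) (w t) =
      ∫ t in (0:ℝ)..1, (b - a) * gnorm M (c (a + (b - a) * t)) (v (a + (b - a) * t)) := by
    refine intervalIntegral.integral_congr fun t ht => ?_
    rw [uIcc_of_le zero_le_one] at ht
    simp only [hFTC t ht, hwκ t ht, gnorm_smul, abs_of_nonneg (sub_nonneg.2 hab), κ]
  rw [h2, intervalIntegral.integral_const_mul]
  have h3 := intervalIntegral.smul_integral_comp_add_mul (a := 0) (b := 1)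
    (fun t => gnorm M (c t) (v t)) (b - a) a
  simpa using h3

lemma rdist_comm (p q : V2) : M.dist p q = M.dist q p := by
  have key : ∀ p q, M.dist p q ≤ M.dist q p := by
    intro p q
    refine le_rdist M fun c v hv hc h0 h1 => ?_
    have hd : ∀ t, HasDerivAt (fun t => c (1 - t)) (-v (1 - t)) t := fun t => by
      have := (hc (1 - t)).scomp t ((hasDerivAt_id' t).const_sub 1)
      simpa [Function.comp_def] using this
    have := rdist_le_integral M (c := fun t => c (1 - t)) (v := fun t => -v (1 - t)) zero_le_one
      (Continuous.continuousOn (by fun_prop)) (fun t _ => (hd t).hasDerivWithinAt)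
    simp only [sub_zero, sub_self, h0, h1] at this
    refine this.trans (le_of_eq ?_)
    have h3 := intervalIntegral.integral_comp_sub_left (a := 0) (b := 1)
      (fun t => gnorm M (c t) (v t)) 1
    simp only [sub_zero, sub_self] at h3
    rw [← h3]
    refine intervalIntegral.integral_congr fun t _ => ?_
    have := gnorm_smul M (c (1 - t)) (v (1 - t)) (-1)
    simpa using this
  exact le_antisymm (key p q) (key q p)

lemma exists_gnorm_lower_bound {S : Set V2} (hS : IsCompact S) :
    ∃ c > 0, ∀ x ∈ S, ∀ v, c * ‖v‖ ≤ gnorm M x v := by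
  rcases S.eq_empty_or_nonempty with rfl | hne
  · exact ⟨1, one_pos, by simp⟩
  obtain ⟨⟨x₀, u₀⟩, ⟨hx₀, hu₀⟩, hmin⟩ := (hS.prod (isCompact_sphere (0 : V2) 1)).exists_isMinOn
    (hne.prod ⟨fun _ => 1, by simp⟩) (continuous_gnorm M).continuousOn
  have hu₀' : u₀ ≠ 0 := by
    rintro rfl
    simp at hu₀
  refine ⟨gnorm M x₀ u₀, Real.sqrt_pos.2 (met_pos M hu₀'), fun x hx v => ?_⟩
  by_cases hv : v = 0
  · simp [hv, gnorm_nonneg]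
  have hn : 0 < ‖v‖ := norm_pos_iff.2 hv
  have h1 : gnorm M x₀ u₀ ≤ gnorm M x (‖v‖⁻¹ • v) := hmin (a := (x, ‖v‖⁻¹ • v))
    ⟨hx, by simp [norm_smul, hn.ne']⟩
  rw [gnorm_smul, abs_of_pos (inv_pos.2 hn)] at h1
  rw [inv_mul_eq_div, le_div_iff₀ hn] at h1
  exact h1

lemma exists_rdist_lower_bound {S : Set V2} (hS : IsCompact S) :
    ∃ c > 0, ∀ q ∈ S, ∀ x, c * min 1 ‖x - q‖ ≤ M.dist q x := by
  obtain ⟨c, hc, hlow⟩ := exists_gnorm_lower_bound M (hS.cthickening (r := 1))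
  refine ⟨c, hc, fun q hq x => le_rdist M fun γ v hv hγ h0 h1 => ?_⟩
  have hγc : Continuous γ := continuous_iff_continuousAt.2 fun t => (hγ t).continuousAt
  have hgc : Continuous fun t => gnorm M (γ t) (v t) := (continuous_gnorm M).comp (hγc.prodMk hv)
  obtain ⟨τ, hτ, hm, hle⟩ : ∃ τ ∈ Icc (0:ℝ) 1, min 1 ‖x - q‖ ≤ ‖γ τ - q‖ ∧
      ∀ t ∈ Icc 0 τ, ‖γ t - q‖ ≤ 1 := by
    by_cases hex : ∃ t ∈ Icc (0:ℝ) 1, 1 ≤ ‖γ t - q‖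
    · obtain ⟨τ, hτ, h2, h3⟩ := exists_first_time (f := fun t => ‖γ t - q‖) (n := 1)
        (Continuous.continuousOn (by fun_prop)) (by simp [h0]) hex
      exact ⟨τ, ⟨hτ.1.le, hτ.2⟩, by rw [h2]; exact min_le_left _ _, h3⟩
    · push Not at hex
      exact ⟨1, ⟨zero_le_one, le_rfl⟩, by rw [h1]; exact min_le_right _ _, fun t ht => (hex t ht).le⟩
  have hFTC : ∫ t in (0:ℝ)..τ, v t = γ τ - q := by
    rw [intervalIntegral.integral_eq_sub_of_hasDerivAt (fun t _ => hγ t) (hv.intervalIntegrable _ _), h0]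
  calc c * min 1 ‖x - q‖ ≤ c * ‖γ τ - q‖ := mul_le_mul_of_nonneg_left hm hc.le
    _ ≤ c * ∫ t in (0:ℝ)..τ, ‖v t‖ := by
        rw [← hFTC]
        exact mul_le_mul_of_nonneg_left (intervalIntegral.norm_integral_le_integral_norm hτ.1) hc.le
    _ = ∫ t in (0:ℝ)..τ, c * ‖v t‖ := by rw [intervalIntegral.integral_const_mul]
    _ ≤ ∫ t in (0:ℝ)..τ, gnorm M (γ t) (v t) := by
        refine intervalIntegral.integral_mono_on hτ.1 (Continuous.intervalIntegrable (by fun_prop) _ _)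
          (hgc.intervalIntegrable _ _) fun t ht => hlow _ ?_ _
        refine closedBall_subset_cthickening hq 1 ?_
        rw [mem_closedBall_iff_norm]; exact hle t ht
    _ ≤ ∫ t in (0:ℝ)..1, gnorm M (γ t) (v t) :=
        intervalIntegral.integral_mono_interval le_rfl hτ.1 hτ.2
          (Eventually.of_forall fun t => gnorm_nonneg M _ _) (hgc.intervalIntegrable _ _)

lemma tendsto_of_rdist_tendsto_zero {ι : Type*} {l : Filter ι} {u : ι → V2} {q : V2}
    (h : Tendsto (fun n => M.dist (u n) q) l (𝓝 0)) : Tendsto u l (𝓝 q) := by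
  obtain ⟨c, hc, hlow⟩ := exists_rdist_lower_bound M (isCompact_singleton (x := q))
  rw [Metric.tendsto_nhds]
  intro ε hε
  filter_upwards [h.eventually_lt_const (show 0 < c * min 1 ε by positivity)] with n hn
  rw [rdist_comm] at hn
  have := lt_of_mul_lt_mul_left ((hlow q rfl (u n)).trans_lt hn) hc.le
  rw [dist_eq_norm]
  by_contra! hcon
  exact absurd (min_le_min_left 1 hcon) (not_le.2 this)

end RiemannianDistance

noncomputable section GeodesicCompleteness

open scoped ContDiff Topology
open Metric

variable (M : RMetric)

lemma geoField_contDiff_one : ContDiff ℝ 1 (geoField M) :=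
  (geoField_contDiff M).of_le (by simp)

lemma SolvesOn.gnorm_eq {X : ℝ → V2 × V2} {τ : ℝ} (h : SolvesOn (geoField M) X τ) {t : ℝ}
    (ht : t ∈ Icc 0 τ) : gnorm M (X t).1 (X t).2 = gnorm M (X 0).1 (X 0).2 := by
  rcases ht.1.eq_or_lt with rfl | h0
  · rfl
  have hc : ContinuousOn (fun s => M.met (X s).1 (X s).2 (X s).2) (Icc 0 t) :=
    (contDiff_met M contDiff_fst contDiff_snd contDiff_snd).continuous.comp_continuousOn
      (h.mono ht.2).continuousOn
  obtain ⟨c, -, hc⟩ := exists_hasDerivAt_eq_slope _ (fun _ => (0:ℝ)) h0 hc fun s hs => by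
    have hX := (h s ⟨hs.1.le, hs.2.le.trans ht.2⟩).hasDerivAt (Icc_mem_nhds hs.1 (hs.2.trans_le ht.2))
    exact hasDerivAt_met_self_zero M (v := fun s => (X s).2) (hasDerivAt_fst_comp hX)
      (hasDerivAt_snd_comp hX)
  rw [eq_div_iff (by linarith), zero_mul, eq_comm, sub_eq_zero] at hc
  simp only [gnorm, hc]

lemma SolvesOn.rdist_le {X : ℝ → V2 × V2} {τ : ℝ} (h : SolvesOn (geoField M) X τ) {a b : ℝ}
    (ha : 0 ≤ a) (hab : a ≤ b) (hb : b ≤ τ) :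
    M.dist (X a).1 (X b).1 ≤ gnorm M (X 0).1 (X 0).2 * (b - a) := by
  have hsub : Icc a b ⊆ Icc 0 τ := Icc_subset_Icc ha hb
  have h1 := rdist_le_integral M (c := fun t => (X t).1) (v := fun t => (X t).2) hab
    (continuous_snd.comp_continuousOn (h.continuousOn.mono hsub)) fun t ht =>
      ((ContinuousLinearMap.fst ℝ V2 V2).hasFDerivAt.comp_hasDerivWithinAt t (h t (hsub ht))).mono hsub
  refine h1.trans (le_of_eq ?_)
  rw [intervalIntegral.integral_congr (g := fun _ => gnorm M (X 0).1 (X 0).2) fun t ht => ?_]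
  · simp [mul_comm]
  · rw [uIcc_of_le hab] at ht
    exact h.gnorm_eq M (hsub ht)

/-- Forward completeness of the geodesic flow. -/
lemma exists_forward_geodesic (hcomp : M.Complete) (q : V2 × V2) {T : ℝ} (hT : 0 ≤ T) :
    ∃ X, X 0 = q ∧ SolvesOn (geoField M) X T := by
  by_contra hno
  have hex := fun n : ℕ => (exists_solvesOn_or_exit (geoField_contDiff_one M) q (n := n + ‖q‖ + 1) hT
    (by have : (0:ℝ) ≤ n := n.cast_nonneg
        linarith)).resolve_left hno
  choose τ hτ X hX0 hX hXn _ using hex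
  set s := gnorm M q.1 q.2 with hs
  have hle : ∀ m n, τ m ≤ τ n → M.dist (X m (τ m)).1 (X n (τ n)).1 ≤ s * (τ n - τ m) := by
    intro m n hmn
    have e : X m (τ m) = X n (τ m) := (hX m).eqOn (geoField_contDiff_one M) ((hX n).mono hmn)
      ((hX0 m).trans (hX0 n).symm) ⟨(hτ m).1, le_rfl⟩
    have := (hX n).rdist_le M (hτ m).1 hmn le_rfl
    rwa [hX0, ← e] at this
  have hle' : ∀ m n, M.dist (X m (τ m)).1 (X n (τ n)).1 ≤ s * |τ n - τ m| := by
    intro m n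
    rcases le_total (τ m) (τ n) with h | h
    · rw [abs_of_nonneg (sub_nonneg.2 h)]; exact hle m n h
    · rw [abs_sub_comm, abs_of_nonneg (sub_nonneg.2 h), rdist_comm]; exact hle n m h
  obtain ⟨τ₀, -, φ, hφ, hlim⟩ := isCompact_Icc.tendsto_subseq hτ
  obtain ⟨x, hx⟩ := hcomp (fun n => (X (φ n) (τ (φ n))).1) fun ε hε => by
    obtain ⟨N, hN⟩ := Metric.cauchySeq_iff.1 hlim.cauchySeq (ε / (s + 1))
      (div_pos hε (by linarith [gnorm_nonneg M q.1 q.2]))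
    refine ⟨N, fun m hm n hn => (hle' _ _).trans_lt ?_⟩
    have h1 := hN n hn m hm
    rw [Real.dist_eq] at h1
    have h2 := gnorm_nonneg M q.1 q.2
    rw [lt_div_iff₀ (by linarith)] at h1
    simp only [Function.comp_def] at h1
    nlinarith [abs_nonneg (τ (φ n) - τ (φ m))]
  have hconv := tendsto_of_rdist_tendsto_zero M hx
  have hcpt := hconv.isCompact_insert_range
  obtain ⟨R, hR⟩ := hcpt.isBounded.exists_norm_le
  obtain ⟨c, hc, hlow⟩ := exists_gnorm_lower_bound M hcpt
  obtain ⟨n, hn⟩ := exists_nat_gt (max R (s / c))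
  have h1 := hXn (φ n)
  have hmem : (X (φ n) (τ (φ n))).1 ∈ insert x (range fun n => (X (φ n) (τ (φ n))).1) :=
    mem_insert_of_mem _ ⟨n, rfl⟩
  have h2 := hlow _ hmem (X (φ n) (τ (φ n))).2
  rw [(hX (φ n)).gnorm_eq M ⟨(hτ _).1, le_rfl⟩, hX0, mul_comm, ← le_div_iff₀ hc] at h2
  have h3 : ‖X (φ n) (τ (φ n))‖ ≤ max R (s / c) := by
    rw [Prod.norm_def]
    exact max_le_max (hR _ hmem) h2
  have h4 : (n:ℝ) ≤ φ n := Nat.cast_le.2 (hφ.id_le n)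
  linarith [norm_nonneg q]

/-- Completeness of the geodesic flow. -/
lemma exists_geodesic (hcomp : M.Complete) (q : V2 × V2) :
    ∃ X : ℝ → V2 × V2, X 0 = q ∧ ∀ t, HasDerivAt X (geoField M (X t)) t := by
  refine exists_global_solution (geoField_contDiff_one M)
    (fun T hT => exists_forward_geodesic M hcomp q hT) fun T hT => ?_
  obtain ⟨X, hX0, hX⟩ := exists_forward_geodesic M hcomp (q.1, -q.2) hT
  refine ⟨fun t => ((X t).1, -(X t).2), by simp [hX0], fun t ht => ?_⟩
  have h1 := (ContinuousLinearMap.fst ℝ V2 V2).hasFDerivAt.comp_hasDerivWithinAt t (hX t ht)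
  have h2 := (ContinuousLinearMap.snd ℝ V2 V2).hasFDerivAt.comp_hasDerivWithinAt t (hX t ht)
  refine (h1.prodMk h2.neg).congr_deriv ?_
  have e : chr M (X t).1 (-(X t).2) (-(X t).2) = chr M (X t).1 (X t).2 (X t).2 := by
    ext k; simp [chr]
  simp [geoField, e]

/-- The geodesic field together with the equation of its normal Jacobi fields. -/
def jacField (q : (V2 × V2) × (ℝ × ℝ)) : (V2 × V2) × (ℝ × ℝ) :=
  (geoField M q.1, (q.2.2, -(M.K q.1.1 * M.met q.1.1 q.1.2 q.1.2 * q.2.1)))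

lemma jacField_contDiff : ContDiff ℝ ∞ (jacField M) := by
  refine ((geoField_contDiff M).comp contDiff_fst).prodMk ((contDiff_snd.comp contDiff_snd).prodMk ?_)
  exact ((((K_smooth M).comp (contDiff_fst.comp contDiff_fst)).mul
    (contDiff_met M (contDiff_fst.comp contDiff_fst) (contDiff_snd.comp contDiff_fst)
      (contDiff_snd.comp contDiff_fst))).mul (contDiff_fst.comp contDiff_snd)).neg

lemma contDiff_infty_of_hasDerivAt {E : Type*} [NormedAddCommGroup E] [NormedSpace ℝ E]
    {F : E → E} (hF : ContDiff ℝ ∞ F) {X : ℝ → E} (h : ∀ t, HasDerivAt X (F (X t)) t) :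
    ContDiff ℝ ∞ X := by
  rw [contDiff_infty]
  intro n
  induction n with
  | zero => exact contDiff_zero.2 (continuous_iff_continuousAt.2 fun t => (h t).continuousAt)
  | succ n ih =>
    rw [show ((n + 1 : ℕ) : WithTop ℕ∞) = (n : WithTop ℕ∞) + 1 by norm_cast, contDiff_succ_iff_deriv]
    refine ⟨fun t => (h t).differentiableAt, by simp, ?_⟩
    rw [show deriv X = fun t => F (X t) from funext fun t => (h t).deriv]
    exact (hF.of_le (by exact_mod_cast le_top)).comp ih

lemma exists_jacobi_flow (hcomp : M.Complete) (q : (V2 × V2) × (ℝ × ℝ)) :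
    ∃ X : ℝ → (V2 × V2) × (ℝ × ℝ), X 0 = q ∧ ∀ t, HasDerivAt X (jacField M (X t)) t := by
  obtain ⟨X, hX0, hX⟩ := exists_geodesic M hcomp q.1
  have hXs := contDiff_infty_of_hasDerivAt (geoField_contDiff M) hX
  have ha : ContDiff ℝ 1 fun t => M.K (X t).1 * M.met (X t).1 (X t).2 (X t).2 := by
    refine ContDiff.of_le (n := ∞) ?_ (by simp)
    exact ((K_smooth M).comp (contDiff_fst.comp hXs)).mul
      (contDiff_met M (contDiff_fst.comp hXs) (contDiff_snd.comp hXs) (contDiff_snd.comp hXs))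
  obtain ⟨j, k, hj0, hk0, hj, hk⟩ := exists_jacobi_solution ha q.2.1 q.2.2
  exact ⟨fun t => (X t, (j t, k t)), by simp [hX0, hj0, hk0], fun t => (hX t).prodMk ((hj t).prodMk (hk t))⟩

end GeodesicCompleteness

noncomputable section ExponentialMap

open scoped ContDiff Topology
open Metric

variable (M : RMetric)

/-- The unit vector of constant direction `(1, 1)` at `p`. -/
def baseVec (p : V2) : V2 := (gnorm M p fun _ => 1)⁻¹ • fun _ => 1

lemma met_baseVec (p : V2) : M.met p (baseVec M p) (baseVec M p) = 1 := by
  have h : (0:ℝ) < M.met p (fun _ => 1) (fun _ => 1) :=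
    met_pos M fun h => one_ne_zero (congrFun h 0)
  rw [baseVec, met_smul_left, met_smul_right, gnorm, ← mul_assoc, ← mul_inv,
    Real.mul_self_sqrt h.le, inv_mul_cancel₀ h.ne']

/-- An isometry from `ℂ` onto the tangent space at `p`. -/
def frame (p : V2) : ℂ →L[ℝ] V2 :=
  Complex.reCLM.smulRight (baseVec M p) + Complex.imCLM.smulRight (rot M p (baseVec M p))

lemma frame_apply (p : V2) (z : ℂ) :
    frame M p z = z.re • baseVec M p + z.im • rot M p (baseVec M p) := rfl

lemma met_frame (p : V2) (z : ℂ) : M.met p (frame M p z) (frame M p z) = ‖z‖ ^ 2 := by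
  simp only [frame_apply, met_add_left, met_add_right, met_smul_left, met_smul_right, met_rot_rot,
    met_self_rot, met_comm M p (rot M p _) (baseVec M p), met_baseVec]
  rw [Complex.sq_norm, Complex.normSq_apply]
  ring

lemma rot_frame (p : V2) (z : ℂ) : rot M p (frame M p z) = frame M p (Complex.I * z) := by
  simp only [frame_apply, rot_add, rot_smul, rot_rot, Complex.I_mul_re, Complex.I_mul_im]
  rw [add_comm]; simp

/-- The wedge of two vectors of the coordinate plane. -/
def wedge (v w : V2) : ℝ := v 0 * w 1 - v 1 * w 0

lemma wedge_frame (p : V2) (z w : ℂ) : wedge (frame M p z) (frame M p w) * √(M.g p).det =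
    z.re * w.im - z.im * w.re := by
  have h := wedge_rot M p (baseVec M p)
  rw [met_baseVec] at h
  simp only [wedge, frame_apply, Pi.add_apply, Pi.smul_apply, smul_eq_mul]
  linear_combination (z.re * w.im - z.im * w.re) * h

lemma eq_of_hasDerivAt_zero {f : ℝ → ℝ} (h : ∀ t, HasDerivAt f 0 t) (a b : ℝ) : f a = f b :=
  is_const_of_deriv_eq_zero (fun t => (h t).differentiableAt) (fun t => (h t).deriv) a b

variable {M} (hcomp : M.Complete) (p : V2)

/-- The flow of the geodesic and Jacobi equations. -/
def flow (q : (V2 × V2) × (ℝ × ℝ)) : ℝ → (V2 × V2) × (ℝ × ℝ) :=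
  (exists_jacobi_flow M hcomp q).choose

lemma flow_zero (q : (V2 × V2) × (ℝ × ℝ)) : flow hcomp q 0 = q :=
  (exists_jacobi_flow M hcomp q).choose_spec.1

lemma hasDerivAt_flow (q : (V2 × V2) × (ℝ × ℝ)) (t : ℝ) :
    HasDerivAt (flow hcomp q) (jacField M (flow hcomp q t)) t :=
  (exists_jacobi_flow M hcomp q).choose_spec.2 t

lemma jacField_contDiff_one : ContDiff ℝ 1 (jacField M) :=
  (jacField_contDiff M).of_le (by simp)

lemma eq_flow {X : ℝ → (V2 × V2) × (ℝ × ℝ)} (hX : ∀ t, HasDerivAt X (jacField M (X t)) t) {t : ℝ}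
    (ht : 0 ≤ t) : X t = flow hcomp (X 0) t :=
  (solvesOn_of_hasDerivAt hX t).eqOn jacField_contDiff_one
    (solvesOn_of_hasDerivAt (hasDerivAt_flow hcomp _) t) (flow_zero hcomp _).symm ⟨ht, le_rfl⟩

/-- The geodesic with initial velocity `z`, its velocity, and its normal Jacobi field. -/
def ray (z : ℂ) : ℝ → (V2 × V2) × (ℝ × ℝ) := flow hcomp ((p, frame M p z), (0, 1))

lemma ray_zero (z : ℂ) : ray hcomp p z 0 = ((p, frame M p z), (0, 1)) := flow_zero hcomp _

lemma hasDerivAt_ray (z : ℂ) (t : ℝ) :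
    HasDerivAt (ray hcomp p z) (jacField M (ray hcomp p z t)) t := hasDerivAt_flow hcomp _ t

lemma continuous_ray : Continuous fun q : ℂ × ℝ => ray hcomp p q.1 q.2 := by
  refine continuous_solution_family jacField_contDiff_one (hasDerivAt_ray hcomp p) ?_
  simp only [ray_zero]
  fun_prop

lemma hasDerivAt_ray_pos (z : ℂ) (t : ℝ) :
    HasDerivAt (fun t => (ray hcomp p z t).1.1) (ray hcomp p z t).1.2 t :=
  hasDerivAt_fst_comp (hasDerivAt_fst_comp (hasDerivAt_ray hcomp p z t))

lemma hasDerivAt_ray_vel (z : ℂ) (t : ℝ) :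
    HasDerivAt (fun t => (ray hcomp p z t).1.2)
      (-chr M (ray hcomp p z t).1.1 (ray hcomp p z t).1.2 (ray hcomp p z t).1.2) t :=
  hasDerivAt_snd_comp (hasDerivAt_fst_comp (hasDerivAt_ray hcomp p z t))

lemma hasDerivAt_ray_jac (z : ℂ) (t : ℝ) :
    HasDerivAt (fun t => (ray hcomp p z t).2.1) (ray hcomp p z t).2.2 t :=
  hasDerivAt_fst_comp (hasDerivAt_snd_comp (hasDerivAt_ray hcomp p z t))

lemma met_ray (z : ℂ) (t : ℝ) :
    M.met (ray hcomp p z t).1.1 (ray hcomp p z t).1.2 (ray hcomp p z t).1.2 = ‖z‖ ^ 2 := by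
  have h := eq_of_hasDerivAt_zero (fun t => hasDerivAt_met_self_zero M (hasDerivAt_ray_pos hcomp p z t)
    (hasDerivAt_ray_vel hcomp p z t)) t 0
  rw [h, ray_zero, met_frame]

lemma hasDerivAt_ray_jac' (z : ℂ) (t : ℝ) :
    HasDerivAt (fun t => (ray hcomp p z t).2.2)
      (-(M.K (ray hcomp p z t).1.1 * ‖z‖ ^ 2 * (ray hcomp p z t).2.1)) t := by
  rw [← met_ray hcomp p z t]
  exact hasDerivAt_snd_comp (hasDerivAt_snd_comp (hasDerivAt_ray hcomp p z t))

lemma ray_smul (z : ℂ) {t s : ℝ} (ht : 0 < t) (hs : 0 ≤ s) : ray hcomp p (t * z) s =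
    (((ray hcomp p z (t * s)).1.1, t • (ray hcomp p z (t * s)).1.2),
      (t⁻¹ * (ray hcomp p z (t * s)).2.1, (ray hcomp p z (t * s)).2.2)) := by
  have hm : ∀ s, HasDerivAt (fun s => t * s) t s := fun s => by
    simpa using (hasDerivAt_id s).const_mul t
  have hcp : ∀ (Y : ℝ → V2) (Y' : V2) (s : ℝ), HasDerivAt Y Y' (t * s) →
      HasDerivAt (fun s => Y (t * s)) (t • Y') s := fun Y Y' s h => h.scomp s (hm s)
  have hcr : ∀ (Y : ℝ → ℝ) (Y' : ℝ) (s : ℝ), HasDerivAt Y Y' (t * s) →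
      HasDerivAt (fun s => Y (t * s)) (t * Y') s := fun Y Y' s h => h.scomp s (hm s)
  have hY : ∀ s, HasDerivAt (fun s => (((ray hcomp p z (t * s)).1.1, t • (ray hcomp p z (t * s)).1.2),
      (t⁻¹ * (ray hcomp p z (t * s)).2.1, (ray hcomp p z (t * s)).2.2)))
      (jacField M (((ray hcomp p z (t * s)).1.1, t • (ray hcomp p z (t * s)).1.2),
      (t⁻¹ * (ray hcomp p z (t * s)).2.1, (ray hcomp p z (t * s)).2.2))) s := by
    intro s
    have h1 := hcp _ _ s (hasDerivAt_ray_pos hcomp p z (t * s))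
    have h2 := (hcp _ _ s (hasDerivAt_ray_vel hcomp p z (t * s))).const_smul t
    have h3 := (hcr _ _ s (hasDerivAt_ray_jac hcomp p z (t * s))).const_mul t⁻¹
    have h4 := hcr _ _ s (hasDerivAt_ray_jac' hcomp p z (t * s))
    refine ((h1.prodMk h2).prodMk (h3.prodMk h4)).congr_deriv ?_
    simp only [jacField, geoField, met_smul_left, met_smul_right, met_ray]
    have e : ∀ x v : V2, chr M x (t • v) (t • v) = t • t • chr M x v v := by
      intro x v; ext k
      simp only [chr, Pi.smul_apply, smul_eq_mul, Fin.sum_univ_two]; ring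
    rw [e, smul_neg, smul_neg]
    congr 2
    · field_simp
    · field_simp
  have h0 : (((ray hcomp p z (t * 0)).1.1, t • (ray hcomp p z (t * 0)).1.2),
      (t⁻¹ * (ray hcomp p z (t * 0)).2.1, (ray hcomp p z (t * 0)).2.2)) =
      ((p, frame M p (t * z)), ((0 : ℝ), (1 : ℝ))) := by
    rw [mul_zero, ray_zero, ← Complex.real_smul, map_smul, mul_zero]
  have := eq_flow hcomp hY hs
  simp only [h0] at this
  exact this.symm

lemma ray_origin {s : ℝ} (hs : 0 ≤ s) : ray hcomp p 0 s = ((p, 0), (s, 1)) := by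
  have e : ∀ x : V2, chr M x 0 0 = 0 := fun x => by ext k; simp [chr]
  have e' : M.met p 0 0 = 0 := by simp [RMetric.met]
  have hY : ∀ s : ℝ, HasDerivAt (fun s : ℝ => (((p, (0 : V2)), (s, (1 : ℝ))) : (V2 × V2) × (ℝ × ℝ)))
      (jacField M ((p, 0), (s, 1))) s := by
    intro s
    refine ((hasDerivAt_const s (p, (0 : V2))).prodMk
      ((hasDerivAt_id' s).prodMk (hasDerivAt_const s (1 : ℝ)))).congr_deriv ?_
    simp only [jacField, geoField, e, e', neg_zero, mul_zero, zero_mul]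
    rfl
  have := eq_flow hcomp hY hs
  rw [this, ray, map_zero]

/-- The exponential map at `p`, in an orthonormal frame. -/
def expMap (z : ℂ) : V2 := (ray hcomp p z 1).1.1

lemma continuous_expMap : Continuous (expMap hcomp p) := by
  have := (continuous_ray hcomp p).comp (continuous_id.prodMk (continuous_const (y := (1:ℝ))))
  exact continuous_fst.comp (continuous_fst.comp this)

lemma expMap_zero : expMap hcomp p 0 = p := by rw [expMap, ray_origin hcomp p zero_le_one]

lemma expMap_smul (z : ℂ) {t : ℝ} (ht : 0 ≤ t) : expMap hcomp p (t * z) = (ray hcomp p z t).1.1 := by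
  rcases ht.eq_or_lt with rfl | ht
  · rw [Complex.ofReal_zero, zero_mul, expMap_zero, ray_zero]
  · rw [expMap, ray_smul hcomp p z ht zero_le_one, mul_one]

lemma jac_smul (z : ℂ) {t : ℝ} (ht : 0 < t) :
    (ray hcomp p (t * z) 1).2.1 = t⁻¹ * (ray hcomp p z t).2.1 := by
  rw [ray_smul hcomp p z ht zero_le_one, mul_one]

end ExponentialMap

noncomputable section ExponentialDerivative

open scoped ContDiff Topology
open Metric

variable {M : RMetric} (hcomp : M.Complete) (p : V2)

lemma ray_contDiff (z : ℂ) : ContDiff ℝ ∞ (ray hcomp p z) :=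
  contDiff_infty_of_hasDerivAt (jacField_contDiff M) (hasDerivAt_ray hcomp p z)

lemma isGeodesic_ray (z : ℂ) : M.IsGeodesic fun t => (ray hcomp p z t).1.1 := by
  refine ⟨((contDiff_fst.comp (contDiff_fst.comp (ray_contDiff hcomp p z))).of_le
    (WithTop.coe_le_coe.2 (le_top : (2:ℕ∞) ≤ ⊤))), fun t k => ?_⟩
  have hv : ∀ t, vel (fun t => (ray hcomp p z t).1.1) t = (ray hcomp p z t).1.2 := fun t =>
    vel_eq_deriv (hasDerivAt_ray_pos hcomp p z t)
  have ha : acc (fun t => (ray hcomp p z t).1.1) t k =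
      -chr M (ray hcomp p z t).1.1 (ray hcomp p z t).1.2 (ray hcomp p z t).1.2 k := by
    have h := hasDerivAt_pi.1 (hasDerivAt_ray_vel hcomp p z t) k
    rw [acc, ← Pi.neg_apply, ← h.deriv]
    congr 1
    funext s
    exact congrFun (hv s) k
  rw [ha, hv, chr]
  ring

lemma jac_pos_of_norm_one (hconj : M.NoConjugatePoints) {z : ℂ} (hz : ‖z‖ = 1) {t : ℝ} (ht : 0 < t) :
    0 < (ray hcomp p z t).2.1 := by
  have hv : ∀ t, vel (fun t => (ray hcomp p z t).1.1) t = (ray hcomp p z t).1.2 := fun t =>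
    vel_eq_deriv (hasDerivAt_ray_pos hcomp p z t)
  have hd1 : deriv (fun t => (ray hcomp p z t).2.1) = fun t => (ray hcomp p z t).2.2 :=
    funext fun t => (hasDerivAt_ray_jac hcomp p z t).deriv
  have hd2 : deriv (fun t => (ray hcomp p z t).2.2) = fun t =>
      -(M.K (ray hcomp p z t).1.1 * ‖z‖ ^ 2 * (ray hcomp p z t).2.1) :=
    funext fun t => (hasDerivAt_ray_jac' hcomp p z t).deriv
  have hc : Continuous fun t => (ray hcomp p z t).2.1 :=
    continuous_fst.comp (continuous_snd.comp (ray_contDiff hcomp p z).continuous)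
  have h0 : (ray hcomp p z 0).2.1 = 0 := by rw [ray_zero]
  have hpos : ∀ᶠ s in 𝓝[>] (0:ℝ), 0 < (ray hcomp p z s).2.1 := by
    have h1 := (hasDerivAt_ray_jac hcomp p z 0).tendsto_slope
    rw [ray_zero] at h1
    have h2 := (h1.eventually_const_lt one_pos).filter_mono
      (nhdsWithin_mono (0:ℝ) fun s (hs : 0 < s) => hs.ne')
    filter_upwards [h2, self_mem_nhdsWithin] with s hs hs0
    rw [slope_def_field, h0, sub_zero, sub_zero] at hs
    exact (div_pos_iff_of_pos_right hs0).1 hs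
  obtain ⟨t₁, ht₁⟩ := hpos.exists
  have hne : ∀ t, 0 < t → (ray hcomp p z t).2.1 ≠ 0 := by
    intro t ht
    refine hconj (fun t => (ray hcomp p z t).1.1) (isGeodesic_ray hcomp p z) (fun t => ?_)
      (fun t => (ray hcomp p z t).2.1) ?_ (fun t => ?_) ⟨t₁, ht₁.ne'⟩ 0 h0 t ht.ne'
    · rw [hv, met_ray, hz, one_pow]
    · exact (contDiff_fst.comp (contDiff_snd.comp (ray_contDiff hcomp p z))).of_le
        (WithTop.coe_le_coe.2 (le_top : (2:ℕ∞) ≤ ⊤))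
    · rw [hd1, hd2]
      simp [hz]
  by_contra hneg
  obtain ⟨s, hs, hst⟩ := (hpos.and (Ioo_mem_nhdsGT ht)).exists
  obtain ⟨r, hr, hr0⟩ := intermediate_value_Icc' hst.2.le hc.continuousOn ⟨not_lt.1 hneg, hs.le⟩
  exact hne r (hst.1.trans_le hr.1) hr0

lemma jac_one_pos (hconj : M.NoConjugatePoints) (z : ℂ) : 0 < (ray hcomp p z 1).2.1 := by
  by_cases hz : z = 0
  · rw [hz, ray_origin hcomp p zero_le_one]; exact one_pos
  have hn : 0 < ‖z‖ := norm_pos_iff.2 hz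
  have e : z = (‖z‖ : ℂ) * (z / ‖z‖) := by
    field_simp [Complex.ofReal_ne_zero.2 hn.ne']
  rw [e, jac_smul hcomp p _ hn]
  refine mul_pos (inv_pos.2 hn) (jac_pos_of_norm_one hcomp p hconj ?_ hn)
  simp [hn.ne']

/-- The derivative of the exponential map at the origin. -/
lemma hasStrictFDerivAt_expMap_zero : HasStrictFDerivAt (expMap hcomp p) (frame M p) 0 := by
  have h := hasStrictFDerivAt_solution_family (geoField_contDiff_one M) (W := ℂ)
    (X := fun z t => (ray hcomp p z t).1) (x₀ := (p, 0)) (ι := (0 : ℂ →L[ℝ] V2).prod (frame M p))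
    (D := (frame M p).prod (frame M p))
    (fun z t => hasDerivAt_fst_comp (hasDerivAt_ray hcomp p z t)) (fun z => by simp [ray_zero])
    0 zero_le_one fun w => ⟨fun t => (t • frame M p w, frame M p w), by simp, by simp, fun t => ?_⟩
  · exact (ContinuousLinearMap.fst ℝ V2 V2).hasStrictFDerivAt.comp 0 h
  · have e : ∀ x u : V2, -(dchr M x (t • u) 0 0 + (2 : ℝ) • chr M x 0 u) = 0 := by
      intro x u; ext k; simp [dchr, chr]
    have hv : (ray hcomp p 0 t).1.2 = 0 := by
      by_contra hv
      have := met_ray hcomp p 0 t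
      rw [norm_zero] at this
      exact (met_pos M hv).ne' (by simpa using this)
    rw [fderiv_geoField, hv, e]
    exact (((hasDerivAt_id' t).smul_const _).congr_deriv (one_smul _ _)).prodMk (hasDerivAt_const _ _)

/-- The radial coordinate of a tangent vector at `z`. -/
def radialCLM (z : ℂ) : ℂ →L[ℝ] ℝ := Complex.reCLM.comp (ContinuousLinearMap.mul ℝ ℂ z⁻¹)

/-- The angular coordinate of a tangent vector at `z`. -/
def angularCLM (z : ℂ) : ℂ →L[ℝ] ℝ := Complex.imCLM.comp (ContinuousLinearMap.mul ℝ ℂ z⁻¹)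

lemma radialCLM_apply (z w : ℂ) : radialCLM z w = (z⁻¹ * w).re := rfl

lemma angularCLM_apply (z w : ℂ) : angularCLM z w = (z⁻¹ * w).im := rfl

lemma radial_angular {z : ℂ} (hz : z ≠ 0) (w : ℂ) :
    radialCLM z w • z + angularCLM z w • (Complex.I * z) = w := by
  have h := Complex.re_add_im (z⁻¹ * w)
  rw [Complex.real_smul, Complex.real_smul, radialCLM_apply, angularCLM_apply]
  calc _ = (((z⁻¹ * w).re : ℂ) + (z⁻¹ * w).im * Complex.I) * z := by ring
    _ = w := by rw [h]; field_simp

/-- The derivative of the exponential map: radial and normal Jacobi fields. -/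
lemma hasStrictFDerivAt_expMap {z : ℂ} (hz : z ≠ 0) : HasStrictFDerivAt (expMap hcomp p)
    ((radialCLM z).smulRight (ray hcomp p z 1).1.2 + (angularCLM z).smulRight
      ((ray hcomp p z 1).2.1 • rot M (ray hcomp p z 1).1.1 (ray hcomp p z 1).1.2)) z := by
  let T : ℝ → V2 × V2 := fun t => (t • (ray hcomp p z t).1.2, (ray hcomp p z t).1.2 -
    t • chr M (ray hcomp p z t).1.1 (ray hcomp p z t).1.2 (ray hcomp p z t).1.2)
  let N : ℝ → V2 := fun t => rot M (ray hcomp p z t).1.1 (ray hcomp p z t).1.2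
  let Y : ℝ → V2 × V2 := fun t => ((ray hcomp p z t).2.1 • N t, (ray hcomp p z t).2.2 • N t -
    (ray hcomp p z t).2.1 • chr M (ray hcomp p z t).1.1 (ray hcomp p z t).1.2 (N t))
  have hT : ∀ t, HasDerivAt T (fderiv ℝ (geoField M) (ray hcomp p z t).1 (T t)) t := fun t =>
    hasDerivAt_tangent_jacobi M (v := fun t => (ray hcomp p z t).1.2) (hasDerivAt_ray_pos hcomp p z t)
      (hasDerivAt_ray_vel hcomp p z t)
  have hY : ∀ t, HasDerivAt Y (fderiv ℝ (geoField M) (ray hcomp p z t).1 (Y t)) t := fun t =>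
    hasDerivAt_normal_jacobi M (v := fun t => (ray hcomp p z t).1.2) (k := fun t => (ray hcomp p z t).2.2)
      (hasDerivAt_ray_pos hcomp p z t) (hasDerivAt_ray_vel hcomp p z t) (hasDerivAt_ray_jac hcomp p z t)
      (by rw [met_ray]; exact hasDerivAt_ray_jac' hcomp p z t)
  have h := hasStrictFDerivAt_solution_family (geoField_contDiff_one M) (W := ℂ)
    (X := fun z t => (ray hcomp p z t).1) (x₀ := (p, 0)) (ι := (0 : ℂ →L[ℝ] V2).prod (frame M p))
    (D := (radialCLM z).smulRight (T 1) + (angularCLM z).smulRight (Y 1))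
    (fun z t => hasDerivAt_fst_comp (hasDerivAt_ray hcomp p z t)) (fun z => by simp [ray_zero])
    z zero_le_one fun w => ⟨fun t => radialCLM z w • T t + angularCLM z w • Y t, ?_, rfl, fun t => ?_⟩
  · have := (ContinuousLinearMap.fst ℝ V2 V2).hasStrictFDerivAt.comp z h
    refine this.congr_fderiv ?_
    ext w
    simp [T, Y, N]
  · have e := congrArg (frame M p) (radial_angular hz w)
    rw [map_add, map_smul, map_smul, ← rot_frame] at e
    simp only [T, Y, N, ray_zero, zero_smul, sub_zero, one_smul]
    ext1
    · simp
    · simpa using e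
  · rw [map_add, map_smul, map_smul]
    exact ((hT t).fun_const_smul (radialCLM z w)).fun_add ((hY t).fun_const_smul (angularCLM z w))

lemma hasStrictFDerivAt_expMap_fderiv (z : ℂ) :
    HasStrictFDerivAt (expMap hcomp p) (fderiv ℝ (expMap hcomp p) z) z := by
  by_cases hz : z = 0
  · have h := hasStrictFDerivAt_expMap_zero hcomp p
    rw [hz, h.hasFDerivAt.fderiv]
    exact h
  · have h := hasStrictFDerivAt_expMap hcomp p hz
    rw [h.hasFDerivAt.fderiv]
    exact h

/-- The Gauss lemma: in polar coordinates, the metric is `dr² + j² dθ²`. -/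
lemma met_fderiv_expMap {z : ℂ} (hz : z ≠ 0) (w : ℂ) :
    M.met (expMap hcomp p z) (fderiv ℝ (expMap hcomp p) z w) (fderiv ℝ (expMap hcomp p) z w) =
      ‖z‖ ^ 2 * (radialCLM z w ^ 2 + (angularCLM z w * (ray hcomp p z 1).2.1) ^ 2) := by
  rw [(hasStrictFDerivAt_expMap hcomp p hz).hasFDerivAt.fderiv]
  simp only [add_apply, ContinuousLinearMap.smulRight_apply, expMap, met_add_left,
    met_add_right, met_smul_left, met_smul_right, met_self_rot, met_rot_rot, met_ray,
    met_comm M _ (rot M _ _) (ray hcomp p z 1).1.2]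
  ring

/-- The Jacobian of the exponential map. -/
lemma wedge_fderiv_expMap (z w₁ w₂ : ℂ) :
    wedge (fderiv ℝ (expMap hcomp p) z w₁) (fderiv ℝ (expMap hcomp p) z w₂) *
      √(M.g (expMap hcomp p z)).det = (ray hcomp p z 1).2.1 * (w₁.re * w₂.im - w₁.im * w₂.re) := by
  by_cases hz : z = 0
  · subst hz
    rw [(hasStrictFDerivAt_expMap_zero hcomp p).hasFDerivAt.fderiv, expMap_zero, wedge_frame,
      ray_origin hcomp p zero_le_one, one_mul]
  · rw [(hasStrictFDerivAt_expMap hcomp p hz).hasFDerivAt.fderiv]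
    have h1 := wedge_rot M (ray hcomp p z 1).1.1 (ray hcomp p z 1).1.2
    rw [met_ray, Complex.sq_norm, Complex.normSq_apply] at h1
    have h2 : w₁.re * w₂.im - w₁.im * w₂.re = (radialCLM z w₁ * angularCLM z w₂ -
        angularCLM z w₁ * radialCLM z w₂) * (z.re * z.re + z.im * z.im) := by
      nth_rw 1 2 [← radial_angular hz w₁]
      nth_rw 1 2 [← radial_angular hz w₂]
      simp only [Complex.add_re, Complex.add_im, Complex.real_smul, Complex.mul_re, Complex.mul_im,
        Complex.I_re, Complex.I_im, Complex.ofReal_re, Complex.ofReal_im]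
      ring
    rw [h2, ← h1]
    simp only [wedge, expMap, add_apply, ContinuousLinearMap.smulRight_apply,
      Pi.add_apply, Pi.smul_apply, smul_eq_mul]
    ring

lemma injective_fderiv_expMap (hconj : M.NoConjugatePoints) (z : ℂ) :
    Function.Injective (fderiv ℝ (expMap hcomp p) z) := by
  rw [injective_iff_map_eq_zero]
  intro w hw
  have h := wedge_fderiv_expMap hcomp p z w (Complex.I * w)
  rw [hw] at h
  have hj := jac_one_pos hcomp p hconj z
  simp only [wedge, Pi.zero_apply, zero_mul, sub_zero, Complex.mul_im, Complex.mul_re, Complex.I_re,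
    Complex.I_im, one_mul, zero_add, zero_sub] at h
  have h2 := (mul_eq_zero.1 h.symm).resolve_left hj.ne'
  have h3 : Complex.normSq w = 0 := by rw [Complex.normSq_apply]; linarith
  exact Complex.normSq_eq_zero.1 h3

/-- The derivative of the exponential map, as a linear isomorphism. -/
def expEquiv (hconj : M.NoConjugatePoints) (z : ℂ) : ℂ ≃L[ℝ] V2 :=
  (LinearEquiv.ofInjectiveOfFinrankEq (fderiv ℝ (expMap hcomp p) z).toLinearMap
    (injective_fderiv_expMap hcomp p hconj z) (by simp)).toContinuousLinearEquiv

lemma hasStrictFDerivAt_expEquiv (hconj : M.NoConjugatePoints) (z : ℂ) :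
    HasStrictFDerivAt (expMap hcomp p) (expEquiv hcomp p hconj z : ℂ →L[ℝ] V2) z :=
  (hasStrictFDerivAt_expMap_fderiv hcomp p z).congr_fderiv (by ext1 w; rfl)

lemma isLocalHomeomorph_expMap (hconj : M.NoConjugatePoints) :
    IsLocalHomeomorph (expMap hcomp p) := by
  refine IsLocalHomeomorph.mk _ fun z => ?_
  exact ⟨(hasStrictFDerivAt_expEquiv hcomp p hconj z).toOpenPartialHomeomorph _,
    (hasStrictFDerivAt_expEquiv hcomp p hconj z).mem_toOpenPartialHomeomorph_source, fun _ _ => rfl⟩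

end ExponentialDerivative

noncomputable section PathLifting

open scoped ContDiff Topology
open Metric

/-- Uniform size of the local inverses of a local homeomorphism on a compact set. -/
lemma IsLocalHomeomorph.exists_uniform_target {X Y : Type*} [MetricSpace X] [MetricSpace Y] {f : X → Y}
    (hf : IsLocalHomeomorph f) {K : Set X} (hK : IsCompact K) :
    ∃ ε > 0, ∀ z ∈ K, ∃ e : OpenPartialHomeomorph X Y, z ∈ e.source ∧ f = e ∧
      ball (f z) ε ⊆ e.target := by
  refine hK.induction_on (p := fun S => ∃ ε > 0, ∀ z ∈ S, ∃ e : OpenPartialHomeomorph X Y,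
    z ∈ e.source ∧ f = e ∧ ball (f z) ε ⊆ e.target) ⟨1, one_pos, by simp⟩ ?_ ?_ ?_
  · rintro S T hST ⟨ε, hε, h⟩
    exact ⟨ε, hε, fun z hz => h z (hST hz)⟩
  · rintro S T ⟨ε, hε, h⟩ ⟨ε', hε', h'⟩
    refine ⟨min ε ε', lt_min hε hε', ?_⟩
    rintro z (hz | hz)
    · obtain ⟨e, h1, h2, h3⟩ := h z hz
      exact ⟨e, h1, h2, (ball_subset_ball (min_le_left _ _)).trans h3⟩
    · obtain ⟨e, h1, h2, h3⟩ := h' z hz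
      exact ⟨e, h1, h2, (ball_subset_ball (min_le_right _ _)).trans h3⟩
  · intro z _
    obtain ⟨e, hz, he⟩ := hf z
    have hmem : f z ∈ e.target := by rw [he]; exact e.map_source hz
    obtain ⟨ε, hε, hb⟩ := Metric.isOpen_iff.1 e.open_target _ hmem
    refine ⟨e.source ∩ f ⁻¹' ball (f z) (ε / 2), mem_nhdsWithin_of_mem_nhds
      (inter_mem (e.open_source.mem_nhds hz) (hf.continuous.continuousAt (ball_mem_nhds _ (half_pos hε)))),
      ε / 2, half_pos hε, fun w hw => ⟨e, hw.1, he, fun y hy => hb ?_⟩⟩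
    have h1 := mem_ball.1 hy
    have h2 := mem_ball.1 hw.2
    rw [mem_ball]
    linarith [dist_triangle y (f w) (f z)]

/-- Paths lift through a local homeomorphism as long as the lifts stay in a compact set. -/
lemma IsLocalHomeomorph.exists_lift_of_bound {X Y : Type*} [MetricSpace X] [MetricSpace Y] {f : X → Y}
    (hf : IsLocalHomeomorph f) {K : Set X} (hK : IsCompact K) {c : ℝ → Y} (hc : Continuous c) {x₀ : X}
    (hx₀ : f x₀ = c 0)
    (hb : ∀ s ∈ Icc (0:ℝ) 1, ∀ V : ℝ → X, Continuous V → V 0 = x₀ → (∀ t ∈ Icc 0 s, f (V t) = c t) →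
      V s ∈ K) :
    ∃ V : ℝ → X, Continuous V ∧ V 0 = x₀ ∧ ∀ t ∈ Icc (0:ℝ) 1, f (V t) = c t := by
  obtain ⟨ε, hε, hloc⟩ := hf.exists_uniform_target hK
  obtain ⟨δ, hδ, hcδ⟩ := Metric.uniformContinuousOn_iff.1
    (isCompact_Icc.uniformContinuousOn_of_continuous (hc.continuousOn (s := Icc (0:ℝ) 1))) ε hε
  have hstep : ∀ n : ℕ, ∃ V : ℝ → X, Continuous V ∧ V 0 = x₀ ∧
      ∀ t ∈ Icc (0:ℝ) (min 1 (n * (δ / 2))), f (V t) = c t := by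
    intro n
    induction n with
    | zero =>
      refine ⟨fun _ => x₀, continuous_const, rfl, fun t ht => ?_⟩
      have : t = 0 := le_antisymm (by simpa using ht.2) ht.1
      rw [this, hx₀]
    | succ n ih =>
      obtain ⟨V, hV, hV0, hVc⟩ := ih
      set s := min 1 ((n:ℝ) * (δ / 2)) with hs
      set s' := min 1 (((n + 1 : ℕ):ℝ) * (δ / 2)) with hs'
      have hs0 : 0 ≤ s := by positivity
      have hs1 : s ≤ 1 := min_le_left _ _
      have hs'1 : s' ≤ 1 := min_le_left _ _
      have hss' : s ≤ s' := min_le_min le_rfl (by push_cast; nlinarith)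
      have hs's : s' - s < δ := by
        have : s' ≤ s + δ / 2 := by
          rw [hs, hs', ← min_add_add_right]
          refine min_le_min (by linarith) (by push_cast; linarith)
        linarith
      obtain ⟨e, h1, h2, h3⟩ := hloc _ (hb s ⟨hs0, hs1⟩ V hV hV0 hVc)
      have hVs := hVc s ⟨hs0, le_rfl⟩
      have hcl : Continuous fun t => max s (min t s') := by fun_prop
      have hmem : ∀ t, max s (min t s') ∈ Icc s s' := fun t =>
        ⟨le_max_left _ _, max_le hss' (min_le_right _ _)⟩
      have htar : ∀ t ∈ Icc s s', c t ∈ e.target := by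
        intro t ht
        refine h3 ?_
        rw [hVs]
        refine hcδ t ⟨hs0.trans ht.1, ht.2.trans hs'1⟩ s ⟨hs0, hs1⟩ ?_
        rw [Real.dist_eq, abs_of_nonneg (by linarith [ht.1])]
        linarith [ht.2]
      have hes : e.symm (c s) = V s := by rw [← hVs, h2, e.left_inv h1]
      refine ⟨fun t => if t ≤ s then V t else e.symm (c (max s (min t s'))),
        Continuous.if_le hV (e.continuousOn_symm.comp_continuous (hc.comp hcl) fun t => htar _ (hmem t))
          continuous_id continuous_const fun t ht => ?_, ?_, fun t ht => ?_⟩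
      · simp only [ht, min_eq_left hss', max_self, hes]
      · simp only [hs0, if_true, hV0]
      · by_cases hts : t ≤ s
        · simp only [hts, if_true]; exact hVc t ⟨ht.1, hts⟩
        · push Not at hts
          simp only [not_le.2 hts, if_false, min_eq_left ht.2, max_eq_right hts.le]
          rw [h2, e.right_inv (htar t ⟨hts.le, ht.2⟩)]
  obtain ⟨n, hn⟩ := exists_nat_gt (2 / δ)
  obtain ⟨V, hV, hV0, hVc⟩ := hstep n
  refine ⟨V, hV, hV0, fun t ht => hVc t ⟨ht.1, le_min ht.2 (ht.2.trans ?_)⟩⟩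
  rw [div_lt_iff₀ hδ] at hn
  linarith

end PathLifting

noncomputable section CartanHadamard

open scoped ContDiff Topology
open Metric

variable {M : RMetric} (hcomp : M.Complete) (hconj : M.NoConjugatePoints) (p : V2)

/-- Continuous lifts of differentiable curves through the exponential map are differentiable. -/
lemma hasDerivAt_lift {V : ℝ → ℂ} {c : ℝ → V2} {v : V2} {t : ℝ} (hV : ContinuousAt V t)
    (hc : HasDerivAt c v t) (h : ∀ᶠ s in 𝓝 t, expMap hcomp p (V s) = c s) :
    HasDerivAt V ((expEquiv hcomp p hconj (V t)).symm v) t := by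
  have he := hasStrictFDerivAt_expEquiv hcomp p hconj (V t)
  have h1 := he.to_localInverse.hasFDerivAt
  rw [h.self_of_nhds] at h1
  refine (h1.comp_hasDerivAt t hc).congr_of_eventuallyEq ?_
  filter_upwards [h, hV.eventually he.eventually_left_inverse] with s hs hs'
  rw [Function.comp_apply, ← hs, hs']

lemma expEquiv_apply (z w : ℂ) : expEquiv hcomp p hconj z w = fderiv ℝ (expMap hcomp p) z w := rfl

lemma inner_eq_radial {z : ℂ} (hz : z ≠ 0) (w : ℂ) : inner ℝ z w = ‖z‖ ^ 2 * radialCLM z w := by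
  have h := radial_angular hz w
  nth_rw 1 [← h]
  rw [Complex.inner, Complex.sq_norm, Complex.normSq_apply]
  simp
  ring

lemma norm_mul_radial_le {z : ℂ} (hz : z ≠ 0) (w : ℂ) :
    ‖z‖ * |radialCLM z w| ≤ gnorm M (expMap hcomp p z) (fderiv ℝ (expMap hcomp p) z w) := by
  refine Real.le_sqrt_of_sq_le ?_
  rw [met_fderiv_expMap hcomp p hz, mul_pow, sq_abs]
  nlinarith [mul_nonneg (sq_nonneg ‖z‖) (sq_nonneg (angularCLM z w * (ray hcomp p z 1).2.1))]

lemma inner_le_norm_mul_gnorm (z w : ℂ) : inner ℝ z w ≤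
    ‖z‖ * gnorm M (expMap hcomp p z) (fderiv ℝ (expMap hcomp p) z w) := by
  by_cases hz : z = 0
  · simp [hz]
  · rw [inner_eq_radial hz]
    have h := norm_mul_radial_le hcomp p hz w
    have h1 := le_abs_self (radialCLM z w)
    nlinarith [mul_le_mul_of_nonneg_left h (norm_nonneg z),
      mul_le_mul_of_nonneg_left h1 (sq_nonneg ‖z‖)]

include hconj in
/-- A lift through the exponential map is at most as far from the origin as the curve is long. -/
lemma norm_lift_le {V : ℝ → ℂ} {c v : ℝ → V2} (hV : Continuous V) (hV0 : V 0 = 0) (hv : Continuous v)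
    (hc : ∀ t, HasDerivAt c (v t) t) {s : ℝ} (hs : 0 ≤ s)
    (h : ∀ t ∈ Icc 0 s, expMap hcomp p (V t) = c t) :
    ‖V s‖ ≤ ∫ t in (0:ℝ)..s, gnorm M (c t) (v t) := by
  have hcc : Continuous c := continuous_iff_continuousAt.2 fun t => (hc t).continuousAt
  have hg : Continuous fun t => gnorm M (c t) (v t) := (continuous_gnorm M).comp (hcc.prodMk hv)
  refine le_of_forall_pos_le_add fun ε hε => ?_
  let φ : ℝ → ℝ := fun t => √(‖V t‖ ^ 2 + ε ^ 2)
  have hφpos : ∀ t, 0 < ‖V t‖ ^ 2 + ε ^ 2 := fun t => by positivity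
  have hφd : ∀ t ∈ Ioo 0 s, HasDerivAt φ (inner ℝ (V t) ((expEquiv hcomp p hconj (V t)).symm (v t)) / φ t) t := by
    intro t ht
    have h1 := hasDerivAt_lift hcomp hconj p hV.continuousAt (hc t)
      (mem_of_superset (Icc_mem_nhds ht.1 ht.2) h)
    refine ((h1.norm_sq.add_const (ε ^ 2)).sqrt (hφpos t).ne').congr_deriv ?_
    simp only [φ]
    field_simp
  have hle : ∀ t ∈ Ioo 0 s, inner ℝ (V t) ((expEquiv hcomp p hconj (V t)).symm (v t)) / φ t ≤
      gnorm M (c t) (v t) := by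
    intro t ht
    have hpos : 0 < φ t := Real.sqrt_pos.2 (hφpos t)
    rw [div_le_iff₀ hpos]
    have h1 := inner_le_norm_mul_gnorm hcomp p (V t) ((expEquiv hcomp p hconj (V t)).symm (v t))
    rw [← expEquiv_apply hcomp hconj, ContinuousLinearEquiv.apply_symm_apply, h t ⟨ht.1.le, ht.2.le⟩,
      mul_comm] at h1
    refine h1.trans (mul_le_mul_of_nonneg_left ?_ (gnorm_nonneg M _ _))
    exact Real.le_sqrt_of_sq_le (by nlinarith [sq_nonneg ε])
  have hFTC : ∀ t, HasDerivAt (fun t => ∫ r in (0:ℝ)..t, gnorm M (c r) (v r)) (gnorm M (c t) (v t)) t :=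
    fun t => intervalIntegral.integral_hasDerivAt_right (hg.intervalIntegrable _ _)
      (hg.stronglyMeasurableAtFilter _ _) hg.continuousAt
  have hφc : Continuous φ := by fun_prop
  have hmono : MonotoneOn (fun t => (∫ r in (0:ℝ)..t, gnorm M (c r) (v r)) - φ t) (Icc 0 s) := by
    refine monotoneOn_of_hasDerivWithinAt_nonneg (convex_Icc 0 s) (f' := fun t => gnorm M (c t) (v t) -
      inner ℝ (V t) ((expEquiv hcomp p hconj (V t)).symm (v t)) / φ t) ?_ ?_ ?_
    · exact ((continuous_iff_continuousAt.2 fun t => (hFTC t).continuousAt).sub hφc).continuousOn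
    · rw [interior_Icc]
      exact fun t ht => ((hFTC t).sub (hφd t ht)).hasDerivWithinAt
    · rw [interior_Icc]
      exact fun t ht => sub_nonneg.2 (hle t ht)
  have := hmono ⟨le_rfl, hs⟩ ⟨hs, le_rfl⟩ hs
  have e0 : φ 0 = ε := by simp [φ, hV0, Real.sqrt_sq hε.le]
  have e1 : ‖V s‖ ≤ φ s := Real.le_sqrt_of_sq_le (by nlinarith [sq_nonneg ε])
  simp only [intervalIntegral.integral_same, e0] at this
  linarith

end CartanHadamard

noncomputable section CartanHadamardHomeomorphism

open scoped ContDiff Topology unitInterval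
open Metric

variable {M : RMetric} (hcomp : M.Complete) (hconj : M.NoConjugatePoints) (p : V2)

include hconj in
lemma exists_lift_segment (q : V2) : ∃ V : ℝ → ℂ, Continuous V ∧ V 0 = 0 ∧
    ∀ t ∈ Icc (0:ℝ) 1, expMap hcomp p (V t) = p + t • (q - p) := by
  have hc : ∀ t : ℝ, HasDerivAt (fun t : ℝ => p + t • (q - p)) (q - p) t := fun t => by
    simpa using ((hasDerivAt_id t).smul_const (q - p)).const_add p
  have hcc : Continuous fun t : ℝ => p + t • (q - p) := by fun_prop
  have hg : Continuous fun t : ℝ => gnorm M (p + t • (q - p)) (q - p) :=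
    (continuous_gnorm M).comp (hcc.prodMk continuous_const)
  refine (isLocalHomeomorph_expMap hcomp p hconj).exists_lift_of_bound (isCompact_closedBall (0:ℂ)
    (∫ t in (0:ℝ)..1, gnorm M (p + t • (q - p)) (q - p))) hcc (by simp [expMap_zero]) ?_
  intro s hs V hV hV0 hVc
  rw [mem_closedBall_zero_iff]
  refine (norm_lift_le hcomp hconj p hV hV0 continuous_const hc hs.1 hVc).trans ?_
  exact intervalIntegral.integral_mono_interval le_rfl hs.1 hs.2
    (Eventually.of_forall fun t => gnorm_nonneg M _ _) (hg.intervalIntegrable _ _)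

include hconj in
/-- The Cartan–Hadamard theorem: the exponential map has a continuous inverse. -/
lemma exists_continuous_inverse : ∃ F : V2 → ℂ, Continuous F ∧ (∀ q, expMap hcomp p (F q) = q) ∧
    ∀ z, F (expMap hcomp p z) = z := by
  have hloc := isLocalHomeomorph_expMap hcomp p hconj
  have hsep : IsSeparatedMap (expMap hcomp p) := T2Space.isSeparatedMap _
  choose V hV hV0 hVc using exists_lift_segment hcomp hconj p
  have hg := hloc.continuous_lift hsep (A := V2)
    ⟨fun x : I × V2 => p + (x.1 : ℝ) • (x.2 - p), by fun_prop⟩ (g := fun x => V x.2 x.1)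
    (by ext1 x; exact hVc x.2 _ x.1.2) (by simp only [Icc.coe_zero, hV0]; exact continuous_const)
    (fun q => (hV q).comp continuous_subtype_val)
  let F : V2 → ℂ := fun q => V q 1
  have hF : Continuous F := hg.comp (continuous_const.prodMk continuous_id : Continuous fun q => ((1 : I), q))
  have hFr : ∀ q, expMap hcomp p (F q) = q := fun q => by
    have := hVc q 1 ⟨zero_le_one, le_rfl⟩
    rw [this]; simp
  refine ⟨F, hF, hFr, ?_⟩
  have hFp : F p = 0 := by
    have := hsep.eq_of_comp_eq hloc.isLocallyInjective (g₁ := fun t : I => V p t) (g₂ := fun _ => 0)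
      ((hV p).comp continuous_subtype_val) continuous_const
      (by ext1 t; simp [hVc p t t.2, expMap_zero]) 0 (hV0 p)
    simpa using congrFun this 1
  have := hsep.eq_of_comp_eq hloc.isLocallyInjective (g₁ := fun z => F (expMap hcomp p z)) (g₂ := id)
    (hF.comp (continuous_expMap hcomp p)) continuous_id (by ext1 z; simp [hFr]) 0
    (by simp [expMap_zero, hFp])
  exact congrFun this

/-- The exponential map as a homeomorphism. -/
def expHomeo : ℂ ≃ₜ V2 where
  toFun := expMap hcomp p
  invFun := (exists_continuous_inverse hcomp hconj p).choose
  left_inv := (exists_continuous_inverse hcomp hconj p).choose_spec.2.2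
  right_inv := (exists_continuous_inverse hcomp hconj p).choose_spec.2.1
  continuous_toFun := continuous_expMap hcomp p
  continuous_invFun := (exists_continuous_inverse hcomp hconj p).choose_spec.1

lemma expHomeo_apply (z : ℂ) : expHomeo hcomp hconj p z = expMap hcomp p z := rfl

include hconj in
/-- The exponential map is a radial isometry. -/
lemma rdist_expMap (z : ℂ) : M.dist p (expMap hcomp p z) = ‖z‖ := by
  refine le_antisymm ?_ (le_rdist M fun c v hv hc h0 h1 => ?_)
  · have h := rdist_le_integral M (c := fun t => (ray hcomp p z t).1.1) (v := fun t => (ray hcomp p z t).1.2)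
      zero_le_one ((contDiff_snd.comp (contDiff_fst.comp (ray_contDiff hcomp p z))).continuous.continuousOn)
      (fun t _ => (hasDerivAt_ray_pos hcomp p z t).hasDerivWithinAt)
    simp only [gnorm, met_ray, Real.sqrt_sq (norm_nonneg z), ray_zero] at h
    simpa [expMap] using h
  · have hcc : Continuous c := continuous_iff_continuousAt.2 fun t => (hc t).continuousAt
    have h := norm_lift_le hcomp hconj p (V := fun t => (expHomeo hcomp hconj p).symm (c t))
      ((expHomeo hcomp hconj p).symm.continuous.comp hcc) (by
        rw [h0, Homeomorph.symm_apply_eq, expHomeo_apply, expMap_zero]) hv hc zero_le_one (fun t _ => by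
        rw [← expHomeo_apply hcomp hconj, Homeomorph.apply_symm_apply])
    rwa [h1, ← expHomeo_apply hcomp hconj, Homeomorph.symm_apply_apply] at h

include hconj in
lemma ball_eq_image (r : ℝ) : M.ball p r = expMap hcomp p '' Metric.ball 0 r := by
  ext q
  constructor
  · intro hq
    refine ⟨(expHomeo hcomp hconj p).symm q, ?_, (expHomeo hcomp hconj p).apply_symm_apply q⟩
    rw [mem_ball_zero_iff, ← rdist_expMap hcomp hconj p, ← expHomeo_apply hcomp hconj,
      Homeomorph.apply_symm_apply]
    exact hq
  · rintro ⟨z, hz, rfl⟩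
    rw [mem_ball_zero_iff, ← rdist_expMap hcomp hconj p] at hz
    exact hz

include hconj in
lemma sphere_eq_image (r : ℝ) : M.sphere p r = expMap hcomp p '' Metric.sphere 0 r := by
  ext q
  constructor
  · intro hq
    refine ⟨(expHomeo hcomp hconj p).symm q, ?_, (expHomeo hcomp hconj p).apply_symm_apply q⟩
    rw [mem_sphere_zero_iff_norm, ← rdist_expMap hcomp hconj p, ← expHomeo_apply hcomp hconj,
      Homeomorph.apply_symm_apply]
    exact hq
  · rintro ⟨z, hz, rfl⟩
    rw [mem_sphere_zero_iff_norm, ← rdist_expMap hcomp hconj p] at hz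
    exact hz

end CartanHadamardHomeomorphism

noncomputable section AreaInPolarCoordinates

open scoped ContDiff Topology
open Metric

variable {M : RMetric} (hcomp : M.Complete) (hconj : M.NoConjugatePoints) (p : V2)

lemma det_eq_wedge (T : V2 →L[ℝ] V2) : T.det = wedge (T ![1, 0]) (T ![0, 1]) := by
  have h0 : (![1, 0] : V2) = Pi.single 0 1 := by ext i; fin_cases i <;> simp
  have h1 : (![0, 1] : V2) = Pi.single 1 1 := by ext i; fin_cases i <;> simp
  rw [ContinuousLinearMap.det, ← LinearMap.det_toMatrix', Matrix.det_fin_two, h0, h1]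
  simp [LinearMap.toMatrix'_apply, wedge]
  ring

/-- The standard identification of the real plane with the complex plane. -/
def toComplexCLM : V2 →L[ℝ] ℂ :=
  (ContinuousLinearMap.proj 0).smulRight (1 : ℂ) + (ContinuousLinearMap.proj 1).smulRight Complex.I

lemma toComplexCLM_apply (v : V2) : toComplexCLM v = Complex.measurableEquivPi.symm v := by
  simp [toComplexCLM, Complex.measurableEquivPi_symm_apply]

include hconj in
/-- The area formula for the exponential map. -/
lemma setIntegral_image_expMap {s : Set ℂ} (hs : MeasurableSet s) (f : V2 → ℝ) :
    ∫ q in expMap hcomp p '' s, f q ∂M.area =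
      ∫ z in s, (ray hcomp p z 1).2.1 * f (expMap hcomp p z) := by
  have hms : MeasurableSet (expMap hcomp p '' s) :=
    (expHomeo hcomp hconj p).measurableEmbedding.measurableSet_image.2 hs
  have hsqrt : Continuous fun q => √(M.g q).det := (det_smooth M).continuous.sqrt
  rw [RMetric.area, setIntegral_withDensity_eq_setIntegral_toReal_smul
    hsqrt.measurable.ennreal_ofReal (Eventually.of_forall fun _ => ENNReal.ofReal_lt_top) _ hms]
  simp only [ENNReal.toReal_ofReal (Real.sqrt_nonneg _)]
  have him : expMap hcomp p '' s = (fun x => expMap hcomp p (toComplexCLM x)) ''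
      (Complex.measurableEquivPi.symm ⁻¹' s) := by
    simp only [toComplexCLM_apply]
    rw [← image_image (expMap hcomp p) (fun x => Complex.measurableEquivPi.symm x),
      image_preimage_eq _ Complex.measurableEquivPi.symm.surjective]
  have hinj : Function.Injective fun x => expMap hcomp p (toComplexCLM x) := by
    simp only [toComplexCLM_apply]
    exact (expHomeo hcomp hconj p).injective.comp Complex.measurableEquivPi.symm.injective
  rw [him, integral_image_eq_integral_abs_det_fderiv_smul volume
    (f := fun x => expMap hcomp p (toComplexCLM x))
    (f' := fun x => (fderiv ℝ (expMap hcomp p) (toComplexCLM x)).comp toComplexCLM)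
    (Complex.measurableEquivPi.symm.measurable hs)
    (fun x _ => ((hasStrictFDerivAt_expMap_fderiv hcomp p _).hasFDerivAt.comp x
      toComplexCLM.hasFDerivAt).hasFDerivWithinAt) hinj.injOn]
  rw [← (Complex.volume_preserving_equiv_pi.symm Complex.measurableEquivPi).setIntegral_preimage_emb
    Complex.measurableEquivPi.symm.measurableEmbedding]
  refine setIntegral_congr_fun (Complex.measurableEquivPi.symm.measurable hs) fun x _ => ?_
  simp only [smul_eq_mul, ← toComplexCLM_apply]
  have hw := wedge_fderiv_expMap hcomp p (toComplexCLM x) (toComplexCLM ![1, 0]) (toComplexCLM ![0, 1])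
  have e : (toComplexCLM ![1, 0]).re * (toComplexCLM ![0, 1]).im -
      (toComplexCLM ![1, 0]).im * (toComplexCLM ![0, 1]).re = 1 := by simp [toComplexCLM]
  rw [e, mul_one] at hw
  rw [det_eq_wedge, ← mul_assoc, ← hw, abs_of_nonneg]
  · rfl
  · refine nonneg_of_mul_nonneg_left ?_ (sqrt_det_pos M (expMap hcomp p (toComplexCLM x)))
    refine le_of_le_of_eq (jac_one_pos hcomp p hconj (toComplexCLM x)).le hw.symm

/-- The unit complex number with argument `θ`. -/
def dir (θ : ℝ) : ℂ := Real.cos θ + Real.sin θ * Complex.I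

lemma continuous_dir : Continuous dir := by unfold dir; fun_prop

lemma dir_eq_exp (θ : ℝ) : dir θ = Complex.exp (θ * Complex.I) := by
  rw [dir, Complex.exp_mul_I, Complex.ofReal_cos, Complex.ofReal_sin]

lemma norm_dir (θ : ℝ) : ‖dir θ‖ = 1 := by rw [dir_eq_exp, Complex.norm_exp_ofReal_mul_I]

lemma continuous_ray_dir : Continuous fun q : ℝ × ℝ => ray hcomp p (dir q.2) q.1 :=
  (continuous_ray hcomp p).comp ((continuous_dir.comp continuous_snd).prodMk continuous_fst)

include hconj in
lemma setIntegral_ball {f : V2 → ℝ} (hf : Continuous f) {r : ℝ} (hr : 0 < r) :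
    ∫ q in M.ball p r, f q ∂M.area = ∫ t in (0:ℝ)..r, ∫ θ in (-π)..π,
      (ray hcomp p (dir θ) t).2.1 * f (ray hcomp p (dir θ) t).1.1 := by
  rw [ball_eq_image hcomp hconj, setIntegral_image_expMap hcomp hconj p measurableSet_ball,
    ← integral_indicator measurableSet_ball, ← Complex.integral_comp_polarCoord_symm,
    polarCoord_target]
  have hcont : Continuous fun q : ℝ × ℝ =>
      (ray hcomp p (dir q.2) q.1).2.1 * f (ray hcomp p (dir q.2) q.1).1.1 :=
    (continuous_fst.comp (continuous_snd.comp (continuous_ray_dir hcomp p))).mul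
      (hf.comp (continuous_fst.comp (continuous_fst.comp (continuous_ray_dir hcomp p))))
  have hsub : Ioo 0 r ×ˢ Ioo (-π) π ⊆ Ioi (0:ℝ) ×ˢ Ioo (-π) π :=
    prod_mono_left Ioo_subset_Ioi_self
  rw [setIntegral_eq_of_subset_of_forall_sdiff_eq_zero
    (measurableSet_Ioi.prod measurableSet_Ioo) hsub, setIntegral_congr_fun
      (measurableSet_Ioo.prod measurableSet_Ioo) (g := fun q : ℝ × ℝ =>
      (ray hcomp p (dir q.2) q.1).2.1 * f (ray hcomp p (dir q.2) q.1).1.1)]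
  · rw [Measure.volume_eq_prod, setIntegral_prod, intervalIntegral.integral_of_le hr.le,
      ← integral_Ioc_eq_integral_Ioo]
    · refine setIntegral_congr_fun measurableSet_Ioc fun t _ => ?_
      simp only
      rw [intervalIntegral.integral_of_le (by linarith [pi_pos]), ← integral_Ioc_eq_integral_Ioo]
    · exact (hcont.continuousOn.integrableOn_compact (isCompact_Icc.prod isCompact_Icc)).mono_set
        (prod_mono Ioo_subset_Icc_self Ioo_subset_Icc_self)
  · rintro ⟨t, θ⟩ ⟨⟨ht0, htr⟩, -⟩
    have e : (Complex.polarCoord.symm (t, θ) : ℂ) = t * dir θ := Complex.polarCoord_symm_apply _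
    have hmem : (t : ℂ) * dir θ ∈ ball (0:ℂ) r := by
      rw [mem_ball_zero_iff, norm_mul, norm_dir, Complex.norm_real, Real.norm_of_nonneg ht0.le, mul_one]
      exact htr
    simp only [e, indicator_of_mem hmem, smul_eq_mul]
    rw [expMap_smul hcomp p _ ht0.le, jac_smul hcomp p _ ht0, ← mul_assoc,
      mul_inv_cancel_left₀ ht0.ne']
  · rintro ⟨t, θ⟩ ⟨⟨ht0, hθ⟩, h⟩
    have e : (Complex.polarCoord.symm (t, θ) : ℂ) = t * dir θ := Complex.polarCoord_symm_apply _
    have hmem : (t : ℂ) * dir θ ∉ ball (0:ℂ) r := by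
      rw [mem_ball_zero_iff, norm_mul, norm_dir, Complex.norm_real, Real.norm_of_nonneg ht0.le, mul_one]
      exact fun hlt => h ⟨⟨ht0, hlt⟩, hθ⟩
    simp only [e, indicator_of_notMem hmem, smul_zero]

/-- The average of an observable over the unit directions at time `t`. -/
def angularIntegral (H : (V2 × V2) × (ℝ × ℝ) → ℝ) (t : ℝ) : ℝ :=
  ∫ θ in (-π)..π, H (ray hcomp p (dir θ) t)

lemma hasDerivAt_angularIntegral {H : (V2 × V2) × (ℝ × ℝ) → ℝ} (hH : ContDiff ℝ ∞ H) (t : ℝ) :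
    HasDerivAt (angularIntegral hcomp p H)
      (angularIntegral hcomp p (fun x => fderiv ℝ H x (jacField M x)) t) t := by
  have hH' : Continuous fun x => fderiv ℝ H x (jacField M x) :=
    (hH.continuous_fderiv (by simp)).clm_apply (jacField_contDiff M).continuous
  have hc := hH.continuous.comp (continuous_ray_dir hcomp p)
  have hc' := hH'.comp (continuous_ray_dir hcomp p)
  obtain ⟨C, hC⟩ := ((isCompact_closedBall t 1).prod (isCompact_Icc (a := -π) (b := π))).exists_bound_of_continuousOn
    hc'.continuousOn
  have hs : ∀ {F : ℝ × ℝ → ℝ}, Continuous F → ∀ t, Continuous fun θ => F (t, θ) := fun hF t =>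
    hF.comp (continuous_const.prodMk continuous_id)
  refine (intervalIntegral.hasDerivAt_integral_of_dominated_loc_of_deriv_le (bound := fun _ => C)
    (F' := fun t θ => fderiv ℝ H (ray hcomp p (dir θ) t) (jacField M (ray hcomp p (dir θ) t)))
    (closedBall_mem_nhds t one_pos)
    (Eventually.of_forall fun t => (hs hc t).aestronglyMeasurable) ((hs hc t).intervalIntegrable _ _)
    (hs hc' t).aestronglyMeasurable (Eventually.of_forall fun θ hθ s hs => ?_)
    intervalIntegrable_const (Eventually.of_forall fun θ _ s _ => ?_)).2
  · rw [uIoc_of_le (by linarith [pi_pos])] at hθ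
    exact hC (s, θ) ⟨hs, Ioc_subset_Icc_self hθ⟩
  · exact ((hH.differentiable (by simp) (ray hcomp p (dir θ) s)).hasFDerivAt).comp_hasDerivAt s
      (hasDerivAt_ray hcomp p (dir θ) s)

lemma contDiff_angularIntegral {H : (V2 × V2) × (ℝ × ℝ) → ℝ} (hH : ContDiff ℝ ∞ H) :
    ContDiff ℝ ∞ (angularIntegral hcomp p H) := by
  refine contDiff_infty.2 fun n => ?_
  induction n generalizing H with
  | zero =>
    exact contDiff_zero.2 (continuous_iff_continuousAt.2 fun t =>
      (hasDerivAt_angularIntegral hcomp p hH t).continuousAt)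
  | succ n ih =>
    rw [Nat.cast_succ, contDiff_succ_iff_deriv]
    refine ⟨fun t => (hasDerivAt_angularIntegral hcomp p hH t).differentiableAt, by simp, ?_⟩
    rw [deriv_eq (hasDerivAt_angularIntegral hcomp p hH)]
    exact ih ((hH.fderiv_right (m := ∞) (by simp)).clm_apply (jacField_contDiff M))

/-- The length of the metric circle of radius `t`, as an integral over the unit directions. -/
def circleLength (t : ℝ) : ℝ := angularIntegral hcomp p (fun x => x.2.1) t

lemma contDiff_circleLength : ContDiff ℝ ∞ (circleLength hcomp p) :=
  contDiff_angularIntegral hcomp p (contDiff_fst.comp contDiff_snd)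

include hconj in
lemma circleLength_pos {t : ℝ} (ht : 0 < t) : 0 < circleLength hcomp p t := by
  refine intervalIntegral.intervalIntegral_pos_of_pos_on ?_
    (fun θ _ => jac_pos_of_norm_one hcomp p hconj (norm_dir θ) ht) (by linarith [pi_pos])
  exact ((continuous_fst.comp (continuous_snd.comp (continuous_ray_dir hcomp p))).comp
    (continuous_const.prodMk continuous_id)).intervalIntegrable _ _

include hconj in
lemma area_ball {r : ℝ} (hr : 0 < r) :
    (M.area (M.ball p r)).toReal = ∫ t in (0:ℝ)..r, circleLength hcomp p t := by
  have h := setIntegral_ball hcomp hconj p (f := fun _ => 1) continuous_const hr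
  simpa [circleLength, angularIntegral, measureReal_def] using h

lemma hasDerivAt_circleLength (t : ℝ) :
    HasDerivAt (circleLength hcomp p) (angularIntegral hcomp p (fun x => x.2.2) t) t := by
  have h := hasDerivAt_angularIntegral hcomp p (H := fun x => x.2.1) (contDiff_fst.comp contDiff_snd) t
  have e : ∀ x : (V2 × V2) × (ℝ × ℝ), fderiv ℝ (fun x : (V2 × V2) × (ℝ × ℝ) => x.2.1) x =
      (ContinuousLinearMap.fst ℝ ℝ ℝ).comp (ContinuousLinearMap.snd ℝ (V2 × V2) (ℝ × ℝ)) := fun x =>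
    ((ContinuousLinearMap.fst ℝ ℝ ℝ).comp (ContinuousLinearMap.snd ℝ (V2 × V2) (ℝ × ℝ))).fderiv
  simp only [e] at h
  exact h

include hconj in
/-- The Gauss–Bonnet formula for metric balls. -/
lemma angularIntegral_snd_snd {r : ℝ} (hr : 0 < r) : angularIntegral hcomp p (fun x => x.2.2) r =
    2 * π - ∫ q in M.ball p r, M.K q ∂M.area := by
  have h := fun t => hasDerivAt_angularIntegral hcomp p (H := fun x => x.2.2) (contDiff_snd.comp contDiff_snd) t
  have e : ∀ x : (V2 × V2) × (ℝ × ℝ), fderiv ℝ (fun x : (V2 × V2) × (ℝ × ℝ) => x.2.2) x =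
      (ContinuousLinearMap.snd ℝ ℝ ℝ).comp (ContinuousLinearMap.snd ℝ (V2 × V2) (ℝ × ℝ)) := fun x =>
    ((ContinuousLinearMap.snd ℝ ℝ ℝ).comp (ContinuousLinearMap.snd ℝ (V2 × V2) (ℝ × ℝ))).fderiv
  simp only [e] at h
  have hd : Continuous (deriv (angularIntegral hcomp p fun x => x.2.2)) :=
    (contDiff_angularIntegral hcomp p (H := fun x => x.2.2) (contDiff_snd.comp contDiff_snd)).continuous_deriv
      (by simp)
  rw [deriv_eq h] at hd
  have hi := intervalIntegral.integral_eq_sub_of_hasDerivAt (fun t _ => h t) (hd.intervalIntegrable 0 r)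
  have h0 : angularIntegral hcomp p (fun x => x.2.2) 0 = 2 * π := by
    simp only [angularIntegral, ray_zero, intervalIntegral.integral_const, smul_eq_mul, mul_one]; ring
  have hK : ∀ t, angularIntegral hcomp p (fun x => ((ContinuousLinearMap.snd ℝ ℝ ℝ).comp
      (ContinuousLinearMap.snd ℝ (V2 × V2) (ℝ × ℝ))) (jacField M x)) t =
      -∫ θ in (-π)..π, (ray hcomp p (dir θ) t).2.1 * M.K (ray hcomp p (dir θ) t).1.1 := fun t => by
    rw [← intervalIntegral.integral_neg]
    refine intervalIntegral.integral_congr fun θ _ => ?_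
    simp [jacField, met_ray, norm_dir, mul_comm]
  rw [setIntegral_ball hcomp hconj p (K_smooth M).continuous hr, ← h0]
  simp only [hK, intervalIntegral.integral_neg] at hi
  linarith

end AreaInPolarCoordinates

noncomputable section LengthOfMetricCircles

open scoped ContDiff Topology
open Metric

variable {M : RMetric} (hcomp : M.Complete) (hconj : M.NoConjugatePoints) (p : V2)

lemma exists_rdist_lt_imp_mem {S O : Set V2} (hS : IsCompact S) (hO : IsOpen O) (hSO : S ⊆ O) :
    ∃ δ > 0, ∀ q ∈ S, ∀ x, M.dist q x < δ → x ∈ O := by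
  obtain ⟨ε, hε, hεO⟩ := hS.exists_thickening_subset_open hO hSO
  obtain ⟨c, hc, hlow⟩ := exists_rdist_lower_bound M hS
  refine ⟨c * min 1 ε, by positivity, fun q hq x hx => hεO (mem_thickening_iff.2 ⟨q, hq, ?_⟩)⟩
  have := lt_of_mul_lt_mul_left ((hlow q hq x).trans_lt hx) hc.le
  rw [dist_eq_norm]
  by_contra! h
  exact absurd this (not_lt.2 (min_le_min_left _ h))

/-- The metric circle of radius `r`, parametrised by the initial direction of radial geodesics. -/
def circle (r θ : ℝ) : V2 := expMap hcomp p (r * dir θ)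

/-- The speed of the metric circle of radius `r`. -/
def circleSpeed (r θ : ℝ) : ℝ := (ray hcomp p (dir θ) r).2.1

lemma continuous_circleSpeed (r : ℝ) : Continuous (circleSpeed hcomp p r) :=
  ((continuous_ray_dir hcomp p).comp (Continuous.prodMk_right r)).snd.fst

include hconj in
lemma circleSpeed_pos {r : ℝ} (hr : 0 < r) (θ : ℝ) : 0 < circleSpeed hcomp p r θ :=
  jac_pos_of_norm_one hcomp p hconj (norm_dir θ) hr

lemma continuous_circle (r : ℝ) : Continuous (circle hcomp p r) :=
  (continuous_expMap hcomp p).comp (continuous_const.mul continuous_dir)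

lemma hasDerivAt_dir (θ : ℝ) : HasDerivAt dir (Complex.I * dir θ) θ := by
  have h := ((Complex.ofRealCLM.hasDerivAt (x := θ)).mul_const Complex.I).cexp
  refine (h.congr_of_eventuallyEq (Eventually.of_forall fun t => dir_eq_exp t)).congr_deriv ?_
  rw [dir_eq_exp]; simp; ring

lemma dir_ne_zero (θ : ℝ) : dir θ ≠ 0 := norm_pos_iff.1 (by rw [norm_dir]; exact one_pos)

include hconj in
lemma rdist_circle_le {r : ℝ} (hr : 0 < r) {a b : ℝ} (hab : a ≤ b) :
    M.dist (circle hcomp p r a) (circle hcomp p r b) ≤ ∫ θ in a..b, circleSpeed hcomp p r θ := by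
  have hd : ∀ θ, HasDerivAt (circle hcomp p r)
      (fderiv ℝ (expMap hcomp p) (r * dir θ) (Complex.I * (r * dir θ))) θ := fun θ => by
    refine ((hasStrictFDerivAt_expMap_fderiv hcomp p _).hasFDerivAt.comp_hasDerivAt θ
      ((hasDerivAt_dir θ).const_mul (r : ℂ))).congr_deriv ?_
    congr 1; ring
  have hne : ∀ θ, (r : ℂ) * dir θ ≠ 0 := fun θ =>
    mul_ne_zero (Complex.ofReal_ne_zero.2 hr.ne') (dir_ne_zero θ)
  have he : ∀ θ, ((r : ℂ) * dir θ)⁻¹ * (Complex.I * (r * dir θ)) = Complex.I := fun θ => by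
    rw [mul_left_comm, inv_mul_cancel₀ (hne θ), mul_one]
  have hg : ∀ θ, gnorm M (circle hcomp p r θ)
      (fderiv ℝ (expMap hcomp p) (r * dir θ) (Complex.I * (r * dir θ))) = circleSpeed hcomp p r θ := fun θ => by
    rw [gnorm, circle, met_fderiv_expMap hcomp p (hne θ), radialCLM_apply, angularCLM_apply, he,
      jac_smul hcomp p _ hr, norm_mul, norm_dir, Complex.norm_real, Real.norm_of_nonneg hr.le]
    rw [← Real.sqrt_sq (circleSpeed_pos hcomp hconj p hr θ).le, circleSpeed]
    congr 1
    simp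
    field_simp
  have hcont : Continuous fun θ =>
      fderiv ℝ (expMap hcomp p) (r * dir θ) (Complex.I * (r * dir θ)) := by
    have hrot : Continuous fun θ => circleSpeed hcomp p r θ •
        rot M (ray hcomp p (dir θ) r).1.1 (ray hcomp p (dir θ) r).1.2 := by
      have hray := ((continuous_ray_dir hcomp p).comp (Continuous.prodMk_right r)).fst
      have hg := fun i j => ((g_smooth M) i j).continuous.comp hray.fst
      have hs := ((det_smooth M).continuous.comp hray.fst).sqrt
      have hv := fun i => (continuous_apply i).comp hray.snd
      refine (continuous_circleSpeed hcomp p r).smul (continuous_pi fun i => ?_)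
      fin_cases i
      · exact (((hg 0 1).mul (hv 0)).add ((hg 1 1).mul (hv 1))).neg.div hs fun θ =>
          (sqrt_det_pos M _).ne'
      · exact (((hg 0 0).mul (hv 0)).add ((hg 0 1).mul (hv 1))).div hs fun θ =>
          (sqrt_det_pos M _).ne'
    refine hrot.congr fun θ => ?_
    rw [(hasStrictFDerivAt_expMap hcomp p (hne θ)).hasFDerivAt.fderiv]
    simp only [add_apply, ContinuousLinearMap.smulRight_apply, radialCLM_apply, angularCLM_apply, he,
      Complex.I_re, Complex.I_im, ray_smul hcomp p _ hr zero_le_one, mul_one, rot_smul, smul_smul,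
      zero_mul, one_mul, zero_smul, zero_add, circleSpeed, mul_right_comm]
    simp [hr.ne']
  refine (rdist_le_integral M hab hcont.continuousOn fun θ _ => (hd θ).hasDerivWithinAt).trans_eq ?_
  exact intervalIntegral.integral_congr fun θ _ => hg θ


lemma norm_mul_jac {t : ℝ} (ht : 0 < t) (θ : ℝ) :
    ‖(t : ℂ) * dir θ‖ * (ray hcomp p (t * dir θ) 1).2.1 = circleSpeed hcomp p t θ := by
  rw [jac_smul hcomp p _ ht, norm_mul, norm_dir, Complex.norm_real, Real.norm_of_nonneg ht.le,
    mul_one, mul_inv_cancel_left₀ ht.ne', circleSpeed]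

include hconj in
lemma abs_angular_mul_le {z : ℂ} (hz : z ≠ 0) (w : ℂ) :
    |(w / z).im| * (‖z‖ * (ray hcomp p z 1).2.1) ≤
      gnorm M (expMap hcomp p z) (fderiv ℝ (expMap hcomp p) z w) := by
  have e : angularCLM z w = (w / z).im := by rw [angularCLM_apply, div_eq_inv_mul]
  have hj := jac_one_pos hcomp p hconj z
  rw [gnorm, met_fderiv_expMap hcomp p hz, e]
  refine Real.le_sqrt_of_sq_le ?_
  rw [mul_pow, sq_abs]
  nlinarith [mul_nonneg (sq_nonneg ‖z‖) (sq_nonneg (radialCLM z w))]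

include hconj in
lemma exists_circle_expansive {r : ℝ} (hr : 0 < r) {ε η : ℝ} (hε : 0 < ε) (hη : 0 < η) :
    ∃ δ > 0, ∀ θ ∈ Icc (-π + η) (π - η), ∀ θ' ∈ Icc (-π + η) (π - η),
      M.dist (circle hcomp p r θ) (circle hcomp p r θ') < δ →
      |∫ φ in θ..θ', circleSpeed hcomp p r φ| ≤
        (1 + ε) * M.dist (circle hcomp p r θ) (circle hcomp p r θ') := by
  let W : Set ℂ := {z | z ∈ Complex.slitPlane ∧
    circleSpeed hcomp p r z.arg < (1 + ε) * (‖z‖ * (ray hcomp p z 1).2.1)}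
  have hcs := continuous_circleSpeed hcomp p r
  have hW : IsOpen W := isOpen_iff_mem_nhds.2 fun z hz => by
    have hray : Continuous fun z => (ray hcomp p z 1).2.1 :=
      ((continuous_ray hcomp p).comp (Continuous.prodMk_left 1)).snd.fst
    exact inter_mem (Complex.isOpen_slitPlane.mem_nhds hz.1)
      ((hcs.continuousAt.comp (Complex.continuousAt_arg hz.1)).eventually_lt
        (continuous_const.mul (continuous_norm.mul hray)).continuousAt hz.2)
  have harg : ∀ θ ∈ Icc (-π + η) (π - η), ((r : ℂ) * dir θ).arg = θ := fun θ hθ => by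
    have h := Complex.arg_mul_cos_add_sin_mul_I hr (θ := θ) ⟨by linarith [hθ.1], by linarith [hθ.2]⟩
    rwa [← Complex.ofReal_cos, ← Complex.ofReal_sin] at h
  have hmem : ∀ θ ∈ Icc (-π + η) (π - η), (r : ℂ) * dir θ ∈ W := fun θ hθ => by
    refine ⟨Complex.mem_slitPlane_iff_arg.2 ⟨?_, ?_⟩, ?_⟩
    · rw [harg θ hθ]; linarith [hθ.2]
    · exact mul_ne_zero (Complex.ofReal_ne_zero.2 hr.ne') (dir_ne_zero θ)
    · rw [harg θ hθ, norm_mul_jac hcomp p hr]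
      nlinarith [circleSpeed_pos hcomp hconj p hr θ]
  let e := expHomeo hcomp hconj p
  obtain ⟨δ, hδ, hδO⟩ := exists_rdist_lt_imp_mem (M := M)
    ((isCompact_Icc (a := -π + η) (b := π - η)).image (continuous_circle hcomp p r))
    (e.isOpenMap _ hW) (by rintro _ ⟨θ, hθ, rfl⟩; exact ⟨_, hmem θ hθ, rfl⟩)
  refine ⟨δ, hδ, fun θ hθ θ' hθ' hd => ?_⟩
  by_contra! hlt
  have h1ε : 0 < 1 + ε := by linarith
  rw [mul_comm, ← lt_div_iff₀ h1ε] at hlt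
  obtain ⟨ℓ, hℓ, hℓ'⟩ := exists_between (lt_min hd hlt)
  obtain ⟨hℓδ, hℓI⟩ := lt_min_iff.1 hℓ'
  rw [lt_div_iff₀ h1ε] at hℓI
  obtain ⟨c, v, hv, hc, hc0, hc1, hlen⟩ := exists_lt_of_rdist_lt M hℓ
  have hcc : Continuous c := continuous_iff_continuousAt.2 fun t => (hc t).continuousAt
  have hgc : Continuous fun t => gnorm M (c t) (v t) := (continuous_gnorm M).comp (hcc.prodMk hv)
  let V : ℝ → ℂ := fun t => e.symm (c t)
  have hVc : Continuous V := e.symm.continuous.comp hcc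
  have hV : ∀ t, expMap hcomp p (V t) = c t := fun t => e.apply_symm_apply _
  have hVcircle : ∀ φ t, c t = circle hcomp p r φ → V t = r * dir φ := fun φ t h =>
    e.symm_apply_eq.2 h
  have hVW : ∀ t ∈ Icc (0:ℝ) 1, V t ∈ W := fun t ht => by
    obtain ⟨z, hz, hzc⟩ := hδO _ (mem_image_of_mem _ hθ) (c t) (by
      rw [← hc0]
      refine (rdist_le_integral M ht.1 hv.continuousOn fun s _ => (hc s).hasDerivWithinAt).trans_lt ?_
      refine lt_of_le_of_lt ?_ (hlen.trans hℓδ)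
      exact intervalIntegral.integral_mono_interval le_rfl ht.1 ht.2
        (Eventually.of_forall fun t => gnorm_nonneg M _ _) (hgc.intervalIntegrable _ _))
    have : V t = z := e.symm_apply_eq.2 hzc.symm
    rwa [this]
  have hQ : ∀ t ∈ Icc (0:ℝ) 1, HasDerivAt (fun t => ∫ φ in θ..(V t).arg, circleSpeed hcomp p r φ)
      (circleSpeed hcomp p r (V t).arg * ((expEquiv hcomp p hconj (V t)).symm (v t) / V t).im) t :=
    fun t ht => by
      have h1 := (hasDerivAt_lift hcomp hconj p hVc.continuousAt (hc t)
        (Eventually.of_forall hV)).clog_real (hVW t ht).1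
      have h2 : HasDerivAt (fun t => (V t).arg)
          ((expEquiv hcomp p hconj (V t)).symm (v t) / V t).im t :=
        (Complex.imCLM.hasFDerivAt.comp_hasDerivAt t h1).congr_of_eventuallyEq
          (Eventually.of_forall fun t => (Complex.log_im _).symm)
      exact (intervalIntegral.integral_hasDerivAt_right (hcs.intervalIntegrable θ (V t).arg)
        (hcs.stronglyMeasurableAtFilter _ _) hcs.continuousAt).comp t h2
  have hB : ∀ t, HasDerivAt (fun t => (1 + ε) * ∫ s in (0:ℝ)..t, gnorm M (c s) (v s))
      ((1 + ε) * gnorm M (c t) (v t)) t := fun t =>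
    (intervalIntegral.integral_hasDerivAt_right (hgc.intervalIntegrable 0 t)
        (hgc.stronglyMeasurableAtFilter _ _) hgc.continuousAt).const_mul _
  have h := image_norm_le_of_norm_deriv_right_le_deriv_boundary
    (fun t ht => (hQ t ht).continuousAt.continuousWithinAt)
    (fun t ht => (hQ t (Ico_subset_Icc_self ht)).hasDerivWithinAt)
    (by simp [hVcircle θ 0 hc0, harg θ hθ]) hB (fun t ht => by
      have hw := hVW t (Ico_subset_Icc_self ht)
      have ha := abs_angular_mul_le hcomp hconj p (Complex.slitPlane_ne_zero hw.1)
        ((expEquiv hcomp p hconj (V t)).symm (v t))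
      rw [hV, ← expEquiv_apply hcomp hconj, ContinuousLinearEquiv.apply_symm_apply] at ha
      rw [norm_mul, Real.norm_eq_abs, Real.norm_eq_abs, abs_of_pos (circleSpeed_pos hcomp hconj p hr _)]
      refine (mul_le_mul_of_nonneg_right hw.2.le (abs_nonneg _)).trans ?_
      rw [mul_assoc, mul_comm (_ * _) |_|]
      exact mul_le_mul_of_nonneg_left ha h1ε.le) (right_mem_Icc.2 zero_le_one)
  rw [hVcircle θ' 1 hc1, harg θ' hθ', Real.norm_eq_abs] at h
  nlinarith

lemma ofReal_rdist_le_ediam {S : Set V2} {x y : V2} (hx : x ∈ S) (hy : y ∈ S) :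
    ENNReal.ofReal (M.dist x y) ≤ M.ediam S :=
  le_iSup₂_of_le x hx (le_iSup₂_of_le y hy le_rfl)

include hconj in
lemma circle_mem_sphere {r : ℝ} (hr : 0 < r) (θ : ℝ) : circle hcomp p r θ ∈ M.sphere p r := by
  rw [RMetric.sphere, mem_ofPred_eq, circle, rdist_expMap hcomp hconj, norm_mul, norm_dir,
    Complex.norm_real, Real.norm_of_nonneg hr.le, mul_one]

include hconj in
lemma sphere_subset_image_circle {r : ℝ} : M.sphere p r ⊆ circle hcomp p r '' Ioc (-π) π := by
  rw [sphere_eq_image hcomp hconj]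
  rintro _ ⟨z, hz, rfl⟩
  refine ⟨z.arg, Complex.arg_mem_Ioc z, ?_⟩
  have h := Complex.norm_mul_cos_add_sin_mul_I z
  rw [mem_sphere_zero_iff_norm.1 hz, ← Complex.ofReal_cos, ← Complex.ofReal_sin] at h
  rw [circle, dir, h]

include hconj in
lemma ediam_image_circle_le {r : ℝ} (hr : 0 < r) (a b : ℝ) :
    M.ediam (circle hcomp p r '' Ioc a b) ≤ ENNReal.ofReal (∫ θ in a..b, circleSpeed hcomp p r θ) := by
  have hcs := continuous_circleSpeed hcomp p r
  have key : ∀ x ∈ Ioc a b, ∀ y ∈ Ioc a b, x ≤ y → M.dist (circle hcomp p r x) (circle hcomp p r y) ≤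
      ∫ θ in a..b, circleSpeed hcomp p r θ := fun x hx y hy hxy =>
    (rdist_circle_le hcomp hconj p hr hxy).trans
      (intervalIntegral.integral_mono_interval hx.1.le hxy hy.2
        (Eventually.of_forall fun θ => (circleSpeed_pos hcomp hconj p hr θ).le) (hcs.intervalIntegrable _ _))
  refine iSup₂_le ?_
  rintro _ ⟨x, hx, rfl⟩
  refine iSup₂_le ?_
  rintro _ ⟨y, hy, rfl⟩
  refine ENNReal.ofReal_le_ofReal ?_
  rcases le_total x y with h | h
  · exact key x hx y hy h
  · rw [rdist_comm]
    exact key y hy x hx h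

include hconj in
lemma H1_sphere_le {r : ℝ} (hr : 0 < r) :
    M.H1 (M.sphere p r) ≤ ENNReal.ofReal (circleLength hcomp p r) := by
  have hcs := continuous_circleSpeed hcomp p r
  have hInt : ∀ a b, IntervalIntegrable (circleSpeed hcomp p r) volume a b := hcs.intervalIntegrable
  obtain ⟨C, hC⟩ := (isCompact_Icc (a := -π) (b := π)).exists_bound_of_continuousOn hcs.continuousOn
  refine iSup₂_le fun δ hδ => ?_
  obtain ⟨N, hN⟩ := exists_nat_gt (C * (2 * π) / δ)
  have hC0 : 0 ≤ C := (norm_nonneg _).trans (hC 0 ⟨by linarith [pi_pos], pi_pos.le⟩)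
  have hN0 : (0:ℝ) < N := lt_of_le_of_lt (by positivity) hN
  let a : ℕ → ℝ := fun n => -π + n * (2 * π / N)
  have ha : Monotone a := fun m n h => by
    have : (m : ℝ) ≤ n := Nat.cast_le.2 h
    exact add_le_add_right (mul_le_mul_of_nonneg_right this (by positivity)) _
  have ha0 : a 0 = -π := by simp [a]
  have haN : a N = π := by simp only [a]; field_simp; ring
  let U : ℕ → Set V2 := fun n => if n < N then circle hcomp p r '' Ioc (a n) (a (n + 1)) else ∅
  have hUle : ∀ n < N, M.ediam (U n) ≤
      ENNReal.ofReal (∫ θ in a n..a (n + 1), circleSpeed hcomp p r θ) := fun n hn => by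
    simp only [U, if_pos hn]
    exact ediam_image_circle_le hcomp hconj p hr _ _
  have hU0 : ∀ n, ¬ n < N → M.ediam (U n) = 0 := fun n hn => by
    simp [U, if_neg hn, RMetric.ediam]
  refine iInf₂_le_of_le U ?_ (iInf_le_of_le (fun n => ?_) ?_)
  · refine (sphere_subset_image_circle hcomp hconj p).trans ?_
    have h := ha.biUnion_Ico_Ioc_map_succ 0 N
    rw [ha0, haN] at h
    rw [← h, image_iUnion₂]
    refine iUnion₂_subset fun i hi => subset_iUnion_of_subset i ?_
    simp only [U, if_pos hi.2]
    exact subset_rfl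
  · by_cases hn : n < N
    · refine (hUle n hn).trans (ENNReal.ofReal_le_ofReal ?_)
      have hb : ∀ θ ∈ uIoc (a n) (a (n + 1)), ‖circleSpeed hcomp p r θ‖ ≤ C := fun θ hθ => by
        rw [uIoc_of_le (ha n.le_succ)] at hθ
        refine hC θ ⟨?_, ?_⟩
        · rw [← ha0]; exact (ha (Nat.zero_le n)).trans hθ.1.le
        · rw [← haN]; exact hθ.2.trans (ha hn)
      refine (le_abs_self _).trans ((intervalIntegral.norm_integral_le_of_norm_le_const hb).trans ?_)
      have e : a (n + 1) - a n = 2 * π / N := by simp only [a]; push_cast; ring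
      rw [e, abs_of_pos (by positivity), ← mul_div_assoc, div_le_iff₀ hN0]
      rw [div_lt_iff₀ hδ] at hN
      linarith
    · rw [hU0 n hn]; exact zero_le
  · rw [tsum_eq_sum (s := Finset.range N) fun n hn => hU0 n (by simpa using hn)]
    refine (Finset.sum_le_sum fun n hn => hUle n (Finset.mem_range.1 hn)).trans ?_
    rw [← ENNReal.ofReal_sum_of_nonneg fun n _ => intervalIntegral.integral_nonneg (ha n.le_succ)
      fun θ _ => (circleSpeed_pos hcomp hconj p hr θ).le,
      intervalIntegral.sum_integral_adjacent_intervals fun n _ => hInt _ _, ha0, haN]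
    exact le_rfl

include hconj in
lemma ofReal_integral_circleSpeed_le {r : ℝ} (hr : 0 < r) {ε η : ℝ} (hε : 0 < ε) (hη : 0 < η)
    (hηπ : η ≤ π) : ENNReal.ofReal (∫ θ in (-π + η)..(π - η), circleSpeed hcomp p r θ) ≤
      ENNReal.ofReal (1 + ε) * M.H1 (M.sphere p r) := by
  have hcs := continuous_circleSpeed hcomp p r
  have hInt : ∀ a b, IntervalIntegrable (circleSpeed hcomp p r) volume a b := hcs.intervalIntegrable
  obtain ⟨δ, hδ, hexp⟩ := exists_circle_expansive hcomp hconj p hr hε hη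
  set a := -π + η with ha
  set b := π - η with hb
  have hab : a ≤ b := by linarith
  refine le_trans (ENNReal.div_le_iff_le_mul (Or.inl ?_) (Or.inl ENNReal.ofReal_ne_top) |>.1 ?_) (mul_comm _ _).le
  · exact (ENNReal.ofReal_pos.2 (by linarith)).ne'
  refine le_iSup₂_of_le (δ / 2) (half_pos hδ) (le_iInf₂ fun U hU => le_iInf fun hUδ => ?_)
  refine ENNReal.div_le_of_le_mul' ?_
  let Ψ : ℝ → ℝ := fun x => ∫ θ in a..x, circleSpeed hcomp p r θ
  have hΨ : Continuous Ψ := intervalIntegral.continuous_primitive hInt a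
  have hΨa : Ψ a = 0 := intervalIntegral.integral_same
  have hcover : Icc 0 (Ψ b) ⊆ ⋃ n, Ψ '' (Icc a b ∩ circle hcomp p r ⁻¹' U n) := fun y hy => by
    rw [← hΨa] at hy
    obtain ⟨θ, hθ, rfl⟩ := intermediate_value_Icc hab hΨ.continuousOn hy
    obtain ⟨n, hn⟩ := mem_iUnion.1 (hU (circle_mem_sphere hcomp hconj p hr θ))
    exact mem_iUnion.2 ⟨n, θ, ⟨hθ, hn⟩, rfl⟩
  have hvol : ENNReal.ofReal (Ψ b) = volume (Icc 0 (Ψ b)) := by rw [Real.volume_Icc, sub_zero]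
  rw [← ENNReal.tsum_mul_left]
  refine hvol.trans_le ((measure_mono hcover).trans ((measure_iUnion_le _).trans ?_))
  refine ENNReal.tsum_le_tsum fun n => (Real.volume_le_diam _).trans (ediam_le ?_)
  rintro _ ⟨θ, ⟨hθ, hθU⟩, rfl⟩ _ ⟨θ', ⟨hθ', hθU'⟩, rfl⟩
  have hle := ofReal_rdist_le_ediam (M := M) (mem_preimage.1 hθU) (mem_preimage.1 hθU')
  have hd : M.dist (circle hcomp p r θ) (circle hcomp p r θ') < δ :=
    ((ENNReal.ofReal_le_ofReal_iff (by linarith)).1 (hle.trans (hUδ n))).trans_lt (half_lt_self hδ)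
  rw [edist_comm, edist_dist, Real.dist_eq,
    intervalIntegral.integral_interval_sub_left (hInt _ _) (hInt _ _)]
  refine (ENNReal.ofReal_le_ofReal (hexp θ hθ θ' hθ' hd)).trans ?_
  rw [ENNReal.ofReal_mul (by linarith)]
  exact mul_le_mul_right hle _

include hconj in
/-- The one-dimensional Hausdorff measure of a metric circle is its length. -/
lemma H1_sphere {r : ℝ} (hr : 0 < r) :
    M.H1 (M.sphere p r) = ENNReal.ofReal (circleLength hcomp p r) := by
  refine le_antisymm (H1_sphere_le hcomp hconj p hr) ?_
  have hcs := continuous_circleSpeed hcomp p r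
  have hInt : ∀ a b, IntervalIntegrable (circleSpeed hcomp p r) volume a b := hcs.intervalIntegrable
  have hI : Continuous fun η : ℝ => ∫ θ in (-π + η)..(π - η), circleSpeed hcomp p r θ := by
    have hΨ := intervalIntegral.continuous_primitive hInt 0
    refine ((hΨ.comp (continuous_const.sub continuous_id : Continuous fun η : ℝ => π - η)).sub
      (hΨ.comp (continuous_const.add continuous_id : Continuous fun η : ℝ => -π + η))).congr fun η => ?_
    exact intervalIntegral.integral_interval_sub_left (hInt _ _) (hInt _ _)
  have h1 : Tendsto (fun η : ℝ => ENNReal.ofReal (∫ θ in (-π + η)..(π - η), circleSpeed hcomp p r θ))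
      (𝓝[>] 0) (𝓝 (ENNReal.ofReal (circleLength hcomp p r))) := by
    have := (ENNReal.continuous_ofReal.comp hI).tendsto 0
    simp only [Function.comp_apply, add_zero, sub_zero] at this
    exact this.mono_left nhdsWithin_le_nhds
  have h2 : Tendsto (fun η : ℝ => ENNReal.ofReal (1 + η) * M.H1 (M.sphere p r)) (𝓝[>] 0)
      (𝓝 (1 * M.H1 (M.sphere p r))) := by
    refine ENNReal.Tendsto.mul_const ?_ (Or.inl one_ne_zero)
    have hc : Continuous fun η : ℝ => ENNReal.ofReal (1 + η) :=
      ENNReal.continuous_ofReal.comp (by fun_prop)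
    have := hc.tendsto 0
    simp only [add_zero, ENNReal.ofReal_one] at this
    exact this.mono_left nhdsWithin_le_nhds
  rw [one_mul] at h2
  refine le_of_tendsto_of_tendsto h1 h2 ?_
  filter_upwards [Ioc_mem_nhdsGT pi_pos] with η hη
  exact ofReal_integral_circleSpeed_le hcomp hconj p hr hη.1 hη.1 hη.2

end LengthOfMetricCircles

/-- **Properties of the ball-area function.** On a complete plane without
conjugate points, `A_p` is positive, non-decreasing and smooth on `(0,∞)`, with
`A_p'(r) = H¹(∂B(p,r))` and `A_p''(r) = 2π - ∫_{B(p,r)} K dA`. -/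
theorem ball_area_function_properties (M : RMetric)
    (hcomp : M.Complete) (hconj : M.NoConjugatePoints) (p : V2) :
    let Ap : ℝ → ℝ := fun r => (M.area (M.ball p r)).toReal
    (∀ r > (0:ℝ), 0 < Ap r) ∧ MonotoneOn Ap (Set.Ioi 0) ∧
      ContDiffOn ℝ (⊤ : ℕ∞) Ap (Set.Ioi 0) ∧
      (∀ r > (0:ℝ), deriv Ap r = (M.H1 (M.sphere p r)).toReal) ∧
      (∀ r > (0:ℝ), deriv (deriv Ap) r = 2 * π - ∫ q in M.ball p r, M.K q ∂M.area) := by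
  intro Ap
  have hS := contDiff_circleLength hcomp p
  have hInt : ∀ a b, IntervalIntegrable (circleLength hcomp p) volume a b :=
    hS.continuous.intervalIntegrable
  have hpos : ∀ {t : ℝ}, 0 < t → 0 < circleLength hcomp p t := circleLength_pos hcomp hconj p
  let P : ℝ → ℝ := fun r => ∫ t in (0:ℝ)..r, circleLength hcomp p t
  have hAP : EqOn Ap P (Ioi 0) := fun r hr => area_ball hcomp hconj p hr
  have hP : ∀ r, HasDerivAt P (circleLength hcomp p r) r := fun r =>
    intervalIntegral.integral_hasDerivAt_right (hInt 0 r)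
      (hS.continuous.stronglyMeasurableAtFilter _ _) hS.continuous.continuousAt
  have hA : ∀ r > 0, HasDerivAt Ap (circleLength hcomp p r) r := fun r hr =>
    (hP r).congr_of_eventuallyEq (hAP.eventuallyEq_of_mem (Ioi_mem_nhds hr))
  refine ⟨fun r hr => ?_, ?_, ?_, fun r hr => ?_, fun r hr => ?_⟩
  · rw [hAP hr]
    exact intervalIntegral.intervalIntegral_pos_of_pos_on (hInt 0 r) (fun t ht => hpos ht.1) hr
  · refine MonotoneOn.congr (f₁ := P) (fun a ha b hb hab => ?_) hAP.symm
    rw [← sub_nonneg, intervalIntegral.integral_interval_sub_left (hInt _ _) (hInt _ _)]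
    exact intervalIntegral.integral_nonneg hab fun t ht => (hpos (lt_of_lt_of_le ha ht.1)).le
  · refine ContDiffOn.congr (f := P) (ContDiff.contDiffOn ?_) hAP
    rw [contDiff_infty_iff_deriv, deriv_eq hP]
    exact ⟨fun r => (hP r).differentiableAt, hS⟩
  · rw [(hA r hr).deriv, H1_sphere hcomp hconj p hr, ENNReal.toReal_ofReal (hpos hr).le]
  · have h : deriv Ap =ᶠ[nhds r] circleLength hcomp p := by
      filter_upwards [Ioi_mem_nhds hr] with t ht using (hA t ht).deriv
    rw [h.deriv_eq, (hasDerivAt_circleLength hcomp p r).deriv,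
      angularIntegral_snd_snd hcomp hconj p hr]
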